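/- Let X₁,…,Xₙ be independent points uniformly distributed in the unit square [0,1]², let P = {X₁,…,Xₙ}, and let U₁ be the number of unordered pairs {u,v} of points of P that are useful order-1 Delaunay edges but not Delaunay edges of P. Then lim_{n→∞} E[U₁]/n = (c₁ + 2c₂)/2 ≈ 0.525785, where c₁ = ∫₀^∞ ∫ₐ^∞ ∫ₐ^∞ 8πa · (2ac/√(c²−a²) − 2c·arcsin(a/c)) · (2ab/√(b²−a²) − 2b·arcsin(a/b)) · exp(−πb² + b²·arcsin(a/b) − a√(b²−a²) − πc² + c²·arcsin(a/c) − a√(c²−a²)) db dc da and c₂ = ∫₀^∞ ∫ₐ^∞ ∫_c^∞ 8πa · (2πc − 2c·arcsin(a/c) + 2ac/√(c²−a²)) · (2ab/√(b²−a²) − 2b·arcsin(a/b)) · exp(−πb² + b²·arcsin(a/b) − a√(b²−a²) − c²·arcsin(a/c) + a√(c²−a²)) db dc da. -/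

import Mathlib

open EuclideanGeometry Set

noncomputable section

/-- Points of the Euclidean plane. -/
abbrev Pt : Type := EuclideanSpace ℝ (Fin 2)

noncomputable instance : DecidableEq Pt := Classical.decEq _

/-- `P` is in general position: no three (distinct) points collinear and
no four (distinct) points concyclic. -/
def GenPos (P : Set Pt) : Prop :=
  (∀ u v w : Pt, u ∈ P → v ∈ P → w ∈ P → u ≠ v → u ≠ w → v ≠ w →
    ¬ Collinear ℝ ({u, v, w} : Set Pt)) ∧
  (∀ u v w z : Pt, u ∈ P → v ∈ P → w ∈ P → z ∈ P →
    u ≠ v → u ≠ w → u ≠ z → v ≠ w → v ≠ z → w ≠ z →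
    ¬ EuclideanGeometry.Cospherical ({u, v, w, z} : Set Pt))

/-- The (closed) triangle spanned by a finite set of points. -/
def triSet (t : Finset Pt) : Set Pt := convexHull ℝ (t : Set Pt)

/-- `T` is a triangulation of `P`: a finite set of triangles with vertices in `P`,
every point of `P` is a vertex of some triangle, the interiors of the triangles are
pairwise disjoint, and their union is the convex hull of `P`. -/
def IsTriangulation (P : Set Pt) (T : Set (Finset Pt)) : Prop :=
  T.Finite ∧
  (∀ t ∈ T, t.card = 3 ∧ (t : Set Pt) ⊆ P) ∧
  (∀ p ∈ P, ∃ t ∈ T, p ∈ t) ∧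
  (T.Pairwise fun t s => interior (triSet t) ∩ interior (triSet s) = ∅) ∧
  (⋃ t ∈ T, triSet t) = convexHull ℝ P

/-- The triangle `t` (with vertex set `t`) is order-`k` Delaunay with respect to `P`:
the open disk bounded by its circumcircle contains at most `k` points of `P`. -/
def OrderKTri (P : Set Pt) (k : ℕ) (t : Finset Pt) : Prop :=
  ∃ z : Pt, ∃ r : ℝ, (∀ p ∈ t, dist p z = r) ∧ {p ∈ P | dist p z < r}.encard ≤ (k : ℕ∞)

/-- `T` is an order-`k` Delaunay triangulation of `P`. -/
def IsOrderDT (P : Set Pt) (k : ℕ) (T : Set (Finset Pt)) : Prop :=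
  IsTriangulation P T ∧ ∀ t ∈ T, OrderKTri P k t

/-- `{u, v}` is an order-`k` Delaunay edge of `P`: some open disk having `u` and `v`
on its boundary circle contains at most `k` points of `P`. -/
def OrderKEdge (P : Set Pt) (k : ℕ) (u v : Pt) : Prop :=
  ∃ z : Pt, ∃ r : ℝ, dist u z = r ∧ dist v z = r ∧ {p ∈ P | dist p z < r}.encard ≤ (k : ℕ∞)

/-- `{u, v}` is a useful order-`k` Delaunay edge of `P`: some order-`k` Delaunay
triangulation of `P` contains a triangle having `u` and `v` among its vertices
(i.e. having segment `uv` as a side). -/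
def UsefulEdge (P : Set Pt) (k : ℕ) (u v : Pt) : Prop :=
  ∃ T, IsOrderDT P k T ∧ ∃ t ∈ T, u ∈ t ∧ v ∈ t

/-- `{u, v}` is a Delaunay edge: it is an edge of the (unique) order-0 Delaunay
triangulation of `P`. -/
def DelaunayEdge (P : Set Pt) (u v : Pt) : Prop := UsefulEdge P 0 u v

/-- `p` lies strictly to the left of the directed line from `v` to `u`, i.e. the
triple `v, u, p` makes a counterclockwise turn. -/
def ccw (v u p : Pt) : Prop :=
  0 < (u 0 - v 0) * (p 1 - v 1) - (u 1 - v 1) * (p 0 - v 0)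


section Probability

open MeasureTheory Filter Real

/-- The unit square `[0,1]²`. -/
def unitSq : Set Pt := {p : Pt | p 0 ∈ Set.Icc (0 : ℝ) 1 ∧ p 1 ∈ Set.Icc (0 : ℝ) 1}

/-- The uniform (probability) distribution on the unit square. -/
noncomputable def unifSq : Measure Pt := volume.restrict unitSq

/-- The law of `n` independent points, each uniform in the unit square: the product
measure on configurations `Fin n → Pt`. -/
noncomputable def conf (n : ℕ) : Measure (Fin n → Pt) := Measure.pi fun _ => unifSq

/-- The constant `c₁ ≈ 0.23807`. -/
noncomputable def c1 : ℝ :=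
  ∫ a in Set.Ioi (0 : ℝ), ∫ c in Set.Ioi a, ∫ b in Set.Ioi a,
    8 * π * a *
      (2 * a * c / Real.sqrt (c ^ 2 - a ^ 2) - 2 * c * Real.arcsin (a / c)) *
      (2 * a * b / Real.sqrt (b ^ 2 - a ^ 2) - 2 * b * Real.arcsin (a / b)) *
      Real.exp (-π * b ^ 2 + b ^ 2 * Real.arcsin (a / b) - a * Real.sqrt (b ^ 2 - a ^ 2)
        - π * c ^ 2 + c ^ 2 * Real.arcsin (a / c) - a * Real.sqrt (c ^ 2 - a ^ 2))

/-- The constant `c₂ ≈ 0.40675`. -/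
noncomputable def c2 : ℝ :=
  ∫ a in Set.Ioi (0 : ℝ), ∫ c in Set.Ioi a, ∫ b in Set.Ioi c,
    8 * π * a *
      (2 * π * c - 2 * c * Real.arcsin (a / c) + 2 * a * c / Real.sqrt (c ^ 2 - a ^ 2)) *
      (2 * a * b / Real.sqrt (b ^ 2 - a ^ 2) - 2 * b * Real.arcsin (a / b)) *
      Real.exp (-π * b ^ 2 + b ^ 2 * Real.arcsin (a / b) - a * Real.sqrt (b ^ 2 - a ^ 2)
        - c ^ 2 * Real.arcsin (a / c) + a * Real.sqrt (c ^ 2 - a ^ 2))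

end Probability
open MeasureTheory Filter in
/-- The set of unordered pairs of points of `P` that are useful order-1 Delaunay edges
but not Delaunay edges. -/
def usefulNotDel (P : Set Pt) : Set (Finset Pt) :=
  {e | ∃ u v : Pt, u ∈ P ∧ v ∈ P ∧ u ≠ v ∧ e = {u, v} ∧
    UsefulEdge P 1 u v ∧ ¬ DelaunayEdge P u v}

/-- Twice the signed area of the triangle `a b p`. -/
def orient (a b p : Pt) : ℝ := (b 0 - a 0) * (p 1 - a 1) - (b 1 - a 1) * (p 0 - a 0)

/-- The inner product of `p - a` and `p - b`; it is negative exactly inside the disk with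
diameter `a b`. -/
def dotAt (a b p : Pt) : ℝ := (p 0 - a 0) * (p 0 - b 0) + (p 1 - a 1) * (p 1 - b 1)

/-- The cotangent of the oriented angle at `p` under which the segment `a b` is seen. It
parametrizes the pencil of circles through `a` and `b`. -/
def cotAt (a b p : Pt) : ℝ := dotAt a b p / orient a b p

/-- A general power function of a circle. -/
def pwr (w : ℝ × ℝ × ℝ) (p : Pt) : ℝ := p 0 ^ 2 + p 1 ^ 2 + w.1 * p 0 + w.2.1 * p 1 + w.2.2

/-- No three points collinear and no four points concyclic, in coordinates. -/
structure Generic (P : Set Pt) : Prop where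
  orient_ne : ∀ {a b c}, a ∈ P → b ∈ P → c ∈ P → a ≠ b → a ≠ c → b ≠ c → orient a b c ≠ 0
  pwr_ne : ∀ {a b c d}, a ∈ P → b ∈ P → c ∈ P → d ∈ P → a ≠ b → a ≠ c → a ≠ d → b ≠ c →
    b ≠ d → c ≠ d → ∀ w, pwr w a = 0 → pwr w b = 0 → pwr w c = 0 → pwr w d ≠ 0

lemma Pt.ext {a b : Pt} (h0 : a 0 = b 0) (h1 : a 1 = b 1) : a = b := by
  ext i; fin_cases i <;> assumption

lemma orient_swap (a b c : Pt) : orient b a c = - orient a b c := by unfold orient; ring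

lemma orient_rot (a b c : Pt) : orient b c a = orient a b c := by unfold orient; ring

lemma dotAt_swap (a b c : Pt) : dotAt b a c = dotAt a b c := by unfold dotAt; ring

lemma cotAt_swap (a b c : Pt) : cotAt b a c = - cotAt a b c := by
  unfold cotAt; rw [dotAt_swap, orient_swap, div_neg]

lemma pwr_bary (w w' : ℝ × ℝ × ℝ) (a b c p : Pt) :
    (pwr w p - pwr w' p) * orient a b c = (pwr w a - pwr w' a) * orient b c p +
      (pwr w b - pwr w' b) * orient c a p + (pwr w c - pwr w' c) * orient a b p := by
  unfold pwr orient; ring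

lemma pwr_unique {w w' : ℝ × ℝ × ℝ} {a b c : Pt} (h : orient a b c ≠ 0)
    (ha : pwr w a = pwr w' a) (hb : pwr w b = pwr w' b) (hc : pwr w c = pwr w' c) (p : Pt) :
    pwr w p = pwr w' p := by
  have := pwr_bary w w' a b c p
  rw [ha, hb, hc] at this
  simp only [sub_self, zero_mul, add_zero, mul_eq_zero] at this
  rcases this with h1 | h1
  · linarith
  · exact absurd h1 h

lemma exists_pwr (a b : Pt) (t : ℝ) : ∃ w, ∀ p, pwr w p = dotAt a b p - t * orient a b p := by
  refine ⟨(-(a 0 + b 0) + t * (b 1 - a 1), -(a 1 + b 1) - t * (b 0 - a 0),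
    a 0 * b 0 + a 1 * b 1 + t * ((b 0 - a 0) * a 1 - (b 1 - a 1) * a 0)), fun p => ?_⟩
  unfold pwr dotAt orient; ring

@[simp] lemma orient_left (a b : Pt) : orient a b a = 0 := by unfold orient; ring
@[simp] lemma orient_right (a b : Pt) : orient a b b = 0 := by unfold orient; ring
@[simp] lemma orient_self (a b : Pt) : orient a a b = 0 := by unfold orient; ring
@[simp] lemma dotAt_left (a b : Pt) : dotAt a b a = 0 := by unfold dotAt; ring
@[simp] lemma dotAt_right (a b : Pt) : dotAt a b b = 0 := by unfold dotAt; ring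

lemma exists_pwr_circum {a b c : Pt} (h : orient a b c ≠ 0) :
    ∃ w, (pwr w a = 0 ∧ pwr w b = 0 ∧ pwr w c = 0) ∧
      ∀ p, pwr w p = dotAt a b p - cotAt a b c * orient a b p := by
  obtain ⟨w, hw⟩ := exists_pwr a b (cotAt a b c)
  refine ⟨w, ⟨by simp [hw], by simp [hw], ?_⟩, hw⟩
  rw [hw, cotAt]; field_simp; ring

lemma ne_of_orient {a b c : Pt} (h : orient a b c ≠ 0) : a ≠ b ∧ a ≠ c ∧ b ≠ c := by
  refine ⟨?_, ?_, ?_⟩ <;> rintro rfl <;> simp at h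

/-- Two triples of a pencil: along the line `a b` two power functions vanishing at `a` and `b`
differ by a multiple of `orient a b`. -/
lemma pwr_pencil {w w' : ℝ × ℝ × ℝ} {a b : Pt} (ha : pwr w a = pwr w' a)
    (hb : pwr w b = pwr w' b) (p q : Pt) :
    (pwr w p - pwr w' p) * orient a b q = (pwr w q - pwr w' q) * orient a b p := by
  have := pwr_bary w w' a b q p
  rw [ha, hb] at this
  linarith

lemma comb2_apply (α β : ℝ) (a b : Pt) (i : Fin 2) :
    (α • a + β • b) i = α * a i + β * b i := by simp

lemma comb3_apply (α β γ : ℝ) (a b c : Pt) (i : Fin 2) :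
    (α • a + β • b + γ • c) i = α * a i + β * b i + γ * c i := by simp

lemma orient_comb {α β γ : ℝ} (h : α + β + γ = 1) (p q a b c : Pt) :
    orient p q (α • a + β • b + γ • c) =
      α * orient p q a + β * orient p q b + γ * orient p q c := by
  unfold orient
  simp only [comb3_apply]
  obtain rfl : γ = 1 - α - β := by linarith
  ring

lemma pwr_sub_comb {α β γ : ℝ} (h : α + β + γ = 1) (w w' : ℝ × ℝ × ℝ) (a b c : Pt) :
    pwr w (α • a + β • b + γ • c) - pwr w' (α • a + β • b + γ • c) =
      α * (pwr w a - pwr w' a) + β * (pwr w b - pwr w' b) + γ * (pwr w c - pwr w' c) := by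
  unfold pwr
  simp only [comb3_apply]
  obtain rfl : γ = 1 - α - β := by linarith
  ring

lemma pwr_comb {α β γ : ℝ} (h : α + β + γ = 1) (w : ℝ × ℝ × ℝ) (a b c : Pt) :
    pwr w (α • a + β • b + γ • c) = α * pwr w a + β * pwr w b + γ * pwr w c
      - (α * β * ((a 0 - b 0) ^ 2 + (a 1 - b 1) ^ 2)
        + β * γ * ((b 0 - c 0) ^ 2 + (b 1 - c 1) ^ 2)
        + α * γ * ((a 0 - c 0) ^ 2 + (a 1 - c 1) ^ 2)) := by
  unfold pwr
  simp only [comb3_apply]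
  obtain rfl : γ = 1 - α - β := by linarith
  ring

/-- Barycentric coordinates with respect to a nondegenerate triangle. -/
lemma exists_bary {a b c : Pt} (h : orient a b c ≠ 0) (z : Pt) :
    ∃ α β γ : ℝ, α + β + γ = 1 ∧ z = α • a + β • b + γ • c := by
  refine ⟨orient b c z / orient a b c, orient c a z / orient a b c, orient a b z / orient a b c,
    ?_, ?_⟩
  · rw [← add_div, ← add_div, div_eq_one_iff_eq h]; unfold orient; ring
  · apply Pt.ext <;> rw [comb3_apply, div_mul_eq_mul_div, div_mul_eq_mul_div, div_mul_eq_mul_div,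
      ← add_div, ← add_div, eq_div_iff h] <;> unfold orient <;> ring

lemma mem_triSet {a b c z : Pt} : z ∈ triSet {a, b, c} ↔
    ∃ α β γ : ℝ, 0 ≤ α ∧ 0 ≤ β ∧ 0 ≤ γ ∧ α + β + γ = 1 ∧ z = α • a + β • b + γ • c := by
  have : (({a, b, c} : Finset Pt) : Set Pt) = insert a {b, c} := by simp
  rw [triSet, this, convexHull_insert (by simp), convexHull_pair, mem_convexJoin]
  constructor
  · rintro ⟨a', rfl, q, ⟨s, t, hs, ht, hst, rfl⟩, ⟨s', t', hs', ht', hst', rfl⟩⟩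
    refine ⟨s', t' * s, t' * t, hs', by positivity, by positivity, ?_, ?_⟩
    · rw [add_assoc, ← mul_add, hst, mul_one, hst']
    · simp only [smul_add, smul_smul, add_assoc]
  · rintro ⟨α, β, γ, hα, hβ, hγ, hs, rfl⟩
    rcases eq_or_lt_of_le (add_nonneg hβ hγ) with h0 | h0
    · have h1 : β = 0 := by linarith
      have h2 : γ = 0 := by linarith
      refine ⟨a, rfl, b, left_mem_segment _ _ _, 1, 0, by norm_num, by norm_num, by norm_num, ?_⟩
      subst h1 h2
      have : α = 1 := by linarith
      simp [this]
    · refine ⟨a, rfl, (β / (β + γ)) • b + (γ / (β + γ)) • c,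
        ⟨_, _, by positivity, by positivity, by field_simp, rfl⟩,
        α, β + γ, hα, h0.le, by linarith, ?_⟩
      rw [smul_add, smul_smul, smul_smul, mul_div_cancel₀ _ h0.ne', mul_div_cancel₀ _ h0.ne',
        add_assoc]

lemma dist_sq_eq_pwr (z : Pt) (r : ℝ) : ∃ w, ∀ p, pwr w p = dist p z ^ 2 - r ^ 2 := by
  refine ⟨(-2 * z 0, -2 * z 1, z 0 ^ 2 + z 1 ^ 2 - r ^ 2), fun p => ?_⟩
  rw [EuclideanSpace.dist_eq, Real.sq_sqrt (by positivity)]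
  simp only [Fin.sum_univ_two, Real.dist_eq, sq_abs, pwr]
  ring

lemma pwr_eq_dist_sq (w : ℝ × ℝ × ℝ) (q : Pt) (hq : pwr w q = 0) :
    ∃ z : Pt, ∃ r : ℝ, 0 ≤ r ∧ ∀ p, pwr w p = dist p z ^ 2 - r ^ 2 := by
  obtain ⟨w', hw'⟩ := dist_sq_eq_pwr !₂[-w.1 / 2, -w.2.1 / 2]
    (dist q !₂[-w.1 / 2, -w.2.1 / 2])
  refine ⟨!₂[-w.1 / 2, -w.2.1 / 2], dist q !₂[-w.1 / 2, -w.2.1 / 2], dist_nonneg, fun p => ?_⟩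
  simp only [EuclideanSpace.dist_eq, Real.sq_sqrt (add_nonneg (sq_nonneg _) (sq_nonneg _)),
    Fin.sum_univ_two, Real.dist_eq, sq_abs, pwr] at hq ⊢
  simp
  linarith

lemma orderKTri_iff {P : Set Pt} {k : ℕ} {t : Finset Pt} (ht : t.Nonempty) :
    OrderKTri P k t ↔ ∃ w, (∀ p ∈ t, pwr w p = 0) ∧ {p ∈ P | pwr w p < 0}.encard ≤ (k : ℕ∞) := by
  obtain ⟨q, hq⟩ := ht
  constructor
  · rintro ⟨z, r, h1, h2⟩
    obtain ⟨w, hw⟩ := dist_sq_eq_pwr z r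
    have hr : 0 ≤ r := h1 q hq ▸ dist_nonneg
    refine ⟨w, fun p hp => by rw [hw, h1 p hp, sub_self], ?_⟩
    convert h2 using 5 with p
    rw [hw, sub_neg, sq_lt_sq₀ dist_nonneg hr]
  · rintro ⟨w, h1, h2⟩
    obtain ⟨z, r, hr, hw⟩ := pwr_eq_dist_sq w q (h1 q hq)
    refine ⟨z, r, fun p hp => ?_, ?_⟩
    · have := h1 p hp
      rw [hw, sub_eq_zero, sq_eq_sq₀ dist_nonneg hr] at this
      exact this
    · convert h2 using 5 with p
      rw [hw, sub_neg, sq_lt_sq₀ dist_nonneg hr]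

section
/-- `z` lies on no line through two points of `P`. -/
def GenPt (P : Set Pt) (z : Pt) : Prop := ∀ p ∈ P, ∀ q ∈ P, p ≠ q → orient p q z ≠ 0

lemma volume_orient_eq_zero {a b : Pt} (h : a ≠ b) :
    MeasureTheory.volume {p | orient a b p = 0} = 0 := by
  let L : AffineSubspace ℝ Pt :=
    { carrier := {p | orient a b p = 0}
      smul_vsub_vadd_mem' := by
        intro c p q r hp hq hr
        simp only [Set.mem_ofPred_eq, orient, vsub_eq_sub, vadd_eq_add, PiLp.add_apply,
          PiLp.smul_apply, PiLp.sub_apply, smul_eq_mul] at *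
        linear_combination c * hp - c * hq + hr }
  refine MeasureTheory.Measure.addHaar_affineSubspace MeasureTheory.volume L fun hL => h ?_
  have h1 : (!₂[a 0 - (b 1 - a 1), a 1 + (b 0 - a 0)] : Pt) ∈ L := hL ▸ AffineSubspace.mem_top _ _ _
  replace h1 : orient a b !₂[a 0 - (b 1 - a 1), a 1 + (b 0 - a 0)] = 0 := h1
  simp [orient] at h1
  apply Pt.ext <;> nlinarith [sq_nonneg (b 0 - a 0), sq_nonneg (b 1 - a 1)]

lemma volume_pwr_eq_zero (w : ℝ × ℝ × ℝ) : MeasureTheory.volume {p | pwr w p = 0} = 0 := by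
  rcases Set.eq_empty_or_nonempty {p | pwr w p = 0} with h | ⟨q, hq⟩
  · simp [h]
  obtain ⟨z, r, hr, hw⟩ := pwr_eq_dist_sq w q hq
  refine MeasureTheory.measure_mono_null (fun p hp => ?_)
    (MeasureTheory.Measure.addHaar_sphere MeasureTheory.volume z r)
  have : pwr w p = 0 := hp
  rw [hw, sub_eq_zero, sq_eq_sq₀ dist_nonneg hr] at this
  exact this

lemma exists_genPt {P : Set Pt} (hP : P.Finite) {U : Set Pt} (hU : IsOpen U) (hne : U.Nonempty) :
    ∃ z ∈ U, GenPt P z := by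
  by_contra! H
  have h0 : MeasureTheory.volume (⋃ p ∈ P, ⋃ q ∈ P, {z | p ≠ q ∧ orient p q z = 0}) = 0 := by
    refine (MeasureTheory.measure_biUnion_null_iff hP.countable).2 fun p _ =>
      (MeasureTheory.measure_biUnion_null_iff hP.countable).2 fun q _ => ?_
    by_cases h : p = q
    · simp [h]
    · exact MeasureTheory.measure_mono_null (fun z hz => hz.2) (volume_orient_eq_zero h)
  refine (hU.measure_pos MeasureTheory.volume hne).ne'
    (MeasureTheory.measure_mono_null (fun z hz => ?_) h0)
  have := H z hz
  simp only [GenPt] at this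
  push Not at this
  obtain ⟨p, hp, q, hq, hpq, h⟩ := this
  simp only [mem_iUnion]
  exact ⟨p, hp, q, hq, hpq, h⟩

lemma bary_pos {P : Set Pt} {a b c : Pt} (ha : a ∈ P) (hb : b ∈ P) (hc : c ∈ P)
    (hab : a ≠ b) (hac : a ≠ c) (hbc : b ≠ c) {z : Pt} (hz : GenPt P z)
    (h : z ∈ triSet {a, b, c}) :
    ∃ α β γ : ℝ, 0 < α ∧ 0 < β ∧ 0 < γ ∧ α + β + γ = 1 ∧ z = α • a + β • b + γ • c := by
  obtain ⟨α, β, γ, hα, hβ, hγ, hs, rfl⟩ := mem_triSet.1 h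
  have h1 := hz b hb c hc hbc
  have h2 := hz a ha c hc hac
  have h3 := hz a ha b hb hab
  rw [orient_comb hs] at h1 h2 h3
  simp only [orient_left, orient_right, mul_zero, add_zero, zero_add, ne_eq, mul_eq_zero,
    not_or] at h1 h2 h3
  exact ⟨α, β, γ, hα.lt_of_ne' h1.1, hβ.lt_of_ne' h2.1, hγ.lt_of_ne' h3.1, hs, rfl⟩

lemma continuous_orient (a b : Pt) : Continuous (orient a b) := by
  unfold orient; fun_prop

/-- The open triangle. -/
def openTri (a b c : Pt) : Set Pt :=
  {p | 0 < orient b c p * orient a b c ∧ 0 < orient c a p * orient a b c ∧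
    0 < orient a b p * orient a b c}

lemma isOpen_openTri (a b c : Pt) : IsOpen (openTri a b c) := by
  refine IsOpen.and ?_ (IsOpen.and ?_ ?_) <;>
    exact isOpen_lt continuous_const ((continuous_orient _ _).mul continuous_const)

lemma comb_mem_openTri {a b c : Pt} (h : orient a b c ≠ 0) {α β γ : ℝ} (hα : 0 < α) (hβ : 0 < β)
    (hγ : 0 < γ) (hs : α + β + γ = 1) : α • a + β • b + γ • c ∈ openTri a b c := by
  have h2 := mul_self_pos.2 h
  simp only [openTri, mem_ofPred_eq, orient_comb hs, orient_left, orient_right, mul_zero,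
    zero_add, add_zero, orient_rot a b c, mul_assoc]
  rw [show orient c a b = orient a b c by rw [orient_rot, orient_rot]]
  exact ⟨by positivity, by positivity, by positivity⟩

lemma openTri_subset {a b c : Pt} : openTri a b c ⊆ triSet {a, b, c} := by
  rintro p ⟨h1, h2, h3⟩
  have h : orient a b c ≠ 0 := fun h => by simp [h] at h1
  have h0 := mul_self_pos.2 h
  refine mem_triSet.2 ⟨orient b c p / orient a b c, orient c a p / orient a b c,
    orient a b p / orient a b c, ?_, ?_, ?_, ?_, ?_⟩
  · rw [← mul_div_mul_right _ _ h]; positivity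
  · rw [← mul_div_mul_right _ _ h]; positivity
  · rw [← mul_div_mul_right _ _ h]; positivity
  · rw [← add_div, ← add_div, div_eq_one_iff_eq h]; unfold orient; ring
  · apply Pt.ext <;> rw [comb3_apply, div_mul_eq_mul_div, div_mul_eq_mul_div, div_mul_eq_mul_div,
      ← add_div, ← add_div, eq_div_iff h] <;> unfold orient <;> ring

lemma comb_mem_interior {a b c : Pt} (h : orient a b c ≠ 0) {α β γ : ℝ} (hα : 0 < α) (hβ : 0 < β)
    (hγ : 0 < γ) (hs : α + β + γ = 1) : α • a + β • b + γ • c ∈ interior (triSet {a, b, c}) :=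
  interior_maximal openTri_subset (isOpen_openTri a b c) (comb_mem_openTri h hα hβ hγ hs)

lemma isClosed_triSet (t : Finset Pt) : IsClosed (triSet t) :=
  (t.finite_toSet.isCompact_convexHull (𝕜 := ℝ)).isClosed

lemma triSet_subset_hull {P : Set Pt} {t : Finset Pt} (h : (t : Set Pt) ⊆ P) :
    triSet t ⊆ convexHull ℝ P := convexHull_mono h

lemma subset_triSet (t : Finset Pt) : (t : Set Pt) ⊆ triSet t := subset_convexHull ℝ _

section
variable {P : Set Pt}

lemma finite_triples (hP : P.Finite) {T : Set (Finset Pt)} (hT : ∀ t ∈ T, (t : Set Pt) ⊆ P) :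
    T.Finite := by
  refine Set.Finite.subset (hP.toFinset.powerset : Finset (Finset Pt)).finite_toSet fun t ht => ?_
  simp only [Finset.coe_powerset, mem_preimage, mem_powerset_iff, Finite.coe_toFinset]
  exact hT t ht

lemma convexHull_subset_iUnion (hP : P.Finite) (hG : Generic P) {T : Set (Finset Pt)}
    (hne : ∃ a ∈ P, ∃ b ∈ P, ∃ c ∈ P, a ≠ b ∧ a ≠ c ∧ b ≠ c)
    (hT : ∀ t ∈ T, (t : Set Pt) ⊆ P)
    (hex : ∀ z, GenPt P z → z ∈ convexHull ℝ P → ∃ t ∈ T, z ∈ triSet t) :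
    convexHull ℝ P ⊆ ⋃ t ∈ T, triSet t := by
  intro z hz
  by_contra hzT
  have hcl : IsClosed (⋃ t ∈ T, triSet t) :=
    (finite_triples hP hT).isClosed_biUnion fun t _ => isClosed_triSet t
  have hintr : (interior (convexHull ℝ P)).Nonempty := by
    obtain ⟨a, ha, b, hb, c, hc, hab, hac, hbc⟩ := hne
    refine ⟨_, interior_mono (triSet_subset_hull ?_) (comb_mem_interior
      (hG.orient_ne ha hb hc hab hac hbc) (α := 1/3) (β := 1/3) (γ := 1/3) (by norm_num)
      (by norm_num) (by norm_num) (by norm_num))⟩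
    simp [Set.insert_subset_iff, ha, hb, hc]
  have hz' : z ∈ closure (interior (convexHull ℝ P)) := by
    rw [(convex_convexHull ℝ P).closure_interior_eq_closure_of_nonempty_interior hintr]
    exact subset_closure hz
  obtain ⟨z', hz', hg⟩ := exists_genPt hP (hcl.isOpen_compl.inter isOpen_interior)
    (mem_closure_iff.1 hz' _ hcl.isOpen_compl hzT)
  obtain ⟨t, ht, hzt⟩ := hex z' hg (interior_subset hz'.2)
  exact hz'.1 (mem_biUnion ht hzt)

lemma isTriangulation_of (hP : P.Finite) (hG : Generic P) {T : Set (Finset Pt)}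
    (hne : ∃ a ∈ P, ∃ b ∈ P, ∃ c ∈ P, a ≠ b ∧ a ≠ c ∧ b ≠ c)
    (hT : ∀ t ∈ T, t.card = 3 ∧ (t : Set Pt) ⊆ P) (hv : ∀ p ∈ P, ∃ t ∈ T, p ∈ t)
    (huniq : ∀ z, GenPt P z → ∀ t ∈ T, ∀ s ∈ T, z ∈ triSet t → z ∈ triSet s → t = s)
    (hex : ∀ z, GenPt P z → z ∈ convexHull ℝ P → ∃ t ∈ T, z ∈ triSet t) :
    IsTriangulation P T := by
  refine ⟨finite_triples hP fun t ht => (hT t ht).2, hT, hv, fun t ht s hs hne => ?_, ?_⟩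
  · by_contra h
    obtain ⟨z, hz, hzg⟩ := exists_genPt hP (isOpen_interior.inter isOpen_interior)
      (nonempty_iff_ne_empty.2 h)
    exact hne (huniq z hzg t ht s hs (interior_subset hz.1) (interior_subset hz.2))
  · exact Subset.antisymm (iUnion₂_subset fun t ht => triSet_subset_hull (hT t ht).2)
      (convexHull_subset_iUnion hP hG hne (fun t ht => (hT t ht).2) hex)

end

end

section
/-- The triangles with vertices in `P` and empty circumdisk. -/
def delTri (P : Set Pt) : Set (Finset Pt) :=
  {t | t.card = 3 ∧ (t : Set Pt) ⊆ P ∧ ∃ w, (∀ p ∈ t, pwr w p = 0) ∧ ∀ p ∈ P, 0 ≤ pwr w p}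

variable {P : Set Pt}

lemma Generic.mem_of_pwr (hG : Generic P) {s : Finset Pt} (h3 : s.card = 3) (hs : (s : Set Pt) ⊆ P)
    {w : ℝ × ℝ × ℝ} (hw : ∀ p ∈ s, pwr w p = 0) {q : Pt} (hq : q ∈ P) (hwq : pwr w q = 0) :
    q ∈ s := by
  obtain ⟨a, b, c, hab, hac, hbc, rfl⟩ := Finset.card_eq_three.1 h3
  by_contra h
  simp only [Finset.mem_insert, Finset.mem_singleton, not_or] at h
  exact hG.pwr_ne (hs (by simp)) (hs (by simp)) (hs (by simp)) hq hab hac (Ne.symm h.1) hbc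
    (Ne.symm h.2.1) (Ne.symm h.2.2) w (hw _ (by simp)) (hw _ (by simp)) (hw _ (by simp)) hwq

lemma delTri_uniq (hG : Generic P) {z : Pt} (hz : GenPt P z) {t s : Finset Pt} (ht : t ∈ delTri P)
    (hs : s ∈ delTri P) (hzt : z ∈ triSet t) (hzs : z ∈ triSet s) : t = s := by
  obtain ⟨ht3, htP, w, hw, hwP⟩ := ht
  obtain ⟨hs3, hsP, w', hw', hwP'⟩ := hs
  obtain ⟨a, b, c, hab, hac, hbc, rfl⟩ := Finset.card_eq_three.1 ht3
  have ha : a ∈ P := htP (by simp)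
  have hb : b ∈ P := htP (by simp)
  have hc : c ∈ P := htP (by simp)
  obtain ⟨α, β, γ, hα, hβ, hγ, hsum, hzabc⟩ := bary_pos ha hb hc hab hac hbc hz hzt
  have h1 : 0 ≤ pwr w z - pwr w' z := by
    obtain ⟨d, e, f, hde, hdf, hef, rfl⟩ := Finset.card_eq_three.1 hs3
    obtain ⟨α', β', γ', hα', hβ', hγ', hsum', hzdef⟩ :=
      bary_pos (hsP (by simp)) (hsP (by simp)) (hsP (by simp)) hde hdf hef hz hzs
    rw [hzdef, pwr_sub_comb hsum', hw' d (by simp), hw' e (by simp), hw' f (by simp)]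
    have := hwP d (hsP (by simp))
    have := hwP e (hsP (by simp))
    have := hwP f (hsP (by simp))
    simp only [sub_zero]
    positivity
  rw [hzabc, pwr_sub_comb hsum, hw a (by simp), hw b (by simp), hw c (by simp)] at h1
  have ha' := hwP' a ha
  have hb' := hwP' b hb
  have hc' := hwP' c hc
  have h2 := mul_nonneg hα.le ha'
  have h3 := mul_nonneg hβ.le hb'
  have h4 := mul_nonneg hγ.le hc'
  have ha0 : pwr w' a = 0 := by
    have : α * pwr w' a = 0 := by linarith
    exact (mul_eq_zero.1 this).resolve_left hα.ne'
  have hb0 : pwr w' b = 0 := by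
    have : β * pwr w' b = 0 := by linarith
    exact (mul_eq_zero.1 this).resolve_left hβ.ne'
  have hc0 : pwr w' c = 0 := by
    have : γ * pwr w' c = 0 := by linarith
    exact (mul_eq_zero.1 this).resolve_left hγ.ne'
  refine Finset.eq_of_subset_of_card_le (fun p hp => ?_) (by rw [hs3, ht3])
  simp only [Finset.mem_insert, Finset.mem_singleton] at hp
  rcases hp with rfl | rfl | rfl
  · exact hG.mem_of_pwr hs3 hsP hw' ha ha0
  · exact hG.mem_of_pwr hs3 hsP hw' hb hb0
  · exact hG.mem_of_pwr hs3 hsP hw' hc hc0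

lemma ratio_test {α β γ α' β' γ' : ℝ} (hα : 0 < α) (hβ : 0 < β) (hγ : 0 < γ)
    (h : α' + β' + γ' = 1) :
    (0 < α' ∧ α * β' ≤ α' * β ∧ α * γ' ≤ α' * γ) ∨ (0 < β' ∧ β * α' ≤ β' * α ∧ β * γ' ≤ β' * γ) ∨
      (0 < γ' ∧ γ * α' ≤ γ' * α ∧ γ * β' ≤ γ' * β) := by
  obtain ⟨x, rfl⟩ : ∃ x, α' = x * α := ⟨α' / α, by field_simp⟩
  obtain ⟨y, rfl⟩ : ∃ y, β' = y * β := ⟨β' / β, by field_simp⟩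
  obtain ⟨z, rfl⟩ : ∃ z, γ' = z * γ := ⟨γ' / γ, by field_simp⟩
  have key : ∀ {x y z α β γ : ℝ}, 0 < α → 0 < β → 0 < γ → x * α + y * β + z * γ = 1 → y ≤ x →
      z ≤ x → 0 < x * α ∧ α * (y * β) ≤ x * α * β ∧ α * (z * γ) ≤ x * α * γ := by
    intro x y z α β γ hα hβ hγ h hy hz
    have hx : 0 < x := by
      by_contra hx
      push Not at hx
      have := mul_nonpos_of_nonpos_of_nonneg hx hα.le
      have := mul_nonpos_of_nonpos_of_nonneg (hy.trans hx) hβ.le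
      have := mul_nonpos_of_nonpos_of_nonneg (hz.trans hx) hγ.le
      linarith
    refine ⟨by positivity, ?_, ?_⟩
    · nlinarith [mul_le_mul_of_nonneg_right hy (mul_pos hα hβ).le]
    · nlinarith [mul_le_mul_of_nonneg_right hz (mul_pos hα hγ).le]
  rcases le_total x y with h1 | h1 <;> rcases le_total y z with h2 | h2 <;>
    rcases le_total x z with h3 | h3
  · exact Or.inr (Or.inr (key hγ hα hβ (by linarith) h3 h2))
  · exact Or.inr (Or.inr (key hγ hα hβ (by linarith) (h1.trans h2) h2))
  · exact Or.inr (Or.inl (key hβ hα hγ (by linarith) h1 h2))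
  · exact Or.inr (Or.inl (key hβ hα hγ (by linarith) h1 h2))
  · exact Or.inr (Or.inr (key hγ hα hβ (by linarith) h3 h2))
  · exact Or.inl (key hα hβ hγ (by linarith) h1 h3)
  · exact Or.inl (key hα hβ hγ (by linarith) h1 (h2.trans h1))
  · exact Or.inl (key hα hβ hγ (by linarith) h1 h3)

/-- A pivot step: exchanging a vertex for a point in the open circumdisk. -/
lemma pivot {a b c p z : Pt} {w : ℝ × ℝ × ℝ} {α β γ α' β' γ' : ℝ} (hG : Generic P)
    (hb : b ∈ P) (hc : c ∈ P) (hp : p ∈ P) (hbc : b ≠ c) (hwb : pwr w b = 0) (hwc : pwr w c = 0)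
    (hwp : pwr w p < 0) (hα : 0 < α) (hs : α + β + γ = 1) (hz : z = α • a + β • b + γ • c)
    (hs' : α' + β' + γ' = 1) (hp' : p = α' • a + β' • b + γ' • c) (h1 : 0 < α')
    (h2 : α * β' ≤ α' * β) (h3 : α * γ' ≤ α' * γ) :
    ∃ t : Finset Pt, t.card = 3 ∧ (t : Set Pt) ⊆ P ∧ z ∈ triSet t ∧ ∃ w', (∀ q ∈ t, pwr w' q = 0) ∧
      pwr w z < pwr w' z := by
  have hpb : p ≠ b := by rintro rfl; linarith
  have hpc : p ≠ c := by rintro rfl; linarith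
  obtain ⟨w', ⟨h4, h5, h6⟩, -⟩ := exists_pwr_circum (hG.orient_ne hp hb hc hpb hpc hbc)
  have hsum : α / α' + (β - α / α' * β') + (γ - α / α' * γ') = 1 := by
    have : γ' = 1 - α' - β' := by linarith
    subst this
    field_simp
    linear_combination α' * hs
  have hz' : z = (α / α') • p + (β - α / α' * β') • b + (γ - α / α' * γ') • c := by
    rw [hz, hp']
    apply Pt.ext <;> simp only [comb3_apply] <;> field_simp <;> ring
  refine ⟨{p, b, c}, Finset.card_eq_three.2 ⟨p, b, c, hpb, hpc, hbc, rfl⟩, ?_, ?_, w', ?_, ?_⟩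
  · simp [Set.insert_subset_iff, hp, hb, hc]
  · refine mem_triSet.2 ⟨_, _, _, by positivity, ?_, ?_, hsum, hz'⟩
    · rw [sub_nonneg, div_mul_eq_mul_div, div_le_iff₀ h1]; linarith
    · rw [sub_nonneg, div_mul_eq_mul_div, div_le_iff₀ h1]; linarith
  · simp [h4, h5, h6]
  · rw [← sub_pos, hz', pwr_sub_comb hsum, h4, h5, h6, hwb, hwc]
    have : 0 < α / α' * -pwr w p := mul_pos (by positivity) (by linarith)
    linarith

lemma exists_triple (hP : P.Finite) (hne : ∃ a ∈ P, ∃ b ∈ P, ∃ c ∈ P, a ≠ b ∧ a ≠ c ∧ b ≠ c)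
    {z : Pt} (hzP : z ∈ convexHull ℝ P) :
    ∃ t : Finset Pt, t.card = 3 ∧ (t : Set Pt) ⊆ P ∧ z ∈ triSet t := by
  rw [convexHull_eq_union] at hzP
  simp only [mem_iUnion] at hzP
  obtain ⟨t, htP, hai, hzt⟩ := hzP
  have h3 : t.card ≤ 3 := by
    have := hai.card_le_finrank_succ
    have h2 := Submodule.finrank_le (vectorSpan ℝ (Set.range ((↑) : t → Pt)))
    simp only [finrank_euclideanSpace, Fintype.card_fin, Fintype.card_coe] at this h2
    lia
  have : ∃ a ∈ P, ∃ b ∈ P, ∃ c ∈ P, a ≠ b ∧ a ≠ c ∧ b ≠ c ∧ t ⊆ {a, b, c} := by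
    have hP3 : 3 ≤ hP.toFinset.card := by
      obtain ⟨a, ha, b, hb, c, hc, hab, hac, hbc⟩ := hne
      rw [← Finset.card_eq_three.2 ⟨a, b, c, hab, hac, hbc, rfl⟩]
      apply Finset.card_le_card
      intro p hp
      simp only [Finset.mem_insert, Finset.mem_singleton] at hp
      rcases hp with rfl | rfl | rfl <;> simpa
    obtain ⟨s, hts, hsP, hs⟩ := Finset.exists_subsuperset_card_eq (s := t) (t := hP.toFinset)
      (by intro p hp; simpa using htP hp) h3 hP3
    obtain ⟨a, b, c, hab, hac, hbc, rfl⟩ := Finset.card_eq_three.1 hs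
    refine ⟨a, ?_, b, ?_, c, ?_, hab, hac, hbc, hts⟩
    · simpa using hsP (show a ∈ _ by simp)
    · simpa using hsP (show b ∈ _ by simp)
    · simpa using hsP (show c ∈ _ by simp)
  obtain ⟨a, ha, b, hb, c, hc, hab, hac, hbc, hts⟩ := this
  refine ⟨{a, b, c}, Finset.card_eq_three.2 ⟨a, b, c, hab, hac, hbc, rfl⟩, ?_,
    convexHull_mono (Finset.coe_subset.2 hts) hzt⟩
  simp [Set.insert_subset_iff, ha, hb, hc]

lemma exists_delTri (hP : P.Finite) (hG : Generic P)
    (hne : ∃ a ∈ P, ∃ b ∈ P, ∃ c ∈ P, a ≠ b ∧ a ≠ c ∧ b ≠ c)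
    {z : Pt} (hz : GenPt P z) (hzP : z ∈ convexHull ℝ P) : ∃ t ∈ delTri P, z ∈ triSet t := by
  let W : Finset Pt → ℝ × ℝ × ℝ := fun s => Classical.epsilon fun w => ∀ p ∈ s, pwr w p = 0
  have hW : ∀ s : Finset Pt, (∃ w, ∀ p ∈ s, pwr w p = 0) → ∀ p ∈ s, pwr (W s) p = 0 :=
    fun s h => Classical.epsilon_spec h
  have hWu : ∀ s : Finset Pt, s.card = 3 → (s : Set Pt) ⊆ P → ∀ w, (∀ p ∈ s, pwr w p = 0) →
      ∀ q, pwr (W s) q = pwr w q := by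
    intro s hs hsP w hw
    have := hW s ⟨w, hw⟩
    obtain ⟨a, b, c, hab, hac, hbc, rfl⟩ := Finset.card_eq_three.1 hs
    simp only [Finset.mem_insert, Finset.mem_singleton, forall_eq_or_imp, forall_eq] at this hw
    refine pwr_unique (hG.orient_ne (hsP (by simp)) (hsP (by simp)) (hsP (by simp)) hab hac hbc)
      ?_ ?_ ?_
    · rw [this.1, hw.1]
    · rw [this.2.1, hw.2.1]
    · rw [this.2.2, hw.2.2]
  have hfin : {s : Finset Pt | s.card = 3 ∧ (s : Set Pt) ⊆ P ∧ z ∈ triSet s}.Finite :=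
    finite_triples hP fun t ht => ht.2.1
  obtain ⟨t, ⟨ht3, htP, hzt⟩, hmax⟩ :=
    Set.exists_max_image _ (fun s => pwr (W s) z) hfin (exists_triple hP hne hzP)
  refine ⟨t, ⟨ht3, htP, W t, ?_⟩, hzt⟩
  obtain ⟨a, b, c, hab, hac, hbc, rfl⟩ := Finset.card_eq_three.1 ht3
  have ha : a ∈ P := htP (by simp)
  have hb : b ∈ P := htP (by simp)
  have hc : c ∈ P := htP (by simp)
  have ho := hG.orient_ne ha hb hc hab hac hbc
  have hw : ∀ p ∈ ({a, b, c} : Finset Pt), pwr (W {a, b, c}) p = 0 := by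
    obtain ⟨w, h, -⟩ := exists_pwr_circum ho
    exact hW _ ⟨w, by simpa using h⟩
  refine ⟨hw, fun p hp => ?_⟩
  by_contra! hneg
  simp only [Finset.mem_insert, Finset.mem_singleton, forall_eq_or_imp, forall_eq] at hw
  obtain ⟨hwa, hwb, hwc⟩ := hw
  obtain ⟨α, β, γ, hα, hβ, hγ, hs, hzabc⟩ := bary_pos ha hb hc hab hac hbc hz hzt
  obtain ⟨α', β', γ', hs', hpabc⟩ := exists_bary ho p
  have : ∃ t : Finset Pt, t.card = 3 ∧ (t : Set Pt) ⊆ P ∧ z ∈ triSet t ∧ ∃ w',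
      (∀ q ∈ t, pwr w' q = 0) ∧ pwr (W {a, b, c}) z < pwr w' z := by
    rcases ratio_test hα hβ hγ hs' with ⟨h1, h2, h3⟩ | ⟨h1, h2, h3⟩ | ⟨h1, h2, h3⟩
    · exact pivot hG hb hc hp hbc hwb hwc hneg hα hs hzabc hs' hpabc h1 h2 h3
    · exact pivot hG ha hc hp hac hwa hwc hneg hβ (by linarith)
        (by rw [hzabc]; abel) (by linarith) (by rw [hpabc]; abel) h1 h2 h3
    · exact pivot hG ha hb hp hab hwa hwb hneg hγ (by linarith)
        (by rw [hzabc]; abel) (by linarith) (by rw [hpabc]; abel) h1 h2 h3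
  obtain ⟨s, hs3, hsP, hzs, w', hw', hlt⟩ := this
  have := hmax s ⟨hs3, hsP, hzs⟩
  simp only [hWu s hs3 hsP w' hw'] at this
  linarith

lemma delTri_mem_of_mem_triSet {t : Finset Pt} (ht : t ∈ delTri P) {p : Pt} (hp : p ∈ P)
    (h : p ∈ triSet t) : p ∈ t := by
  obtain ⟨ht3, htP, w, hw, hwP⟩ := ht
  obtain ⟨a, b, c, hab, hac, hbc, rfl⟩ := Finset.card_eq_three.1 ht3
  obtain ⟨α, β, γ, hα, hβ, hγ, hs, rfl⟩ := mem_triSet.1 h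
  have h0 := hwP _ hp
  rw [pwr_comb hs, hw a (by simp), hw b (by simp), hw c (by simp)] at h0
  have pos : ∀ {a b : Pt}, a ≠ b → 0 < (a 0 - b 0) ^ 2 + (a 1 - b 1) ^ 2 := by
    intro a b hab
    by_contra! h
    have h0 : a 0 - b 0 = 0 := by nlinarith [sq_nonneg (a 0 - b 0), sq_nonneg (a 1 - b 1)]
    have h1 : a 1 - b 1 = 0 := by nlinarith [sq_nonneg (a 0 - b 0), sq_nonneg (a 1 - b 1)]
    exact hab (Pt.ext (by linarith) (by linarith))
  have h1 := mul_nonneg (mul_nonneg hα hβ) (pos hab).le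
  have h2 := mul_nonneg (mul_nonneg hβ hγ) (pos hbc).le
  have h3 := mul_nonneg (mul_nonneg hα hγ) (pos hac).le
  have e1 : α * β = 0 := (mul_eq_zero.1 (by linarith : α * β * _ = 0)).resolve_right (pos hab).ne'
  have e2 : β * γ = 0 := (mul_eq_zero.1 (by linarith : β * γ * _ = 0)).resolve_right (pos hbc).ne'
  have e3 : α * γ = 0 := (mul_eq_zero.1 (by linarith : α * γ * _ = 0)).resolve_right (pos hac).ne'
  rcases eq_or_ne α 0 with rfl | hα0
  · rcases eq_or_ne β 0 with rfl | hβ0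
    · obtain rfl : γ = 1 := by linarith
      simp
    · obtain rfl : γ = 0 := (mul_eq_zero.1 e2).resolve_left hβ0
      obtain rfl : β = 1 := by linarith
      simp
  · obtain rfl : β = 0 := (mul_eq_zero.1 e1).resolve_left hα0
    obtain rfl : γ = 0 := (mul_eq_zero.1 e3).resolve_left hα0
    obtain rfl : α = 1 := by linarith
    simp

lemma delTri_vertex (hP : P.Finite) (hG : Generic P)
    (hne : ∃ a ∈ P, ∃ b ∈ P, ∃ c ∈ P, a ≠ b ∧ a ≠ c ∧ b ≠ c) {p : Pt} (hp : p ∈ P) :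
    ∃ t ∈ delTri P, p ∈ t := by
  have := convexHull_subset_iUnion hP hG hne (T := delTri P) (fun t ht => ht.2.1)
    (fun z hz hzP => exists_delTri hP hG hne hz hzP) (subset_convexHull ℝ P hp)
  simp only [mem_iUnion] at this
  obtain ⟨t, ht, h⟩ := this
  exact ⟨t, ht, delTri_mem_of_mem_triSet ht hp h⟩

/-- The Delaunay triangulation. -/
theorem delTri_isTriangulation (hP : P.Finite) (hG : Generic P)
    (hne : ∃ a ∈ P, ∃ b ∈ P, ∃ c ∈ P, a ≠ b ∧ a ≠ c ∧ b ≠ c) : IsTriangulation P (delTri P) :=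
  isTriangulation_of hP hG hne (fun _ ht => ⟨ht.1, ht.2.1⟩)
    (fun _ hp => delTri_vertex hP hG hne hp)
    (fun _ hz _ ht _ hs hzt hzs => delTri_uniq hG hz ht hs hzt hzs)
    (fun _ hz hzP => exists_delTri hP hG hne hz hzP)

lemma orderKTri_zero_of_mem {t : Finset Pt} (ht : t ∈ delTri P) : OrderKTri P 0 t := by
  obtain ⟨ht3, htP, w, hw, hwP⟩ := ht
  refine (orderKTri_iff (Finset.card_pos.1 (by lia))).2 ⟨w, hw, ?_⟩
  rw [show {p ∈ P | pwr w p < 0} = ∅ from ?_]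
  · simp
  · ext p
    simp only [mem_sep_iff, mem_empty_iff_false, iff_false, not_and, not_lt]
    exact hwP p

theorem delTri_isOrderDT (hP : P.Finite) (hG : Generic P)
    (hne : ∃ a ∈ P, ∃ b ∈ P, ∃ c ∈ P, a ≠ b ∧ a ≠ c ∧ b ≠ c) : IsOrderDT P 0 (delTri P) :=
  ⟨delTri_isTriangulation hP hG hne, fun _ ht => orderKTri_zero_of_mem ht⟩

end

section
/-- `y` lies in the circumdisk of `u v x` and `x` in that of `u v y`, where `x` is to the left
and `y` to the right of the line from `u` to `v`. -/
def Flippable (u v x y : Pt) : Prop :=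
  0 < orient u v x ∧ orient u v y < 0 ∧ cotAt u v x < cotAt u v y

/-- The union of the open circumdisks of `u v x` and `u v y`. -/
def twoDisks (u v x y : Pt) : Set Pt :=
  {p | dotAt u v p < cotAt u v x * orient u v p ∨ dotAt u v p < cotAt u v y * orient u v p}

variable {P : Set Pt}

lemma mem_delTri_of_flip (hG : Generic P) {a c d : Pt} (ha : a ∈ P) (hc : c ∈ P) (hd : d ∈ P)
    (hac : a ≠ c) (had : a ≠ d) (hcd : c ≠ d) {w₁ w₂ : ℝ × ℝ × ℝ} (h1a : pwr w₁ a = 0)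
    (h1c : pwr w₁ c = 0) (h1d : pwr w₁ d < 0) (h2a : pwr w₂ a = 0) (h2d : pwr w₂ d = 0)
    (h2c : pwr w₂ c < 0) (h1 : ∀ p ∈ P, pwr w₁ p < 0 → p = d)
    (h2 : ∀ p ∈ P, pwr w₂ p < 0 → p = c) : ({a, c, d} : Finset Pt) ∈ delTri P := by
  have ho := hG.orient_ne ha hc hd hac had hcd
  obtain ⟨w, ⟨hwa, hwc, hwd⟩, -⟩ := exists_pwr_circum ho
  refine ⟨Finset.card_eq_three.2 ⟨_, _, _, hac, had, hcd, rfl⟩, ?_, w, ?_, fun p hp => ?_⟩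
  · intro p hp; simp at hp; rcases hp with rfl | rfl | rfl <;> assumption
  · intro p hp; simp at hp; rcases hp with rfl | rfl | rfl <;> assumption
  by_contra! hneg
  have n1 : 0 ≤ pwr w₁ p := by
    by_contra! h; rw [h1 p hp h] at hneg; linarith
  have n2 : 0 ≤ pwr w₂ p := by
    by_contra! h; rw [h2 p hp h] at hneg; linarith
  obtain ⟨α, β, γ, hs, rfl⟩ := exists_bary ho p
  have e1 := pwr_sub_comb hs w₁ w a c d
  have e2 := pwr_sub_comb hs w₂ w a c d
  rw [hwa, hwc, hwd] at e1 e2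
  rw [h1a, h1c] at e1
  rw [h2a, h2d] at e2
  have hγ : γ < 0 := by by_contra! h; nlinarith
  have hβ : β < 0 := by by_contra! h; nlinarith
  have hα : 0 < α := by linarith
  set p := α • a + β • c + γ • d with hpdef
  have key := pwr_comb (α := 1 / α) (β := -β / α) (γ := -γ / α)
    (by field_simp; linarith) w p c d
  rw [show (1 / α) • p + (-β / α) • c + (-γ / α) • d = a from ?_, hwa, hwc, hwd] at key
  · have : 0 < 1 / α := by positivity
    have h5 : 0 < -β / α := div_pos (by linarith) hα
    have h6 : 0 < -γ / α := div_pos (by linarith) hα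
    have : (1 / α) * pwr w p < 0 := mul_neg_of_pos_of_neg (by positivity) hneg
    have : 0 ≤ 1 / α * (-β / α) * ((p 0 - c 0) ^ 2 + (p 1 - c 1) ^ 2)
        + -β / α * (-γ / α) * ((c 0 - d 0) ^ 2 + (c 1 - d 1) ^ 2)
        + 1 / α * (-γ / α) * ((p 0 - d 0) ^ 2 + (p 1 - d 1) ^ 2) := by positivity
    linarith
  · refine Pt.ext ?_ ?_ <;> rw [comb3_apply, hpdef, comb3_apply] <;> field_simp <;> ring

/-- The open segments `u v` and `x y` cross. -/
def Crossing (u v x y : Pt) : Prop :=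
  ∃ s l : ℝ, 0 < s ∧ s < 1 ∧ 0 < l ∧ l < 1 ∧ ∀ i, (1 - s) * u i + s * v i = (1 - l) * x i + l * y i

lemma Crossing.swap_left {u v x y : Pt} (h : Crossing u v x y) : Crossing v u x y := by
  obtain ⟨s, l, h1, h2, h3, h4, h⟩ := h
  exact ⟨1 - s, l, by linarith, by linarith, h3, h4, fun i => by rw [← h i]; ring⟩

lemma Crossing.symm {u v x y : Pt} (h : Crossing u v x y) : Crossing x y u v := by
  obtain ⟨s, l, h1, h2, h3, h4, h⟩ := h
  exact ⟨l, s, h3, h4, h1, h2, fun i => (h i).symm⟩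

lemma Crossing.swap_right {u v x y : Pt} (h : Crossing u v x y) : Crossing u v y x :=
  h.symm.swap_left.symm

lemma Crossing.triSet_subset {u v x y : Pt} (h : Crossing u v x y) :
    triSet {u, v, x} ⊆ triSet {u, x, y} ∪ triSet {v, x, y} := by
  intro z hz
  obtain ⟨s, l, h1, h2, h3, h4, h⟩ := h
  obtain ⟨α, β, γ, hα, hβ, hγ, hs, rfl⟩ := mem_triSet.1 hz
  have h2' : 0 < 1 - s := by linarith
  have h4' : 0 < 1 - l := by linarith
  rcases le_total (β * (1 - s)) (α * s) with hc | hc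
  · left
    refine mem_triSet.2 ⟨α - β * (1 - s) / s, γ + β / s * (1 - l), β / s * l, ?_, by positivity,
      by positivity, by field_simp; linear_combination s * hs, ?_⟩
    · rw [sub_nonneg, div_le_iff₀ h1]; exact hc
    · refine Pt.ext ?_ ?_ <;> rw [comb3_apply, comb3_apply] <;> field_simp
      · linear_combination β * h 0
      · linear_combination β * h 1
  · right
    refine mem_triSet.2 ⟨β - α * s / (1 - s), γ + α / (1 - s) * (1 - l), α / (1 - s) * l, ?_,
      by positivity, by positivity, by field_simp; linear_combination (1 - s) * hs, ?_⟩
    · rw [sub_nonneg, div_le_iff₀ h2']; exact hc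
    · refine Pt.ext ?_ ?_ <;> rw [comb3_apply, comb3_apply] <;> field_simp
      · linear_combination α * h 0
      · linear_combination α * h 1

lemma mem_twoDisks {u v x y p : Pt} {w₁ w₂ : ℝ × ℝ × ℝ}
    (h1 : ∀ p, pwr w₁ p = dotAt u v p - cotAt u v x * orient u v p)
    (h2 : ∀ p, pwr w₂ p = dotAt u v p - cotAt u v y * orient u v p) :
    p ∈ twoDisks u v x y ↔ pwr w₁ p < 0 ∨ pwr w₂ p < 0 := by
  rw [h1, h2, sub_neg, sub_neg]; rfl

lemma dotAt_eq_cotAt {u v p : Pt} (h : orient u v p ≠ 0) :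
    dotAt u v p = cotAt u v p * orient u v p := by
  unfold cotAt; field_simp

lemma Flippable.crossing {u v x y : Pt} (h : Flippable u v x y) : Crossing u v x y := by
  obtain ⟨hx, hy, hc⟩ := h
  set l := orient u v x / (orient u v x - orient u v y) with hl
  have hd : 0 < orient u v x - orient u v y := by linarith
  have hl0 : 0 < l := by positivity
  have hl1 : l < 1 := by rw [hl, div_lt_one hd]; linarith
  have huv : 0 < (v 0 - u 0) ^ 2 + (v 1 - u 1) ^ 2 := by
    by_contra! hn
    have e0 : v 0 - u 0 = 0 := by nlinarith [sq_nonneg (v 0 - u 0), sq_nonneg (v 1 - u 1)]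
    have e1 : v 1 - u 1 = 0 := by nlinarith [sq_nonneg (v 0 - u 0), sq_nonneg (v 1 - u 1)]
    simp [orient, e0, e1] at hx
  set m : Pt := (1 - l) • x + l • y with hm
  have hm0 : ∀ i, m i = (1 - l) * x i + l * y i := fun i => by rw [hm, comb2_apply]
  have hom : orient u v m = 0 := by
    have : orient u v m = (1 - l) * orient u v x + l * orient u v y := by
      unfold orient; rw [hm0, hm0]; ring
    rw [this, hl]; field_simp; ring
  set s := ((m 0 - u 0) * (v 0 - u 0) + (m 1 - u 1) * (v 1 - u 1)) /
    ((v 0 - u 0) ^ 2 + (v 1 - u 1) ^ 2) with hs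
  have hms : ∀ i : Fin 2, (1 - s) * u i + s * v i = m i := by
    have e : ∀ i : Fin 2, (v 0 - u 0) ^ 2 + (v 1 - u 1) ^ 2 ≠ 0 := fun _ => huv.ne'
    unfold orient at hom
    intro i
    have : s * ((v 0 - u 0) ^ 2 + (v 1 - u 1) ^ 2)
        = ((m 0 - u 0) * (v 0 - u 0) + (m 1 - u 1) * (v 1 - u 1)) := by
      rw [hs]; field_simp
    apply mul_right_cancel₀ huv.ne'
    fin_cases i
    · simp only [Fin.zero_eta]
      linear_combination (v 0 - u 0) * this + (v 1 - u 1) * hom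
    · simp only [Fin.mk_one]
      linear_combination (v 1 - u 1) * this - (v 0 - u 0) * hom
  have hdot : dotAt u v m < 0 := by
    obtain ⟨w, hw⟩ := exists_pwr u v (cotAt u v x)
    have hwx : pwr w x = 0 := by rw [hw, dotAt_eq_cotAt hx.ne', sub_self]
    have hwy : pwr w y < 0 := by
      rw [hw, dotAt_eq_cotAt hy.ne]; nlinarith
    have := pwr_comb (α := 1 - l) (β := l) (γ := 0) (by ring) w x y y
    rw [zero_smul, add_zero, ← hm, hwx, hw m, hom] at this
    have h2 : 0 ≤ (1 - l) * l * ((x 0 - y 0) ^ 2 + (x 1 - y 1) ^ 2) :=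
      mul_nonneg (mul_nonneg (by linarith) hl0.le) (by positivity)
    nlinarith
  have hss : dotAt u v m = - (s * (1 - s)) * ((v 0 - u 0) ^ 2 + (v 1 - u 1) ^ 2) := by
    unfold dotAt; rw [← hms 0, ← hms 1]; ring
  have : 0 < s * (1 - s) := by by_contra! hn; nlinarith
  have hs01 : 0 < s ∧ s < 1 := by
    constructor <;> by_contra! hn <;> nlinarith
  exact ⟨s, l, hs01.1, hs01.2, hl0, hl1, fun i => by rw [hms, hm0]⟩

end

section
variable {P : Set Pt}

lemma orderKTri_one_iff {t : Finset Pt} (ht : t.Nonempty) :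
    OrderKTri P 1 t ↔ ∃ w, (∀ p ∈ t, pwr w p = 0) ∧
      ∀ p ∈ P, ∀ q ∈ P, pwr w p < 0 → pwr w q < 0 → p = q := by
  rw [orderKTri_iff ht]
  simp only [Nat.cast_one, Set.encard_le_one_iff, mem_sep_iff]
  exact exists_congr fun w => and_congr_right fun _ =>
    ⟨fun h p hp q hq h1 h2 => h p q ⟨hp, h1⟩ ⟨hq, h2⟩,
      fun h p q hp hq => h p hp.1 q hq.1 hp.2 hq.2⟩

/-- The pair `u v` is a useful non-Delaunay edge, with opposite vertices `x` and `y`. -/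
def FlipConfig (P : Set Pt) (u v x y : Pt) : Prop :=
  Flippable u v x y ∧ ∀ p ∈ P, p ∈ twoDisks u v x y → p = x ∨ p = y

lemma Flippable.exists_pwr {u v x y : Pt} (h : Flippable u v x y) : ∃ w₁ w₂,
    pwr w₁ u = 0 ∧ pwr w₁ v = 0 ∧ pwr w₁ x = 0 ∧ pwr w₁ y < 0 ∧
    pwr w₂ u = 0 ∧ pwr w₂ v = 0 ∧ pwr w₂ x < 0 ∧ pwr w₂ y = 0 ∧
    ∀ p, p ∈ twoDisks u v x y ↔ pwr w₁ p < 0 ∨ pwr w₂ p < 0 := by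
  obtain ⟨hx, hy, hc⟩ := h
  obtain ⟨w₁, ⟨h1, h2, h3⟩, hw₁⟩ := exists_pwr_circum hx.ne'
  obtain ⟨w₂, ⟨h4, h5, h6⟩, hw₂⟩ := exists_pwr_circum hy.ne
  refine ⟨w₁, w₂, h1, h2, h3, ?_, h4, h5, ?_, h6, fun p => mem_twoDisks hw₁ hw₂⟩
  · rw [hw₁, dotAt_eq_cotAt hy.ne]; nlinarith
  · rw [hw₂, dotAt_eq_cotAt hx.ne']; nlinarith

lemma Flippable.ne {u v x y : Pt} (h : Flippable u v x y) :
    u ≠ v ∧ u ≠ x ∧ u ≠ y ∧ v ≠ x ∧ v ≠ y ∧ x ≠ y := by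
  obtain ⟨hx, hy, hc⟩ := h
  obtain ⟨h1, h2, h3⟩ := ne_of_orient hx.ne'
  obtain ⟨-, h5, h6⟩ := ne_of_orient hy.ne
  exact ⟨h1, h2, h5, h3, h6, by rintro rfl; linarith⟩

lemma FlipConfig.mem_delTri (hG : Generic P) {u v x y : Pt} (hu : u ∈ P) (hv : v ∈ P) (hx : x ∈ P)
    (hy : y ∈ P) (h : FlipConfig P u v x y) :
    ({u, x, y} : Finset Pt) ∈ delTri P ∧ ({v, x, y} : Finset Pt) ∈ delTri P := by
  obtain ⟨w₁, w₂, h1u, h1v, h1x, h1y, h2u, h2v, h2x, h2y, hS⟩ := h.1.exists_pwr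
  obtain ⟨huv, hux, huy, hvx, hvy, hxy⟩ := h.1.ne
  have e1 : ∀ p ∈ P, pwr w₁ p < 0 → p = y := fun p hp hlt =>
    (h.2 p hp ((hS p).2 (Or.inl hlt))).resolve_left (by rintro rfl; linarith)
  have e2 : ∀ p ∈ P, pwr w₂ p < 0 → p = x := fun p hp hlt =>
    (h.2 p hp ((hS p).2 (Or.inr hlt))).resolve_right (by rintro rfl; linarith)
  exact ⟨mem_delTri_of_flip hG hu hx hy hux huy hxy h1u h1x h1y h2u h2y h2x e1 e2,
    mem_delTri_of_flip hG hv hx hy hvx hvy hxy h1v h1x h1y h2v h2y h2x e1 e2⟩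

lemma FlipConfig.usefulEdge (hP : P.Finite) (hG : Generic P) {u v x y : Pt} (hu : u ∈ P)
    (hv : v ∈ P) (hx : x ∈ P) (hy : y ∈ P) (h : FlipConfig P u v x y) : UsefulEdge P 1 u v := by
  obtain ⟨hA, hB⟩ := h.mem_delTri hG hu hv hx hy
  obtain ⟨w₁, w₂, h1u, h1v, h1x, h1y, h2u, h2v, h2x, h2y, hS⟩ := h.1.exists_pwr
  obtain ⟨huv, hux, huy, hvx, hvy, hxy⟩ := h.1.ne
  have hne : ∃ a ∈ P, ∃ b ∈ P, ∃ c ∈ P, a ≠ b ∧ a ≠ c ∧ b ≠ c :=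
    ⟨u, hu, v, hv, x, hx, huv, hux, hvx⟩
  have hcr := h.1.crossing
  have sub1 : triSet {u, v, x} ⊆ triSet {u, x, y} ∪ triSet {v, x, y} := hcr.triSet_subset
  have sub2 : triSet {u, v, y} ⊆ triSet {u, x, y} ∪ triSet {v, x, y} := by
    have := hcr.swap_right.triSet_subset
    rwa [show ({u, y, x} : Finset Pt) = {u, x, y} by grind,
      show ({v, y, x} : Finset Pt) = {v, x, y} by grind] at this
  have sub3 : triSet {u, x, y} ⊆ triSet {u, v, x} ∪ triSet {u, v, y} := by
    have := hcr.symm.triSet_subset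
    rwa [show ({x, u, v} : Finset Pt) = {u, v, x} by grind,
      show ({y, u, v} : Finset Pt) = {u, v, y} by grind,
      show ({x, y, u} : Finset Pt) = {u, x, y} by grind] at this
  have sub4 : triSet {v, x, y} ⊆ triSet {u, v, x} ∪ triSet {u, v, y} := by
    have := hcr.symm.swap_right.triSet_subset
    rwa [show ({x, v, u} : Finset Pt) = {u, v, x} by grind,
      show ({y, v, u} : Finset Pt) = {u, v, y} by grind,
      show ({x, y, v} : Finset Pt) = {v, x, y} by grind] at this
  set A : Finset Pt := {u, x, y}
  set B : Finset Pt := {v, x, y}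
  set C : Finset Pt := {u, v, x} with hC
  set D : Finset Pt := {u, v, y} with hD
  have e1 : ∀ p ∈ P, pwr w₁ p < 0 → p = y := fun p hp hlt =>
    (h.2 p hp ((hS p).2 (Or.inl hlt))).resolve_left (by rintro rfl; linarith)
  have e2 : ∀ p ∈ P, pwr w₂ p < 0 → p = x := fun p hp hlt =>
    (h.2 p hp ((hS p).2 (Or.inr hlt))).resolve_right (by rintro rfl; linarith)
  have hC3 : C.card = 3 := Finset.card_eq_three.2 ⟨_, _, _, huv, hux, hvx, rfl⟩
  have hD3 : D.card = 3 := Finset.card_eq_three.2 ⟨_, _, _, huv, huy, hvy, rfl⟩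
  have hCP : (C : Set Pt) ⊆ P := by
    intro p hp; simp [hC] at hp; rcases hp with rfl | rfl | rfl <;> assumption
  have hDP : (D : Set Pt) ⊆ P := by
    intro p hp; simp [hD] at hp; rcases hp with rfl | rfl | rfl <;> assumption
  have hC1 : OrderKTri P 1 C := (orderKTri_one_iff ⟨u, by simp [hC]⟩).2 ⟨w₁, by
    intro p hp; simp [hC] at hp; rcases hp with rfl | rfl | rfl <;> assumption,
    fun p hp q hq hp' hq' => (e1 p hp hp').trans (e1 q hq hq').symm⟩
  have hD1 : OrderKTri P 1 D := (orderKTri_one_iff ⟨u, by simp [hD]⟩).2 ⟨w₂, by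
    intro p hp; simp [hD] at hp; rcases hp with rfl | rfl | rfl <;> assumption,
    fun p hp q hq hp' hq' => (e2 p hp hp').trans (e2 q hq hq').symm⟩
  have hCD : ∀ z, GenPt P z → z ∈ triSet C → z ∈ triSet D → False := by
    intro z hz h1 h2
    obtain ⟨α, β, γ, hα, hβ, hγ, hs, rfl⟩ := bary_pos hu hv hx huv hux hvx hz h1
    obtain ⟨α', β', γ', hα', hβ', hγ', hs', hz'⟩ := bary_pos hu hv hy huv huy hvy hz h2
    have o1 := orient_comb hs u v u v x
    have o2 := orient_comb hs' u v u v y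
    rw [← hz'] at o2
    simp only [orient_left, orient_right, mul_zero, zero_add] at o1 o2
    nlinarith [h.1.1, h.1.2.1]
  refine ⟨(delTri P \ {A, B}) ∪ {C, D}, ⟨isTriangulation_of hP hG hne ?_ ?_ ?_ ?_, ?_⟩, C,
    Or.inr (Or.inl rfl), by simp [hC], by simp [hC]⟩
  · rintro t (ht | rfl | rfl)
    exacts [⟨ht.1.1, ht.1.2.1⟩, ⟨hC3, hCP⟩, ⟨hD3, hDP⟩]
  · intro p hp
    obtain ⟨t, ht, hpt⟩ := delTri_vertex hP hG hne hp
    by_cases htAB : t ∈ ({A, B} : Set (Finset Pt))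
    · have : p = u ∨ p = v ∨ p = x ∨ p = y := by
        rcases htAB with rfl | rfl <;> simp [A, B] at hpt <;> tauto
      rcases this with rfl | rfl | rfl | rfl
      · exact ⟨C, by simp, by simp [hC]⟩
      · exact ⟨C, by simp, by simp [hC]⟩
      · exact ⟨C, by simp, by simp [hC]⟩
      · exact ⟨D, by simp, by simp [hD]⟩
    · exact ⟨t, Or.inl ⟨ht, htAB⟩, hpt⟩
  · intro z hz t ht s hs hzt hzs
    have key : ∀ t ∈ delTri P \ {A, B}, z ∈ triSet t → z ∈ triSet A ∪ triSet B → False := by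
      rintro t ⟨ht, hn⟩ hzt (hzA | hzB)
      · exact hn (Or.inl (delTri_uniq hG hz ht hA hzt hzA))
      · exact hn (Or.inr (delTri_uniq hG hz ht hB hzt hzB))
    have hCDAB : ∀ t ∈ ({C, D} : Set (Finset Pt)), z ∈ triSet t → z ∈ triSet A ∪ triSet B := by
      rintro t (rfl | rfl) h
      exacts [sub1 h, sub2 h]
    rcases ht with ht | ht <;> rcases hs with hs | hs
    · exact delTri_uniq hG hz ht.1 hs.1 hzt hzs
    · exact (key t ht hzt (hCDAB s hs hzs)).elim
    · exact (key s hs hzs (hCDAB t ht hzt)).elim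
    · rcases ht with rfl | rfl <;> rcases hs with rfl | rfl
      exacts [rfl, (hCD z hz hzt hzs).elim, (hCD z hz hzs hzt).elim, rfl]
  · intro z hz hzP
    obtain ⟨t, ht, hzt⟩ := exists_delTri hP hG hne hz hzP
    by_cases htAB : t ∈ ({A, B} : Set (Finset Pt))
    · have : z ∈ triSet C ∪ triSet D := by
        rcases htAB with rfl | rfl
        exacts [sub3 hzt, sub4 hzt]
      rcases this with h | h
      exacts [⟨C, by simp, h⟩, ⟨D, by simp, h⟩]
    · exact ⟨t, Or.inl ⟨ht, htAB⟩, hzt⟩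
  · rintro t (ht | rfl | rfl)
    · obtain ⟨z, r, h1, h2⟩ := orderKTri_zero_of_mem ht.1
      exact ⟨z, r, h1, h2.trans (by simp)⟩
    exacts [hC1, hD1]

lemma FlipConfig.not_delaunayEdge {u v x y : Pt} (hx : x ∈ P) (hy : y ∈ P)
    (h : Flippable u v x y) : ¬ DelaunayEdge P u v := by
  rintro ⟨T, hT, t, ht, hut, hvt⟩
  obtain ⟨w, hw, hw0⟩ := (orderKTri_iff ⟨u, hut⟩).1 (hT.2 t ht)
  obtain ⟨w₁, w₂, h1u, h1v, h1x, h1y, -⟩ := h.exists_pwr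
  simp only [Nat.cast_zero, nonpos_iff_eq_zero, encard_eq_zero] at hw0
  have pos : ∀ p ∈ P, 0 ≤ pwr w p := fun p hp => by
    by_contra! hn
    exact (hw0 ▸ (⟨hp, hn⟩ : p ∈ {p ∈ P | pwr w p < 0}) : p ∈ (∅ : Set Pt))
  have key := pwr_pencil (w := w) (w' := w₁) (by rw [hw u hut, h1u]) (by rw [hw v hvt, h1v]) x y
  have a1 := pos x hx
  have a2 := pos y hy
  have := h.1
  have := h.2.1
  nlinarith

end

section
variable {P : Set Pt}

lemma mem_closure_interior (hG : Generic P) {t : Finset Pt} (h3 : t.card = 3)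
    (ht : (t : Set Pt) ⊆ P) {z : Pt} (hz : z ∈ triSet t) : z ∈ closure (interior (triSet t)) := by
  have hc : Convex ℝ (triSet t) := convex_convexHull _ _
  rw [hc.closure_interior_eq_closure_of_nonempty_interior]
  · exact subset_closure hz
  · obtain ⟨a, b, c, hab, hac, hbc, rfl⟩ := Finset.card_eq_three.1 h3
    exact ⟨_, comb_mem_interior (hG.orient_ne (ht (by simp)) (ht (by simp)) (ht (by simp))
      hab hac hbc) (α := 1 / 3) (β := 1 / 3) (γ := 1 / 3) (by norm_num) (by norm_num)
      (by norm_num) (by norm_num)⟩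

lemma IsTriangulation.eq_of_mem_interior (hG : Generic P) {T : Set (Finset Pt)}
    (hT : IsTriangulation P T) {t s : Finset Pt} (ht : t ∈ T) (hs : s ∈ T) {z : Pt}
    (hzt : z ∈ interior (triSet t)) (hzs : z ∈ triSet s) : t = s := by
  by_contra hne
  have h := mem_closure_interior hG (hT.2.1 s hs).1 (hT.2.1 s hs).2 hzs
  obtain ⟨y, hy1, hy2⟩ := mem_closure_iff.1 h _ isOpen_interior hzt
  have := hT.2.2.2.1 ht hs hne
  exact this.subset ⟨hy1, hy2⟩

lemma exists_generic_mid (hP : P.Finite) (hG : Generic P) {a b : Pt} (ha : a ∈ P) (hb : b ∈ P)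
    (hab : a ≠ b) : ∃ s : ℝ, 0 < s ∧ s < 1 ∧ ∀ p ∈ P, ∀ q ∈ P, p ≠ q →
      orient p q ((1 - s) • a + s • b) = 0 → ({p, q} : Finset Pt) = {a, b} := by
  let F : Pt × Pt → Set ℝ := fun r =>
    {s | r.1 ≠ r.2 ∧ ({r.1, r.2} : Finset Pt) ≠ {a, b} ∧ orient r.1 r.2 ((1 - s) • a + s • b) = 0}
  have hfin : (⋃ r ∈ P ×ˢ P, F r).Finite := by
    refine (hP.prod hP).biUnion fun r hr => Set.Subsingleton.finite ?_
    rintro s ⟨h1, h2, h3⟩ s' ⟨-, -, h4⟩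
    by_contra hss
    have lin : ∀ s : ℝ, orient r.1 r.2 ((1 - s) • a + s • b)
        = (1 - s) * orient r.1 r.2 a + s * orient r.1 r.2 b := by
      intro s; unfold orient; rw [comb2_apply, comb2_apply]; ring
    rw [lin] at h3 h4
    have hs : s - s' ≠ 0 := sub_ne_zero.2 hss
    have oa : orient r.1 r.2 a = 0 := by
      apply mul_left_cancel₀ hs
      linear_combination s * h4 - s' * h3
    have ob : orient r.1 r.2 b = 0 := by
      apply mul_left_cancel₀ hs
      linear_combination (1 - s') * h3 - (1 - s) * h4
    have ma : a = r.1 ∨ a = r.2 := by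
      by_contra! hn
      exact hG.orient_ne hr.1 hr.2 ha h1 hn.1.symm hn.2.symm oa
    have mb : b = r.1 ∨ b = r.2 := by
      by_contra! hn
      exact hG.orient_ne hr.1 hr.2 hb h1 hn.1.symm hn.2.symm ob
    apply h2
    rcases ma with h5 | h5 <;> rcases mb with h6 | h6
    · exact absurd (h5.trans h6.symm) hab
    · rw [h5, h6]
    · rw [h5, h6, Finset.pair_comm]
    · exact absurd (h5.trans h6.symm) hab
  obtain ⟨s, hs, hs'⟩ := (Set.Ioo_infinite (zero_lt_one' ℝ)).exists_notMem_finite hfin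
  refine ⟨s, hs.1, hs.2, fun p hp q hq hpq h0 => ?_⟩
  by_contra hne
  exact hs' (Set.mem_biUnion (x := (p, q)) ⟨hp, hq⟩ ⟨hpq, hne, h0⟩)

lemma IsTriangulation.exists_neighbor (hP : P.Finite) (hG : Generic P) {T : Set (Finset Pt)}
    (hT : IsTriangulation P T) {a b c p : Pt} (habc : ({a, b, c} : Finset Pt) ∈ T)
    (hab : a ≠ b) (hp : p ∈ P) (ho : orient a b c * orient a b p < 0) :
    ∃ q ∈ P, ({a, b, q} : Finset Pt) ∈ T ∧ orient a b c * orient a b q < 0 := by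
  have hsub := (hT.2.1 _ habc).2
  have ha : a ∈ P := hsub (by simp)
  have hb : b ∈ P := hsub (by simp)
  have hc : c ∈ P := hsub (by simp)
  obtain ⟨s, hs0, hs1, hs⟩ := exists_generic_mid hP hG ha hb hab
  set m : Pt := (1 - s) • a + s • b with hm
  have hmabc : m ∈ triSet {a, b, c} := mem_triSet.2
    ⟨1 - s, s, 0, by linarith, hs0.le, le_rfl, by ring, by rw [zero_smul, add_zero]⟩
  let z : ℝ → Pt := fun ε => (1 - ε) • m + ε • p
  have hz0 : Filter.Tendsto z (nhdsWithin 0 (Ioi 0)) (nhds m) := by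
    have : Continuous z := by fun_prop
    have h := this.tendsto 0
    simp only [z, sub_zero, one_smul, zero_smul, add_zero] at h
    exact h.mono_left nhdsWithin_le_nhds
  have hmo : orient a b m = 0 := by
    rw [hm]; unfold orient; rw [comb2_apply, comb2_apply]; ring
  have hzo : ∀ ε, orient a b (z ε) = ε * orient a b p := by
    intro ε
    have : orient a b (z ε) = (1 - ε) * orient a b m + ε * orient a b p := by
      simp only [z]; unfold orient
      rw [comb2_apply _ _ _ _ 0, comb2_apply _ _ _ _ 1]; ring
    rw [this, hmo]; ring
  by_contra! hcon
  have hsame : ∀ q, 0 ≤ orient a b c * orient a b q → ∀ ε > 0, z ε ∉ triSet {a, b, q} := by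
    intro q hq ε hε hmem
    obtain ⟨α, β, γ, hα, hβ, hγ, hsum, hzz⟩ := mem_triSet.1 hmem
    have h1 := hzo ε
    rw [hzz, orient_comb hsum, orient_left, orient_right] at h1
    have : orient a b c * (ε * orient a b p) < 0 := by nlinarith
    rw [← h1] at this
    nlinarith [mul_nonneg hγ hq]
  have hev : ∀ t ∈ T, ∀ᶠ ε in nhdsWithin (0 : ℝ) (Ioi 0), z ε ∉ triSet t := by
    intro t ht
    by_cases hmt : m ∈ triSet t
    · have hclose : ∃ q ∈ P, t = {a, b, q} ∧ 0 ≤ orient a b c * orient a b q := by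
        have h3 := (hT.2.1 t ht).1
        have htP := (hT.2.1 t ht).2
        have main : ∀ d e f : Pt, d ≠ e → t = {d, e, f} → orient d e m = 0 →
            ∃ q ∈ P, t = {a, b, q} ∧ 0 ≤ orient a b c * orient a b q := by
          rintro d e f hde rfl h0
          have := hs d (htP (by simp)) e (htP (by simp)) hde h0
          have e1 : ({d, e, f} : Finset Pt) = {a, b, f} := by
            have h5 : ∀ x, x = d ∨ x = e ↔ x = a ∨ x = b := fun x => by
              simpa using Finset.ext_iff.1 this x
            ext x
            simp only [Finset.mem_insert, Finset.mem_singleton, ← or_assoc, h5 x]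
          have hf : f ∈ P := htP (by simp)
          exact ⟨f, hf, e1, hcon f hf (e1 ▸ ht)⟩
        obtain ⟨d, e, f, hde, hdf, hef, htdef⟩ := Finset.card_eq_three.1 h3
        obtain ⟨α, β, γ, hα, hβ, hγ, hsum, hmm⟩ := mem_triSet.1 (htdef ▸ hmt)
        rcases hα.eq_or_lt with rfl | hα'
        · refine main e f d hef (by rw [htdef]; ext x; simp; tauto) ?_
          rw [hmm, orient_comb hsum]; simp
        rcases hβ.eq_or_lt with rfl | hβ'
        · refine main d f e hdf (by rw [htdef]; ext x; simp; tauto) ?_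
          rw [hmm, orient_comb hsum]; simp
        rcases hγ.eq_or_lt with rfl | hγ'
        · refine main d e f hde htdef ?_
          rw [hmm, orient_comb hsum]; simp
        rw [htdef] at htP
        have hintr := comb_mem_interior (hG.orient_ne (htP (by simp)) (htP (by simp))
          (htP (by simp)) hde hdf hef) hα' hβ' hγ' hsum
        rw [← hmm, ← htdef] at hintr
        have heq := hT.eq_of_mem_interior hG ht habc hintr hmabc
        exact ⟨c, hc, heq, mul_self_nonneg _⟩
      obtain ⟨q, hq, rfl, hpos⟩ := hclose
      filter_upwards [self_mem_nhdsWithin] with ε hε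
      exact hsame q hpos ε hε
    · exact hz0.eventually ((isClosed_triSet t).isOpen_compl.mem_nhds hmt)
  have hall : ∀ᶠ ε in nhdsWithin (0 : ℝ) (Ioi 0), ∀ t ∈ T, z ε ∉ triSet t :=
    (Filter.eventually_all_finite hT.1).2 hev
  have hlt : ∀ᶠ ε in nhdsWithin (0 : ℝ) (Ioi 0), ε < 1 :=
    nhdsWithin_le_nhds (eventually_lt_nhds one_pos)
  obtain ⟨ε, ⟨h1, h2⟩, h3⟩ := ((hall.and hlt).and self_mem_nhdsWithin).exists
  have hεpos : 0 < ε := h3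
  have hmP : m ∈ convexHull ℝ P := triSet_subset_hull hsub hmabc
  have : z ε ∈ convexHull ℝ P := (convex_convexHull ℝ P) hmP (subset_convexHull ℝ P hp)
    (by linarith) hεpos.le (by ring)
  rw [← hT.2.2.2.2] at this
  simp only [mem_iUnion] at this
  obtain ⟨t, ht, h⟩ := this
  exact h1 t ht h

lemma IsTriangulation.exists_neg (hG : Generic P) {T : Set (Finset Pt)}
    (hT : IsTriangulation P T) {a b c p : Pt} (habc : ({a, b, c} : Finset Pt) ∈ T)
    (hab : a ≠ b) (hac : a ≠ c) (hbc : b ≠ c) (hp : p ∈ P) (hpa : p ≠ a) (hpb : p ≠ b)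
    (hpc : p ≠ c) : orient a b c * orient a b p < 0 ∨ orient b c a * orient b c p < 0 ∨
      orient c a b * orient c a p < 0 := by
  have hsub := (hT.2.1 _ habc).2
  have ha : a ∈ P := hsub (by simp)
  have hb : b ∈ P := hsub (by simp)
  have hc : c ∈ P := hsub (by simp)
  have ho := hG.orient_ne ha hb hc hab hac hbc
  have hsq := mul_self_pos.2 ho
  obtain ⟨α, β, γ, hs, hz⟩ := exists_bary ho p
  have e1 := orient_comb hs a b a b c
  have e2 := orient_comb hs b c a b c
  have e3 := orient_comb hs c a a b c
  rw [← hz] at e1 e2 e3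
  simp only [orient_left, orient_right, mul_zero, zero_add, add_zero] at e1 e2 e3
  rw [orient_rot a b c] at e2
  rw [orient_rot b c a, orient_rot a b c] at e3
  have n1 := hG.orient_ne ha hb hp hab hpa.symm hpb.symm
  have n2 := hG.orient_ne hb hc hp hbc hpb.symm hpc.symm
  have n3 := hG.orient_ne hc ha hp hac.symm hpc.symm hpa.symm
  rw [orient_rot a b c, orient_rot b c a, orient_rot a b c]
  by_contra! hn
  rw [e1, e2, e3] at hn
  rw [e1] at n1
  rw [e2] at n2
  rw [e3] at n3
  have hα : 0 < α := lt_of_le_of_ne (by nlinarith [hn.2.1]) (by rintro rfl; simp at n2)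
  have hβ : 0 < β := lt_of_le_of_ne (by nlinarith [hn.2.2]) (by rintro rfl; simp at n3)
  have hγ : 0 < γ := lt_of_le_of_ne (by nlinarith [hn.1]) (by rintro rfl; simp at n1)
  have hintr := comb_mem_interior ho hα hβ hγ hs
  rw [← hz] at hintr
  obtain ⟨t, ht, hpt⟩ := hT.2.2.1 p hp
  have := hT.eq_of_mem_interior hG habc ht hintr (subset_triSet t hpt)
  rw [← this] at hpt
  simp at hpt
  tauto

end

section
variable {P : Set Pt}

/-- In an order-1 Delaunay triangulation, a triangle `a b c` whose circumdisk contains a point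
`p` beyond the side `a b` is adjacent to the triangle `a b p`. -/
lemma IsOrderDT.adjacent (hP : P.Finite) (hG : Generic P) {T : Set (Finset Pt)}
    (hT : IsOrderDT P 1 T) {p : Pt} (hp : p ∈ P) :
    ∀ a b c : Pt, a ≠ b → a ≠ c → b ≠ c → ({a, b, c} : Finset Pt) ∈ T →
      orient a b c * orient a b p < 0 → dotAt a b p - cotAt a b c * orient a b p < 0 →
      ({a, b, p} : Finset Pt) ∈ T := by
  by_contra! hcon
  let F : Pt × Pt × Pt → ℝ := fun r => dotAt r.1 r.2.1 p - cotAt r.1 r.2.1 r.2.2 * orient r.1 r.2.1 p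
  let B : Set (Pt × Pt × Pt) := {r | r.1 ≠ r.2.1 ∧ r.1 ≠ r.2.2 ∧ r.2.1 ≠ r.2.2 ∧
    ({r.1, r.2.1, r.2.2} : Finset Pt) ∈ T ∧ orient r.1 r.2.1 r.2.2 * orient r.1 r.2.1 p < 0 ∧
    F r < 0 ∧ ({r.1, r.2.1, p} : Finset Pt) ∉ T}
  have hBfin : B.Finite := by
    refine (hP.prod (hP.prod hP)).subset fun r hr => ?_
    have h := (hT.1.2.1 _ hr.2.2.2.1).2
    exact ⟨h (by simp), h (by simp), h (by simp)⟩
  have hBne : B.Nonempty := by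
    obtain ⟨a, b, c, h⟩ := hcon
    exact ⟨(a, b, c), h⟩
  obtain ⟨⟨a, b, c⟩, ⟨hab, hac, hbc, habc, ho, hneg, hnot⟩, hmin⟩ := Set.exists_min_image B F hBfin hBne
  simp only [F] at hab hac hbc habc ho hneg hnot hmin
  have hsub := (hT.1.2.1 _ habc).2
  have ha : a ∈ P := hsub (by simp)
  have hb : b ∈ P := hsub (by simp)
  have hc : c ∈ P := hsub (by simp)
  have hoc := hG.orient_ne ha hb hc hab hac hbc
  obtain ⟨w, ⟨hwa, hwb, hwc⟩, hw⟩ := exists_pwr_circum hoc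
  have hpn : pwr w p < 0 := by rw [hw]; exact hneg
  have uniq : ∀ (d e f : Pt) (w : ℝ × ℝ × ℝ), ({d, e, f} : Finset Pt) ∈ T → d ≠ e → d ≠ f → e ≠ f →
      pwr w d = 0 → pwr w e = 0 → pwr w f = 0 → ∀ x ∈ P, ∀ y ∈ P, pwr w x < 0 → pwr w y < 0 →
      x = y := by
    intro d e f w ht hde hdf hef hd he hf x hx y hy hwx hwy
    obtain ⟨w', hw'0, hw'⟩ := (orderKTri_one_iff ⟨d, by simp⟩).1 (hT.2 _ ht)
    have hs := (hT.1.2.1 _ ht).2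
    have ho := hG.orient_ne (hs (by simp)) (hs (by simp)) (hs (by simp)) hde hdf hef
    have heq := fun p => pwr_unique ho (w := w) (w' := w') (by rw [hd, hw'0 d (by simp)])
      (by rw [he, hw'0 e (by simp)]) (by rw [hf, hw'0 f (by simp)]) p
    exact hw' x hx y hy (heq x ▸ hwx) (heq y ▸ hwy)
  have u1 : ∀ x ∈ P, pwr w x < 0 → x = p := fun x hx h =>
    uniq a b c w habc hab hac hbc hwa hwb hwc x hx p hp h hpn
  obtain ⟨q, hq, habq, hoq⟩ := hT.1.exists_neighbor hP hG habc hab hp ho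
  have hpq : q ≠ p := by rintro rfl; exact hnot habq
  have hqo : orient a b q ≠ 0 := by rintro h; simp [h] at hoq
  obtain ⟨-, haq, hbq⟩ := ne_of_orient hqo
  have hcq : c ≠ q := by rintro rfl; nlinarith [mul_self_nonneg (orient a b c)]
  have hwq : 0 < pwr w q := by
    refine lt_of_le_of_ne (not_lt.1 fun h => hpq (u1 q hq h)) (Ne.symm ?_)
    exact hG.pwr_ne ha hb hc hq hab hac haq hbc hbq hcq w hwa hwb hwc
  obtain ⟨w', ⟨hw'a, hw'b, hw'q⟩, hw'⟩ := exists_pwr_circum hqo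
  have hpen := pwr_pencil (w := w') (w' := w) (by rw [hwa, hw'a]) (by rw [hwb, hw'b]) p q
  rw [hw'q] at hpen
  have hopq : 0 < orient a b p * orient a b q := by
    have h1 : 0 < (orient a b c * orient a b p) * (orient a b c * orient a b q) :=
      mul_pos_of_neg_of_neg ho hoq
    nlinarith [mul_self_pos.2 hoc]
  have hlt : pwr w' p < pwr w p := by
    by_contra! hle
    have h2 : (pwr w' p - pwr w p) * orient a b q * orient a b q
        = - (pwr w q * (orient a b p * orient a b q)) := by rw [hpen]; ring
    nlinarith [mul_pos hwq hopq, mul_nonneg (sub_nonneg.2 hle) (mul_self_nonneg (orient a b q))]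
  have hpn' : pwr w' p < 0 := hlt.trans hpn
  have u2 : ∀ x ∈ P, pwr w' x < 0 → x = p := fun x hx h =>
    uniq a b q w' habq hab haq hbq hw'a hw'b hw'q x hx p hp h hpn'
  have hpa : p ≠ a := by rintro rfl; linarith
  have hpb : p ≠ b := by rintro rfl; linarith
  have hpc : p ≠ c := by rintro rfl; linarith
  -- the circumdisk of `a b p` contains `c`
  have hpo : orient a b p ≠ 0 := by rintro h; simp [h] at ho
  have hcontra : ({a, b, p} : Finset Pt) ∉ delTri P := by
    rintro ⟨-, -, v, hv, hv0⟩
    have h := pwr_pencil (w := v) (w' := w) (by rw [hwa, hv a (by simp)])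
      (by rw [hwb, hv b (by simp)]) c p
    rw [hv p (by simp), hwc] at h
    have h3 := hv0 c hc
    have h2 : pwr v c * (orient a b p * orient a b p) = - pwr w p * (orient a b c * orient a b p) := by
      linear_combination orient a b p * h
    nlinarith [mul_nonneg h3 (mul_self_nonneg (orient a b p)), mul_pos_of_neg_of_neg hpn ho]
  have step : ∀ e f : Pt, e ∈ P → f ∈ P → e ≠ f → e ≠ q → f ≠ q → p ≠ e → p ≠ f →
      ({e, f, q} : Finset Pt) = {a, b, q} → ({f, e, p} : Finset Pt) = {a, b, p} →
      pwr w' e = 0 → pwr w' f = 0 →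
      orient f q e * orient f q p < 0 → False := by
    intro e f he hf hef heq hfq hpe hpf hset hset' hwe hwf hneg
    have hfqe : ({f, q, e} : Finset Pt) ∈ T := by
      rw [show ({f, q, e} : Finset Pt) = {e, f, q} by ext x; simp; tauto, hset]; exact habq
    have hofqe := hG.orient_ne hf hq he hfq hef.symm heq.symm
    have hval : dotAt f q p - cotAt f q e * orient f q p = pwr w' p := by
      obtain ⟨v, ⟨h1, h2, h3⟩, h4⟩ := exists_pwr_circum hofqe
      rw [← h4]
      exact pwr_unique hofqe (by rw [h1, hwf]) (by rw [h2, hw'q]) (by rw [h3, hwe]) p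
    have hfqp : ({f, q, p} : Finset Pt) ∈ T := by
      by_contra hn
      have := hmin (f, q, e) ⟨hfq, hef.symm, heq.symm, hfqe, hneg, by
        simp only [F]; rw [hval]; exact hpn', hn⟩
      simp only at this
      rw [hval, ← hw] at this
      linarith
    have hofqp : orient f q p ≠ 0 := by rintro h; simp [h] at hneg
    obtain ⟨v, ⟨hvf, hvq, hvp⟩, -⟩ := exists_pwr_circum hofqp
    have hpen := pwr_pencil (w := v) (w' := w') (by rw [hvf, hwf]) (by rw [hvq, hw'q]) e p
    rw [hvp, hwe] at hpen
    have hve : pwr v e < 0 := by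
      by_contra! h3
      have h2 : pwr v e * (orient f q p * orient f q p)
          = - pwr w' p * (orient f q e * orient f q p) := by
        linear_combination orient f q p * hpen
      nlinarith [mul_nonneg h3 (mul_self_nonneg (orient f q p)), mul_pos_of_neg_of_neg hpn' hneg]
    have u3 : ∀ x ∈ P, pwr v x < 0 → x = e := fun x hx h =>
      uniq f q p v hfqp hfq hpf.symm hpq hvf hvq hvp x hx e he h hve
    exact hcontra (hset' ▸ mem_delTri_of_flip hG hf he hp hef.symm hpf.symm hpe.symm hwf hwe hpn' hvf hvp hve u2 u3)
  rcases hT.1.exists_neg hG habq hab haq hbq hp hpa hpb hpq.symm with h | h | h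
  · nlinarith
  · exact step a b ha hb hab haq hbq hpa hpb rfl (by ext x; simp; tauto) hw'a hw'b h
  · refine step b a hb ha hab.symm hbq haq hpb hpa (by ext x; simp; tauto) rfl hw'b hw'a ?_
    rw [orient_swap q a b, orient_swap q a p]
    linarith

end

section
variable {P : Set Pt}

lemma exists_flipConfig {u v c p : Pt} (hc : c ∈ P) (hp : p ∈ P)
    (ho : orient u v c * orient u v p < 0) {w w' : ℝ × ℝ × ℝ}
    (hu : pwr w u = 0) (hv : pwr w v = 0) (hwc : pwr w c = 0) (hwp : pwr w p < 0)
    (hu' : pwr w' u = 0) (hv' : pwr w' v = 0) (hwp' : pwr w' p = 0)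
    (h1 : ∀ x ∈ P, pwr w x < 0 → x = p) (h2 : ∀ x ∈ P, pwr w' x < 0 → x = c) :
    ∃ x ∈ P, ∃ y ∈ P, FlipConfig P u v x y := by
  have hoc : orient u v c ≠ 0 := by rintro h; simp [h] at ho
  have hop : orient u v p ≠ 0 := by rintro h; simp [h] at ho
  obtain ⟨w₁, ⟨a1, a2, a3⟩, a4⟩ := exists_pwr_circum hoc
  obtain ⟨w₂, ⟨b1, b2, b3⟩, b4⟩ := exists_pwr_circum hop
  have e1 := pwr_unique hoc (hu.trans a1.symm) (hv.trans a2.symm) (hwc.trans a3.symm)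
  have e2 := pwr_unique hop (hu'.trans b1.symm) (hv'.trans b2.symm) (hwp'.trans b3.symm)
  have hlt : (cotAt u v p - cotAt u v c) * orient u v p < 0 := by
    have := hwp
    rw [e1, a4, dotAt_eq_cotAt hop] at this
    linarith
  rcases lt_or_gt_of_ne hoc with hneg | hpos
  · have hpp : 0 < orient u v p := by by_contra! h; nlinarith
    refine ⟨p, hp, c, hc, ⟨hpp, hneg, by nlinarith⟩, fun x hx hxS => ?_⟩
    rcases (mem_twoDisks b4 a4).1 hxS with h | h
    · exact Or.inr (h2 x hx (by rwa [e2]))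
    · exact Or.inl (h1 x hx (by rwa [e1]))
  · have hpp : orient u v p < 0 := by by_contra! h; nlinarith
    refine ⟨c, hc, p, hp, ⟨hpos, hpp, by nlinarith⟩, fun x hx hxS => ?_⟩
    rcases (mem_twoDisks a4 b4).1 hxS with h | h
    · exact Or.inr (h1 x hx (by rwa [e1]))
    · exact Or.inl (h2 x hx (by rwa [e2]))

lemma IsOrderDT.exists_pwr {T : Set (Finset Pt)} (hT : IsOrderDT P 1 T)
    {a b c : Pt} (h : ({a, b, c} : Finset Pt) ∈ T) :
    ∃ w, pwr w a = 0 ∧ pwr w b = 0 ∧ pwr w c = 0 ∧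
      ∀ x ∈ P, ∀ y ∈ P, pwr w x < 0 → pwr w y < 0 → x = y := by
  obtain ⟨w', hw'0, hw'⟩ := (orderKTri_one_iff ⟨a, by simp⟩).1 (hT.2 _ h)
  exact ⟨w', hw'0 a (by simp), hw'0 b (by simp), hw'0 c (by simp), hw'⟩

lemma UsefulEdge.exists_flipConfig (hP : P.Finite) (hG : Generic P) {u v : Pt}
    (huv : u ≠ v) (h : UsefulEdge P 1 u v) (hnd : ¬ DelaunayEdge P u v) :
    ∃ x ∈ P, ∃ y ∈ P, FlipConfig P u v x y := by
  obtain ⟨T, hT, t, ht, hut, hvt⟩ := h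
  obtain ⟨h3, htP⟩ := hT.1.2.1 t ht
  obtain ⟨c, huc, hvc, rfl⟩ : ∃ c, u ≠ c ∧ v ≠ c ∧ t = {u, v, c} := by
    have h1 : ((t.erase u).erase v).card = 1 := by
      rw [Finset.card_erase_of_mem (by simp [huv.symm, hvt]), Finset.card_erase_of_mem hut, h3]
    obtain ⟨c, hc⟩ := Finset.card_eq_one.1 h1
    have hcm : c ∈ (t.erase u).erase v := hc ▸ Finset.mem_singleton_self c
    simp only [Finset.mem_erase] at hcm
    refine ⟨c, hcm.2.1.symm, hcm.1.symm, ?_⟩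
    rw [← Finset.insert_erase hut, ← Finset.insert_erase (s := t.erase u) (a := v)
      (by simp [huv.symm, hvt]), hc]
  have hu : u ∈ P := htP (by simp)
  have hv : v ∈ P := htP (by simp)
  have hc : c ∈ P := htP (by simp)
  have hne : ∃ a ∈ P, ∃ b ∈ P, ∃ c ∈ P, a ≠ b ∧ a ≠ c ∧ b ≠ c :=
    ⟨u, hu, v, hv, c, hc, huv, huc, hvc⟩
  have hdel : ∀ s ∈ delTri P, u ∈ s → v ∈ s → False := fun s hs h1 h2 =>
    hnd ⟨_, delTri_isOrderDT hP hG hne, s, hs, h1, h2⟩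
  have ho := hG.orient_ne hu hv hc huv huc hvc
  obtain ⟨w, hwu, hwv, hwc, hw⟩ := hT.exists_pwr ht
  by_cases hex : ∃ p ∈ P, pwr w p < 0
  swap
  · push Not at hex
    refine (hdel {u, v, c} ⟨h3, htP, w, ?_, hex⟩ (by simp) (by simp)).elim
    intro p hp; simp at hp; rcases hp with rfl | rfl | rfl <;> assumption
  obtain ⟨p, hp, hwp⟩ := hex
  have u1 : ∀ x ∈ P, pwr w x < 0 → x = p := fun x hx h => hw x hx p hp h hwp
  have hpu : p ≠ u := by rintro rfl; linarith
  have hpv : p ≠ v := by rintro rfl; linarith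
  have hpc : p ≠ c := by rintro rfl; linarith
  have step : ∀ d e f : Pt, d ≠ e → d ≠ f → e ≠ f → ({d, e, f} : Finset Pt) = {u, v, c} →
      pwr w d = 0 → pwr w e = 0 → pwr w f = 0 → p ≠ d → p ≠ e → d ∈ P → e ∈ P → f ∈ P →
      orient d e f * orient d e p < 0 →
      ∃ w', pwr w' d = 0 ∧ pwr w' e = 0 ∧ pwr w' p = 0 ∧ pwr w' f < 0 ∧
        ∀ x ∈ P, pwr w' x < 0 → x = f := by
    intro d e f hde hdf hef hset hwd hwe hwf hpd hpe hd he hf hneg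
    have hdef : ({d, e, f} : Finset Pt) ∈ T := hset ▸ ht
    have hodef := hG.orient_ne hd he hf hde hdf hef
    have hval : dotAt d e p - cotAt d e f * orient d e p = pwr w p := by
      obtain ⟨v, ⟨h1, h2, h3⟩, h4⟩ := exists_pwr_circum hodef
      rw [← h4]
      exact pwr_unique hodef (by rw [h1, hwd]) (by rw [h2, hwe]) (by rw [h3, hwf]) p
    have hdep := hT.adjacent hP hG hp d e f hde hdf hef hdef hneg (by rw [hval]; exact hwp)
    obtain ⟨w', h1, h2, h3, h4⟩ := hT.exists_pwr hdep
    have hpen := pwr_pencil (w := w') (w' := w) (by rw [h1, hwd]) (by rw [h2, hwe]) f p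
    rw [h3, hwf] at hpen
    have hf' : pwr w' f < 0 := by
      by_contra! h5
      have h6 : pwr w' f * (orient d e p * orient d e p)
          = - pwr w p * (orient d e f * orient d e p) := by
        linear_combination orient d e p * hpen
      nlinarith [mul_nonneg h5 (mul_self_nonneg (orient d e p)), mul_pos_of_neg_of_neg hwp hneg]
    exact ⟨w', h1, h2, h3, hf', fun x hx h => h4 x hx f hf h hf'⟩
  rcases hT.1.exists_neg hG ht huv huc hvc hp hpu hpv hpc with h | h | h
  · obtain ⟨w', h1, h2, h3, -, h5⟩ := step u v c huv huc hvc rfl hwu hwv hwc hpu hpv hu hv hc h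
    exact _root_.exists_flipConfig hc hp h hwu hwv hwc hwp h1 h2 h3 u1 h5
  · obtain ⟨w', h1, h2, h3, h4, h5⟩ := step v c u hvc huv.symm huc.symm (by ext x; simp; tauto)
      hwv hwc hwu hpv hpc hv hc hu h
    exact (hdel _ (mem_delTri_of_flip hG hv hu hp huv.symm hpv.symm hpu.symm hwv hwu hwp h1 h3 h4
      u1 h5) (by simp) (by simp)).elim
  · obtain ⟨w', h1, h2, h3, h4, h5⟩ := step c u v huc.symm hvc.symm huv (by ext x; simp; tauto)
      hwc hwu hwv hpc hpu hc hu hv h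
    exact (hdel _ (mem_delTri_of_flip hG hu hv hp huv hpu.symm hpv.symm hwu hwv hwp h2 h3 h4
      u1 h5) (by simp) (by simp)).elim

/-- The useful order-1 non-Delaunay edges are the diagonals of flippable quadrilaterals whose two
circumdisks contain no further point. -/
theorem usefulNotDel_eq (hP : P.Finite) (hG : Generic P) :
    usefulNotDel P = {e | ∃ u ∈ P, ∃ v ∈ P, ∃ x ∈ P, ∃ y ∈ P, e = {u, v} ∧ FlipConfig P u v x y} := by
  ext e
  constructor
  · rintro ⟨u, v, hu, hv, huv, rfl, h1, h2⟩
    obtain ⟨x, hx, y, hy, h⟩ := h1.exists_flipConfig hP hG huv h2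
    exact ⟨u, hu, v, hv, x, hx, y, hy, rfl, h⟩
  · rintro ⟨u, hu, v, hv, x, hx, y, hy, rfl, h⟩
    exact ⟨u, v, hu, hv, h.1.ne.1, rfl, h.usefulEdge hP hG hu hv hx hy,
      FlipConfig.not_delaunayEdge hx hy h.1⟩

end

section
variable {P : Set Pt}

lemma Flippable.swap {u v x y : Pt} (h : Flippable u v x y) : Flippable v u y x := by
  obtain ⟨h1, h2, h3⟩ := h
  refine ⟨?_, ?_, ?_⟩
  · rw [orient_swap]; linarith
  · rw [orient_swap]; linarith
  · rw [cotAt_swap u v, cotAt_swap u v]; linarith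

lemma twoDisks_swap (u v x y : Pt) : twoDisks v u y x = twoDisks u v x y := by
  ext p
  simp only [twoDisks, mem_ofPred_eq, dotAt_swap u v, cotAt_swap u v, orient_swap u v, neg_mul_neg]
  exact or_comm

lemma FlipConfig.swap {u v x y : Pt} (h : FlipConfig P u v x y) : FlipConfig P v u y x :=
  ⟨h.1.swap, fun p hp hpS => (h.2 p hp (by rwa [twoDisks_swap] at hpS)).symm⟩

lemma FlipConfig.left_unique {u v x y x' y' : Pt} (hx : x ∈ P) (hx' : x' ∈ P)
    (h : FlipConfig P u v x y) (h' : FlipConfig P u v x' y') : x = x' := by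
  have key : ∀ {x y x' y' : Pt}, x' ∈ P → FlipConfig P u v x y → FlipConfig P u v x' y' →
      cotAt u v x' < cotAt u v y → x' = x := by
    intro x y x' y' hx' h h' hlt
    refine (h.2 x' hx' (Or.inr ?_)).resolve_right ?_
    · rw [dotAt_eq_cotAt h'.1.1.ne']; exact mul_lt_mul_of_pos_right hlt h'.1.1
    · rintro rfl; linarith [h'.1.1, h.1.2.1]
  by_cases h1 : cotAt u v x' < cotAt u v y
  · exact (key hx' h h' h1).symm
  · refine key hx h' h ?_
    have := h.1.2.2
    have := h'.1.2.2
    linarith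

lemma FlipConfig.right_unique {u v x y x' y' : Pt} (hy : y ∈ P) (hy' : y' ∈ P)
    (h : FlipConfig P u v x y) (h' : FlipConfig P u v x' y') : y = y' :=
  h.swap.left_unique hy hy' h'.swap

lemma Flippable.orient_mul_neg {u v x y : Pt} (h : Flippable u v x y) (ho : orient x y u ≠ 0) :
    orient x y u * orient x y v < 0 := by
  obtain ⟨s, l, h1, h2, h3, h4, h⟩ := h.crossing
  have e : (1 - s) * orient x y u + s * orient x y v = 0 := by
    have h0 := h 0
    have h1 := h 1
    unfold orient
    linear_combination (y 0 - x 0) * h1 - (y 1 - x 1) * h0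
  have hsq := mul_self_pos.2 ho
  by_contra! hn
  have a1 := mul_pos (sub_pos.2 h2) hsq
  have a2 := mul_nonneg h1.le hn
  have e2 : (1 - s) * (orient x y u * orient x y u) + s * (orient x y u * orient x y v) = 0 := by
    linear_combination orient x y u * e
  linarith

lemma FlipConfig.opposite_unique (hG : Generic P) {u v v' x y : Pt} (hu : u ∈ P) (hv : v ∈ P)
    (hv' : v' ∈ P) (hx : x ∈ P) (hy : y ∈ P) (h : FlipConfig P u v x y)
    (h' : FlipConfig P u v' x y) : v = v' := by
  obtain ⟨huv, hux, huy, hvx, hvy, hxy⟩ := h.1.ne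
  have hvx' := h'.1.ne.2.2.2.1
  have hvy' := h'.1.ne.2.2.2.2.1
  have ho := hG.orient_ne hx hy hu hxy hux.symm huy.symm
  have o1 := h.1.orient_mul_neg ho
  have o2 := h'.1.orient_mul_neg ho
  obtain ⟨h3, hsub, w, hw, hw0⟩ := (h.mem_delTri hG hu hv hx hy).2
  obtain ⟨h3', hsub', w', hw', hw0'⟩ := (h'.mem_delTri hG hu hv' hx hy).2
  have hpen := pwr_pencil (w := w) (w' := w') (a := x) (b := y)
    (by rw [hw x (by simp), hw' x (by simp)]) (by rw [hw y (by simp), hw' y (by simp)]) v v'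
  rw [hw v (by simp), hw' v' (by simp)] at hpen
  have a1 := hw0 v' hv'
  have a2 := hw0' v hv
  have o3 : 0 < orient x y v * orient x y v' := by
    nlinarith [mul_pos_of_neg_of_neg o1 o2, mul_self_pos.2 ho]
  have hov := mul_self_nonneg (orient x y v')
  have hne : orient x y v ≠ 0 := by rintro h; simp [h] at o3
  have hz : pwr w v' = 0 := by
    have e : pwr w v' * (orient x y v * orient x y v')
        = - (pwr w' v * (orient x y v' * orient x y v')) := by
      linear_combination (- orient x y v') * hpen
    by_contra hn
    nlinarith [mul_pos (lt_of_le_of_ne a1 (Ne.symm hn)) o3, mul_nonneg a2 hov]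
  have := hG.mem_of_pwr h3 hsub hw hv' hz
  simp only [Finset.mem_insert, Finset.mem_singleton] at this
  rcases this with h | h | h
  · exact h.symm
  · exact absurd h hvx'
  · exact absurd h hvy'

lemma IsTriangulation.eq_of_mid (hG : Generic P) {T : Set (Finset Pt)} (hT : IsTriangulation P T)
    {l m r l' r' : Pt} (h1 : l 0 < m 0) (h2 : m 0 < r 0) (h1' : l' 0 < m 0) (h2' : m 0 < r' 0)
    (ht : ({l, m, r} : Finset Pt) ∈ T) (ht' : ({l', m, r'} : Finset Pt) ∈ T)
    (ho : 0 < orient l m r * orient l' m r') : l = l' ∧ r = r' := by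
  have hd : 0 < r 0 - l 0 := by linarith
  have hd' : 0 < r' 0 - l' 0 := by linarith
  have hml : 0 < m 0 - l 0 := by linarith
  have hml' : 0 < m 0 - l' 0 := by linarith
  have hrm : 0 < r 0 - m 0 := by linarith
  have hrm' : 0 < r' 0 - m 0 := by linarith
  have hne : orient l m r ≠ 0 := by rintro h; simp [h] at ho
  have hne' : orient l' m r' ≠ 0 := by rintro h; simp [h] at ho
  set a := |orient l m r| with ha
  set a' := |orient l' m r'| with ha'
  have hap : 0 < a := abs_pos.2 hne
  have hap' : 0 < a' := abs_pos.2 hne'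
  set D := a * (r' 0 - l' 0) + a' * (r 0 - l 0) with hD
  have hDp : 0 < D := by positivity
  have key : a' * orient l m r = a * orient l' m r' := by
    rcases lt_or_gt_of_ne hne with h | h
    · have h' : orient l' m r' < 0 := by by_contra! hn; nlinarith
      rw [ha, ha', abs_of_neg h, abs_of_neg h']; ring
    · have h' : 0 < orient l' m r' := by by_contra! hn; nlinarith
      rw [ha, ha', abs_of_pos h, abs_of_pos h']; ring
  have m1 := comb_mem_interior hne (α := a' * (r 0 - m 0) / D)
    (β := a * (r' 0 - l' 0) / D) (γ := a' * (m 0 - l 0) / D) (by positivity) (by positivity)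
    (by positivity) (by field_simp; rw [hD]; ring)
  have m2 := comb_mem_interior hne' (α := a * (r' 0 - m 0) / D)
    (β := a' * (r 0 - l 0) / D) (γ := a * (m 0 - l' 0) / D) (by positivity) (by positivity)
    (by positivity) (by field_simp; rw [hD]; ring)
  rw [show (a * (r' 0 - m 0) / D) • l' + (a' * (r 0 - l 0) / D) • m + (a * (m 0 - l' 0) / D) • r'
    = (a' * (r 0 - m 0) / D) • l + (a * (r' 0 - l' 0) / D) • m + (a' * (m 0 - l 0) / D) • r from ?_]
    at m2
  · have := hT.eq_of_mem_interior hG ht ht' m1 (interior_subset m2)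
    have hl : l ∈ ({l', m, r'} : Finset Pt) := this ▸ (by simp)
    have hr : r ∈ ({l', m, r'} : Finset Pt) := this ▸ (by simp)
    simp only [Finset.mem_insert, Finset.mem_singleton] at hl hr
    constructor
    · rcases hl with h | h | h
      · exact h
      · rw [h] at h1; linarith
      · rw [h] at h1; linarith
    · rcases hr with h | h | h
      · rw [h] at h2; linarith
      · rw [h] at h2; linarith
      · exact h
  · unfold orient at key
    refine Pt.ext ?_ ?_ <;> rw [comb3_apply, comb3_apply] <;> field_simp
    · ring
    · linear_combination -key

/-- The entry with the middle abscissa. -/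
def midOf {α : Type*} (f : α → Pt) (u x y : α) : α :=
  if f u 0 < f x 0 then (if f x 0 < f y 0 then x else if f u 0 < f y 0 then y else u)
  else (if f u 0 < f y 0 then u else if f x 0 < f y 0 then y else x)

lemma midOf_map {α : Type*} (f : α → Pt) (u x y : α) :
    f (midOf f u x y) = midOf id (f u) (f x) (f y) := by
  unfold midOf; simp only [id]; split_ifs <;> rfl

set_option maxHeartbeats 1000000 in
lemma eq_of_midOf (hP : P.Finite) (hG : Generic P)
    (hX : ∀ p ∈ P, ∀ q ∈ P, p 0 = q 0 → p = q) {u x y u' x' y' : Pt}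
    (h : ({u, x, y} : Finset Pt) ∈ delTri P) (h' : ({u', x', y'} : Finset Pt) ∈ delTri P)
    (hux : u ≠ x) (huy : u ≠ y) (hxy : x ≠ y) (hux' : u' ≠ x') (huy' : u' ≠ y') (hxy' : x' ≠ y')
    (h1 : u 0 < x 0 ↔ u' 0 < x' 0) (h2 : u 0 < y 0 ↔ u' 0 < y' 0) (h3 : x 0 < y 0 ↔ x' 0 < y' 0)
    (ho : 0 < orient u x y ↔ 0 < orient u' x' y') (hm : midOf id u x y = midOf id u' x' y') :
    u = u' ∧ x = x' ∧ y = y' := by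
  have hu : u ∈ P := h.2.1 (by simp)
  have hx : x ∈ P := h.2.1 (by simp)
  have hy : y ∈ P := h.2.1 (by simp)
  have hu' : u' ∈ P := h'.2.1 (by simp)
  have hx' : x' ∈ P := h'.2.1 (by simp)
  have hy' : y' ∈ P := h'.2.1 (by simp)
  have hT := delTri_isTriangulation hP hG ⟨u, hu, x, hx, y, hy, hux, huy, hxy⟩
  have n1 := hG.orient_ne hu hx hy hux huy hxy
  have n2 := hG.orient_ne hu' hx' hy' hux' huy' hxy'
  have hoo : 0 < orient u x y * orient u' x' y' := by
    by_cases hp : 0 < orient u x y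
    · exact mul_pos hp (ho.1 hp)
    · exact mul_pos_of_neg_of_neg (lt_of_le_of_ne (not_lt.1 hp) n1)
        (lt_of_le_of_ne (not_lt.1 (fun h => hp (ho.2 h))) n2)
  have c1 : u 0 ≠ x 0 := fun h => hux (hX _ hu _ hx h)
  have c2 : u 0 ≠ y 0 := fun h => huy (hX _ hu _ hy h)
  have c3 : x 0 ≠ y 0 := fun h => hxy (hX _ hx _ hy h)
  have c1' : u' 0 ≠ x' 0 := fun h => hux' (hX _ hu' _ hx' h)
  have c2' : u' 0 ≠ y' 0 := fun h => huy' (hX _ hu' _ hy' h)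
  have c3' : x' 0 ≠ y' 0 := fun h => hxy' (hX _ hx' _ hy' h)
  have perm : ∀ (s s' : Finset Pt), s = {u, x, y} → s' = {u', x', y'} → s ∈ delTri P ∧ s' ∈ delTri P :=
    fun s s' e e' => ⟨e ▸ h, e' ▸ h'⟩
  have r1 : ∀ a b c : Pt, orient b c a = orient a b c := orient_rot
  have s1 : ∀ a b c : Pt, orient a c b = - orient a b c := fun a b c => by
    unfold orient; ring
  unfold midOf at hm
  simp only [id, h1, h2, h3] at hm
  by_cases b1 : u' 0 < x' 0 <;> by_cases b2 : u' 0 < y' 0 <;> by_cases b3 : x' 0 < y' 0 <;>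
    simp only [b1, b2, b3, if_true, if_false, iff_true, iff_false, not_lt] at hm h1 h2 h3
  · subst hm
    obtain ⟨t, t'⟩ := perm {u, x, y} {u', x, y'} rfl rfl
    obtain ⟨rfl, rfl⟩ := hT.eq_of_mid hG h1 h3 b1 b3 t t' hoo
    exact ⟨rfl, rfl, rfl⟩
  · subst hm
    obtain ⟨t, t'⟩ := perm {u, y, x} {u', y, x'} (by ext; simp; tauto) (by ext; simp; tauto)
    obtain ⟨rfl, rfl⟩ := hT.eq_of_mid hG h2 (lt_of_le_of_ne h3 c3.symm) b2
      (lt_of_le_of_ne (not_lt.1 b3) c3'.symm) t t' (by rw [s1, s1 u' x' y, neg_mul_neg]; exact hoo)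
    exact ⟨rfl, rfl, rfl⟩
  · linarith
  · subst hm
    obtain ⟨t, t'⟩ := perm {y, u, x} {y', u, x'} (by ext; simp; tauto) (by ext; simp; tauto)
    obtain ⟨rfl, rfl⟩ := hT.eq_of_mid hG (lt_of_le_of_ne h2 c2.symm) h1
      (lt_of_le_of_ne (not_lt.1 b2) c2'.symm) b1 t t'
      (by rw [← r1 y u x, ← r1 y' u x']; exact hoo)
    exact ⟨rfl, rfl, rfl⟩
  · subst hm
    obtain ⟨t, t'⟩ := perm {x, u, y} {x', u, y'} (by ext; simp; tauto) (by ext; simp; tauto)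
    obtain ⟨rfl, rfl⟩ := hT.eq_of_mid hG (lt_of_le_of_ne h1 c1.symm) h2
      (lt_of_le_of_ne (not_lt.1 b1) c1'.symm) b2 t t'
      (by rw [orient_swap u x, orient_swap u x', neg_mul_neg]; exact hoo)
    exact ⟨rfl, rfl, rfl⟩
  · exact absurd (lt_of_le_of_lt (not_lt.1 b1) (b2.trans_le (not_lt.1 b3))) (lt_irrefl _)
  · subst hm
    obtain ⟨t, t'⟩ := perm {x, y, u} {x', y, u'} (by ext; simp; tauto) (by ext; simp; tauto)
    obtain ⟨rfl, rfl⟩ := hT.eq_of_mid hG h3 (lt_of_le_of_ne h2 c2.symm) b3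
      (lt_of_le_of_ne (not_lt.1 b2) c2'.symm) t t' (by rw [r1 u x y, r1 u' x' y]; exact hoo)
    exact ⟨rfl, rfl, rfl⟩
  · subst hm
    obtain ⟨t, t'⟩ := perm {y, x, u} {y', x, u'} (by ext; simp; tauto) (by ext; simp; tauto)
    obtain ⟨rfl, rfl⟩ := hT.eq_of_mid hG (lt_of_le_of_ne h3 c3.symm) (lt_of_le_of_ne h1 c1.symm)
      (lt_of_le_of_ne (not_lt.1 b3) c3'.symm) (lt_of_le_of_ne (not_lt.1 b1) c1'.symm) t t'
      (by rw [orient_swap x y, orient_swap x y', r1 u x y, r1 u' x y']; linarith)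
    exact ⟨rfl, rfl, rfl⟩

end

/-- The indices `e` form a flippable quadrilateral whose two disks avoid all other points. -/
def FlipIdx {n : ℕ} (x : Fin n → Pt) (e : Fin 4 ↪ Fin n) : Prop :=
  Flippable (x (e 0)) (x (e 1)) (x (e 2)) (x (e 3)) ∧
    ∀ m, (∀ a, m ≠ e a) → x m ∉ twoDisks (x (e 0)) (x (e 1)) (x (e 2)) (x (e 3))

lemma left_notMem_twoDisks (u v x y : Pt) : u ∉ twoDisks u v x y := by
  simp [twoDisks, dotAt]

lemma right_notMem_twoDisks (u v x y : Pt) : v ∉ twoDisks u v x y := by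
  simp [twoDisks, dotAt]

lemma flipIdx_iff {n : ℕ} {x : Fin n → Pt} (hx : Function.Injective x) (e : Fin 4 ↪ Fin n) :
    FlipIdx x e ↔ FlipConfig (range x) (x (e 0)) (x (e 1)) (x (e 2)) (x (e 3)) := by
  refine and_congr_right fun _ => ⟨?_, ?_⟩
  · rintro h _ ⟨m, rfl⟩ hm
    by_contra! hne
    refine h m (fun a => ?_) hm
    fin_cases a
    · rintro rfl; exact left_notMem_twoDisks _ _ _ _ hm
    · rintro rfl; exact right_notMem_twoDisks _ _ _ _ hm
    · rintro rfl; exact hne.1 rfl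
    · rintro rfl; exact hne.2 rfl
  · intro h m hm hmem
    rcases h _ ⟨m, rfl⟩ hmem with h | h
    · exact hm 2 (hx h)
    · exact hm 3 (hx h)

/-- The relabelling exchanging the roles of the two ends of the diagonal. -/
def flipPerm : Fin 4 ≃ Fin 4 := Equiv.swap 0 1 * Equiv.swap 2 3

lemma flipPerm_vals : flipPerm 0 = 1 ∧ flipPerm 1 = 0 ∧ flipPerm 2 = 3 ∧ flipPerm 3 = 2 := by
  unfold flipPerm; decide

lemma emb_ext {n : ℕ} {e e' : Fin 4 ↪ Fin n} (h0 : e 0 = e' 0) (h1 : e 1 = e' 1) (h2 : e 2 = e' 2)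
    (h3 : e 3 = e' 3) : e = e' := by
  ext a; fin_cases a <;> simp [h0, h1, h2, h3]

open Classical in
lemma two_mul_ncard_usefulNotDel {n : ℕ} {x : Fin n → Pt} (hx : Function.Injective x)
    (hG : Generic (range x)) :
    2 * (usefulNotDel (range x)).ncard =
      (Finset.univ.filter fun e : Fin 4 ↪ Fin n => FlipIdx x e).card := by
  set F := Finset.univ.filter fun e : Fin 4 ↪ Fin n => FlipIdx x e with hF
  let φ : (Fin 4 ↪ Fin n) → Finset Pt := fun e => {x (e 0), x (e 1)}
  have himg : usefulNotDel (range x) = ((F.image φ : Finset (Finset Pt)) : Set (Finset Pt)) := by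
    rw [usefulNotDel_eq (finite_range x) hG]
    ext s
    simp only [mem_ofPred_eq, Finset.coe_image, mem_image, Finset.mem_coe, hF, Finset.mem_filter,
      Finset.mem_univ, true_and]
    constructor
    · rintro ⟨_, ⟨i, rfl⟩, _, ⟨j, rfl⟩, _, ⟨k, rfl⟩, _, ⟨l, rfl⟩, rfl, h⟩
      obtain ⟨a1, a2, a3, a4, a5, a6⟩ := h.1.ne
      have b1 := ne_of_apply_ne x a1
      have b2 := ne_of_apply_ne x a2
      have b3 := ne_of_apply_ne x a3
      have b4 := ne_of_apply_ne x a4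
      have b5 := ne_of_apply_ne x a5
      have b6 := ne_of_apply_ne x a6
      have hinj : Function.Injective ![i, j, k, l] := by
        intro a b hab
        fin_cases a <;> fin_cases b <;> simp_all
      exact ⟨⟨![i, j, k, l], hinj⟩, (flipIdx_iff hx _).2 (by simpa using h), by simp [φ]⟩
    · rintro ⟨e, he, rfl⟩
      exact ⟨_, ⟨_, rfl⟩, _, ⟨_, rfl⟩, _, ⟨_, rfl⟩, _, ⟨_, rfl⟩, rfl, (flipIdx_iff hx e).1 he⟩
  rw [himg, Set.ncard_coe_finset, Finset.card_eq_sum_card_image φ F, Finset.sum_const_nat, mul_comm]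
  intro s hs
  obtain ⟨e, he, rfl⟩ := Finset.mem_image.1 hs
  obtain ⟨p0, p1, p2, p3⟩ := flipPerm_vals
  set e' : Fin 4 ↪ Fin n := flipPerm.toEmbedding.trans e with he'
  have q0 : e' 0 = e 1 := by simp [he', p0]
  have q1 : e' 1 = e 0 := by simp [he', p1]
  have q2 : e' 2 = e 3 := by simp [he', p2]
  have q3 : e' 3 = e 2 := by simp [he', p3]
  have hne : e ≠ e' := by
    intro h
    have : e 0 = e 1 := by rw [← q0, ← h]
    exact absurd (e.injective this) (by decide)
  have hc := (flipIdx_iff hx e).1 (Finset.mem_filter.1 he).2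
  have : F.filter (fun d => φ d = φ e) = {e, e'} := by
    ext d
    simp only [Finset.mem_filter, Finset.mem_insert, Finset.mem_singleton, hF, Finset.mem_univ,
      true_and]
    constructor
    · rintro ⟨hd, hφ⟩
      have hd := (flipIdx_iff hx d).1 hd
      have h0 : x (d 0) = x (e 0) ∨ x (d 0) = x (e 1) := by
        have : x (d 0) ∈ φ e := hφ ▸ (by simp [φ])
        simpa [φ] using this
      have h1 : x (d 1) = x (e 0) ∨ x (d 1) = x (e 1) := by
        have : x (d 1) ∈ φ e := hφ ▸ (by simp [φ])
        simpa [φ] using this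
      have hn : x (d 0) ≠ x (d 1) := hd.1.ne.1
      rcases h0 with h0 | h0 <;> rcases h1 with h1 | h1
      · exact absurd (h0.trans h1.symm) hn
      · left
        rw [h0, h1] at hd
        exact emb_ext (hx h0) (hx h1) (hx (hd.left_unique (mem_range_self _) (mem_range_self _) hc))
          (hx (hd.right_unique (mem_range_self _) (mem_range_self _) hc))
      · right
        rw [h0, h1] at hd
        exact emb_ext ((hx h0).trans q0.symm) ((hx h1).trans q1.symm)
          ((hx (hd.left_unique (mem_range_self _) (mem_range_self _) hc.swap)).trans q2.symm)
          ((hx (hd.right_unique (mem_range_self _) (mem_range_self _) hc.swap)).trans q3.symm)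
      · exact absurd (h0.trans h1.symm) hn
    · rintro (rfl | rfl)
      · exact ⟨(flipIdx_iff hx _).2 hc, rfl⟩
      · refine ⟨(flipIdx_iff hx _).2 ?_, ?_⟩
        · rw [q0, q1, q2, q3]; exact hc.swap
        · simp only [φ]; rw [q0, q1]; exact Finset.pair_comm _ _
  rw [this, Finset.card_pair hne]

open Classical in
lemma card_flipIdx_le {n : ℕ} {x : Fin n → Pt} (hx : Function.Injective x)
    (hG : Generic (range x)) (hX : ∀ i j, x i 0 = x j 0 → i = j) (A : Set Pt) :
    (Finset.univ.filter fun e : Fin 4 ↪ Fin n => FlipIdx x e ∧ ∀ a, x (e a) ∈ A).card ≤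
      16 * (Finset.univ.filter fun i => x i ∈ A).card := by
  set F := Finset.univ.filter fun e : Fin 4 ↪ Fin n => FlipIdx x e ∧ ∀ a, x (e a) ∈ A with hF
  set I := Finset.univ.filter fun i => x i ∈ A with hI
  let key : (Fin 4 ↪ Fin n) → Fin n × Bool × Bool × Bool × Bool := fun e =>
    (midOf x (e 0) (e 2) (e 3), decide (x (e 0) 0 < x (e 2) 0), decide (x (e 0) 0 < x (e 3) 0),
      decide (x (e 2) 0 < x (e 3) 0), decide (0 < orient (x (e 0)) (x (e 2)) (x (e 3))))
  have hX' : ∀ p ∈ range x, ∀ q ∈ range x, p 0 = q 0 → p = q := by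
    rintro _ ⟨i, rfl⟩ _ ⟨j, rfl⟩ h
    rw [hX i j h]
  calc F.card ≤ (I ×ˢ (Finset.univ : Finset (Bool × Bool × Bool × Bool))).card := by
        refine Finset.card_le_card_of_injOn key ?_ ?_
        · intro e he
          have he := (Finset.mem_filter.1 he).2.2
          simp only [Finset.coe_product, mem_prod, Finset.mem_coe, Finset.mem_univ, and_true, hI,
            Finset.mem_filter, true_and, key]
          unfold midOf
          split_ifs <;> exact he _
        · intro e he e' he' hk
          have hc := (flipIdx_iff hx e).1 (Finset.mem_filter.1 he).2.1
          have hc' := (flipIdx_iff hx e').1 (Finset.mem_filter.1 he').2.1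
          simp only [key, Prod.mk.injEq, decide_eq_decide] at hk
          obtain ⟨k0, k1, k2, k3, k4⟩ := hk
          have km := congrArg x k0
          rw [midOf_map x, midOf_map x] at km
          have m := fun a => (⟨e a, rfl⟩ : x (e a) ∈ range x)
          have m' := fun a => (⟨e' a, rfl⟩ : x (e' a) ∈ range x)
          obtain ⟨_, ux, uy, _, _, xy⟩ := hc.1.ne
          obtain ⟨_, ux', uy', _, _, xy'⟩ := hc'.1.ne
          obtain ⟨e0, e2, e3⟩ := eq_of_midOf (finite_range x) hG hX'
            (hc.mem_delTri hG (m 0) (m 1) (m 2) (m 3)).1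
            (hc'.mem_delTri hG (m' 0) (m' 1) (m' 2) (m' 3)).1 ux uy xy ux' uy' xy' k1 k2 k3 k4 km
          rw [← e0, ← e2, ← e3] at hc'
          exact emb_ext (hx e0) (hx (hc.opposite_unique hG (m 0) (m 1) (m' 1) (m 2) (m 3) hc'))
            (hx e2) (hx e3)
    _ = 16 * I.card := by
        rw [Finset.card_product, mul_comm]; rfl

section
open MeasureTheory
open scoped ENNReal

lemma measurable_apply (i : Fin 2) : Measurable fun p : Pt => p i := by fun_prop

lemma measurableSet_unitSq : MeasurableSet unitSq := by
  refine (measurableSet_Icc.preimage (measurable_apply 0)).inter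
    (measurableSet_Icc.preimage (measurable_apply 1))

lemma volume_rect (a b c d : ℝ) :
    volume {p : Pt | p 0 ∈ Icc a b ∧ p 1 ∈ Icc c d} = ENNReal.ofReal (b - a) * ENNReal.ofReal (d - c) := by
  have e : {p : Pt | p 0 ∈ Icc a b ∧ p 1 ∈ Icc c d} =
      (MeasurableEquiv.toLp 2 (Fin 2 → ℝ)).symm ⁻¹' (Icc ![a, c] ![b, d]) := by
    ext p
    simp [Pi.le_def, Fin.forall_fin_two]
    tauto
  rw [e, (EuclideanSpace.volume_preserving_symm_measurableEquiv_toLp (Fin 2)).measure_preimage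
    measurableSet_Icc.nullMeasurableSet, Real.volume_Icc_pi]
  simp

lemma volume_unitSq : volume unitSq = 1 := by
  unfold unitSq; rw [volume_rect]; simp

instance : IsProbabilityMeasure unifSq := ⟨by
  rw [unifSq, Measure.restrict_apply_univ, volume_unitSq]⟩

instance (n : ℕ) : IsProbabilityMeasure (conf n) := by unfold conf; infer_instance

lemma conf_eq_zero_of_section {n : ℕ} (k : Fin n) {S : Set (Fin n → Pt)} (hS : MeasurableSet S)
    (h : ∀ x, volume {p | Function.update x k p ∈ S} = 0) : conf n S = 0 := by
  have hm : Measurable (S.indicator (1 : (Fin n → Pt) → ℝ≥0∞)) := measurable_one.indicator hS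
  rw [← lintegral_indicator_one hS, conf, lintegral_eq_lmarginal_univ (fun _ => 0),
    lmarginal_erase' _ hm (Finset.mem_univ k)]
  have : (fun x : Fin n → Pt => ∫⁻ p, S.indicator (1 : (Fin n → Pt) → ℝ≥0∞)
      (Function.update x k p) ∂unifSq) = 0 := by
    ext x
    have hS' : MeasurableSet {p | Function.update x k p ∈ S} := hS.preimage (measurable_update x)
    have : (fun p => S.indicator (1 : (Fin n → Pt) → ℝ≥0∞) (Function.update x k p)) =
      {p | Function.update x k p ∈ S}.indicator 1 := rfl
    rw [this, lintegral_indicator_one hS']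
    exact le_antisymm ((Measure.restrict_apply_le _ _).trans (h x).le) bot_le
  rw [this]
  simp [lmarginal]

lemma measurable_orient {α : Type*} [MeasurableSpace α] {f g h : α → Pt} (hf : Measurable f)
    (hg : Measurable g) (hh : Measurable h) : Measurable fun x => orient (f x) (g x) (h x) := by
  unfold orient; fun_prop

lemma measurable_dotAt {α : Type*} [MeasurableSpace α] {f g h : α → Pt} (hf : Measurable f)
    (hg : Measurable g) (hh : Measurable h) : Measurable fun x => dotAt (f x) (g x) (h x) := by
  unfold dotAt; fun_prop

lemma measurable_cotAt {α : Type*} [MeasurableSpace α] {f g h : α → Pt} (hf : Measurable f)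
    (hg : Measurable g) (hh : Measurable h) : Measurable fun x => cotAt (f x) (g x) (h x) :=
  (measurable_dotAt hf hg hh).div (measurable_orient hf hg hh)

lemma volume_apply_zero_eq (c : ℝ) : volume {p : Pt | c = p 0} = 0 := by
  have : {p : Pt | c = p 0} = {p : Pt | orient !₂[c, 0] !₂[c, 1] p = 0} := by
    ext p
    simp only [mem_ofPred_eq, orient]
    simp
    constructor <;> intro h <;> linarith
  rw [this]
  refine volume_orient_eq_zero fun h => ?_
  have := congrArg (fun p : Pt => p 1) h
  simp at this

lemma ae_ne_first {n : ℕ} {i j : Fin n} (h : i ≠ j) : ∀ᵐ x ∂conf n, x i 0 ≠ x j 0 := by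
  rw [ae_iff]
  simp only [not_not]
  refine conf_eq_zero_of_section j (measurableSet_eq_fun (by fun_prop) (by fun_prop)) fun x => ?_
  simp only [mem_ofPred_eq, Function.update_of_ne h, Function.update_self]
  exact volume_apply_zero_eq _

lemma ae_orient_ne {n : ℕ} {i j k : Fin n} (hij : i ≠ j) (hik : i ≠ k) (hjk : j ≠ k) :
    ∀ᵐ x ∂conf n, orient (x i) (x j) (x k) ≠ 0 := by
  have h0 : conf n {x | x i 0 ≠ x j 0 ∧ orient (x i) (x j) (x k) = 0} = 0 := by
    refine conf_eq_zero_of_section k (.inter (measurableSet_eq_fun (by fun_prop) (by fun_prop)).compl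
      (measurableSet_eq_fun (measurable_orient (by fun_prop) (by fun_prop) (by fun_prop))
        (by fun_prop))) fun x => ?_
    simp only [mem_ofPred_eq, Function.update_of_ne hik, Function.update_of_ne hjk,
      Function.update_self]
    by_cases h : x i 0 = x j 0
    · simp [h]
    · exact measure_mono_null (fun p hp => hp.2) (volume_orient_eq_zero fun e => h (by rw [e]))
  filter_upwards [ae_ne_first hij, measure_eq_zero_iff_ae_notMem.1 h0] with x h1 h2 h3
  exact h2 ⟨h1, h3⟩

lemma ae_cocircular_ne {n : ℕ} {i j k l : Fin n} (hij : i ≠ j) (hik : i ≠ k) (hil : i ≠ l)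
    (hjk : j ≠ k) (hjl : j ≠ l) (hkl : k ≠ l) :
    ∀ᵐ x ∂conf n, dotAt (x i) (x j) (x k) * orient (x i) (x j) (x l) ≠
      dotAt (x i) (x j) (x l) * orient (x i) (x j) (x k) := by
  have h0 : conf n {x | orient (x i) (x j) (x k) ≠ 0 ∧
      dotAt (x i) (x j) (x k) * orient (x i) (x j) (x l) =
        dotAt (x i) (x j) (x l) * orient (x i) (x j) (x k)} = 0 := by
    refine conf_eq_zero_of_section l (.inter (measurableSet_eq_fun
      (measurable_orient (by fun_prop) (by fun_prop) (by fun_prop)) (by fun_prop)).compl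
      (measurableSet_eq_fun (.mul (measurable_dotAt (by fun_prop) (by fun_prop) (by fun_prop))
        (measurable_orient (by fun_prop) (by fun_prop) (by fun_prop)))
        (.mul (measurable_dotAt (by fun_prop) (by fun_prop) (by fun_prop))
        (measurable_orient (by fun_prop) (by fun_prop) (by fun_prop))))) fun x => ?_
    simp only [mem_ofPred_eq, Function.update_of_ne hil, Function.update_of_ne hjl,
      Function.update_of_ne hkl, Function.update_self]
    by_cases h : orient (x i) (x j) (x k) = 0
    · simp [h]
    · obtain ⟨w, hw⟩ := exists_pwr (x i) (x j) (cotAt (x i) (x j) (x k))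
      refine measure_mono_null (fun p hp => ?_) (volume_pwr_eq_zero w)
      rw [mem_ofPred_eq, hw, cotAt]
      have := hp.2
      field_simp
      linarith
  filter_upwards [ae_orient_ne hij hik hjk, measure_eq_zero_iff_ae_notMem.1 h0] with x h1 h2 h3
  exact h2 ⟨h1, h3⟩

lemma ae_generic (n : ℕ) : ∀ᵐ x ∂conf n, Function.Injective x ∧ Generic (range x) ∧
    ∀ i j, x i 0 = x j 0 → i = j := by
  have h1 : ∀ᵐ x ∂conf n, ∀ i j, i ≠ j → x i 0 ≠ x j 0 := by
    simp only [ae_all_iff]; exact fun i j h => ae_ne_first h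
  have h2 : ∀ᵐ x ∂conf n, ∀ i j k, i ≠ j → i ≠ k → j ≠ k → orient (x i) (x j) (x k) ≠ 0 := by
    simp only [ae_all_iff]; exact fun i j k a b c => ae_orient_ne a b c
  have h3 : ∀ᵐ x ∂conf n, ∀ i j k l, i ≠ j → i ≠ k → i ≠ l → j ≠ k → j ≠ l → k ≠ l →
      dotAt (x i) (x j) (x k) * orient (x i) (x j) (x l) ≠
      dotAt (x i) (x j) (x l) * orient (x i) (x j) (x k) := by
    simp only [ae_all_iff]; exact fun i j k l a b c d e f => ae_cocircular_ne a b c d e f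
  filter_upwards [h1, h2, h3] with x h1 h2 h3
  have h1' : ∀ i j, x i 0 = x j 0 → i = j := fun i j h => by
    by_contra hn; exact h1 i j hn h
  refine ⟨fun i j h => h1' i j (by rw [h]), ⟨?_, ?_⟩, h1'⟩
  · rintro _ _ _ ⟨i, rfl⟩ ⟨j, rfl⟩ ⟨k, rfl⟩ a b c
    exact h2 i j k (ne_of_apply_ne x a) (ne_of_apply_ne x b) (ne_of_apply_ne x c)
  · rintro _ _ _ _ ⟨i, rfl⟩ ⟨j, rfl⟩ ⟨k, rfl⟩ ⟨l, rfl⟩ a b c d e f w wi wj wk wl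
    refine h3 i j k l (ne_of_apply_ne x a) (ne_of_apply_ne x b) (ne_of_apply_ne x c)
      (ne_of_apply_ne x d) (ne_of_apply_ne x e) (ne_of_apply_ne x f) ?_
    obtain ⟨w', hw'⟩ := exists_pwr (x i) (x j) 0
    have := pwr_pencil (w := w) (w' := w') (a := x i) (b := x j) (by rw [wi, hw']; simp [dotAt])
      (by rw [wj, hw']; simp [dotAt]) (x k) (x l)
    rw [wk, wl, hw', hw'] at this
    linarith

end

section
open MeasureTheory
open scoped ENNReal

/-- Quadruples forming a flippable quadrilateral. -/
def flipSet : Set (Fin 4 → Pt) := {q | Flippable (q 0) (q 1) (q 2) (q 3)}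

/-- The two disks of a quadruple. -/
def disksOf (q : Fin 4 → Pt) : Set Pt := twoDisks (q 0) (q 1) (q 2) (q 3)

lemma measurableSet_flipSet : MeasurableSet flipSet := by
  have m : ∀ a, Measurable fun q : Fin 4 → Pt => q a := fun a => measurable_pi_apply a
  exact (measurableSet_lt measurable_const (measurable_orient (m 0) (m 1) (m 2))).inter
    ((measurableSet_lt (measurable_orient (m 0) (m 1) (m 3)) measurable_const).inter
    (measurableSet_lt (measurable_cotAt (m 0) (m 1) (m 2)) (measurable_cotAt (m 0) (m 1) (m 3))))

lemma measurableSet_twoDisks {α : Type*} [MeasurableSpace α] {u v x y p : α → Pt}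
    (hu : Measurable u) (hv : Measurable v) (hx : Measurable x) (hy : Measurable y)
    (hp : Measurable p) : MeasurableSet {a | p a ∈ twoDisks (u a) (v a) (x a) (y a)} :=
  (measurableSet_lt (measurable_dotAt hu hv hp)
    ((measurable_cotAt hu hv hx).mul (measurable_orient hu hv hp))).union
  (measurableSet_lt (measurable_dotAt hu hv hp)
    ((measurable_cotAt hu hv hy).mul (measurable_orient hu hv hp)))

lemma measurableSet_disksOf_prod :
    MeasurableSet {r : (Fin 4 → Pt) × Pt | r.2 ∈ disksOf r.1} :=
  measurableSet_twoDisks (by fun_prop) (by fun_prop) (by fun_prop) (by fun_prop) (by fun_prop)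

lemma measurableSet_disksOf (q : Fin 4 → Pt) : MeasurableSet (disksOf q) :=
  measurableSet_disksOf_prod.preimage (measurable_prodMk_left (x := q))

lemma lintegral_pi_embedding {n : ℕ} (e : Fin 4 ↪ Fin n)
    (f : (Fin 4 → Pt) → ({m : Fin n // ¬ (m ∈ range e)} → Pt) → ℝ≥0∞)
    (hf : Measurable (Function.uncurry f)) :
    ∫⁻ x, f (fun a => x (e a)) (fun m => x m) ∂conf n =
      ∫⁻ q, ∫⁻ z, f q z ∂Measure.pi (fun _ => unifSq) ∂Measure.pi (fun _ : Fin 4 => unifSq) := by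
  classical
  have h1 := measurePreserving_piEquivPiSubtypeProd (fun _ : Fin n => unifSq) (fun m => m ∈ range e)
  let g : ({m : Fin n // m ∈ range e} → Pt) → (Fin 4 → Pt) := fun y a => y ⟨e a, a, rfl⟩
  have hg : Measurable g := by fun_prop
  have hm : Measurable fun y : ({m : Fin n // m ∈ range e} → Pt) ×
      ({m : Fin n // ¬ (m ∈ range e)} → Pt) => f (g y.1) y.2 :=
    hf.comp ((hg.comp measurable_fst).prodMk measurable_snd)
  have h2 := h1.lintegral_comp hm
  have h3 : ∫⁻ x, f (fun a => x (e a)) (fun m => x m) ∂conf n = _ := h2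
  rw [h3, lintegral_prod _ hm.aemeasurable]
  have h4 := measurePreserving_piCongrLeft (fun _ : {m : Fin n // m ∈ range e} => unifSq)
    (Equiv.ofInjective e e.injective)
  have hm2 : Measurable fun q : Fin 4 → Pt => ∫⁻ z, f q z ∂Measure.pi (fun _ => unifSq) :=
    hf.lintegral_prod_right'
  have h5 := h4.lintegral_comp (hm2.comp hg)
  refine Eq.trans ?_ (h5.symm.trans ?_)
  · congr!
  refine lintegral_congr fun q => ?_
  have : g ((MeasurableEquiv.piCongrLeft (fun _ => Pt) (Equiv.ofInjective e e.injective)) q) = q := by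
    ext1 a
    exact (Equiv.piCongrLeft_apply_apply (fun _ => Pt) (Equiv.ofInjective e e.injective) q a)
  simp only [Function.comp]
  rw [this]

lemma conf_flipIdx {n : ℕ} (e : Fin 4 ↪ Fin n) {A : Set Pt} (hA : MeasurableSet A) :
    conf n {x | FlipIdx x e ∧ ∀ a, x (e a) ∈ A} =
      ∫⁻ q in flipSet ∩ {q | ∀ a, q a ∈ A}, (unifSq (disksOf q)ᶜ) ^ (n - 4)
        ∂Measure.pi (fun _ : Fin 4 => unifSq) := by
  classical
  have hQ : MeasurableSet (flipSet ∩ {q : Fin 4 → Pt | ∀ a, q a ∈ A}) := by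
    refine measurableSet_flipSet.inter ?_
    rw [show {q : Fin 4 → Pt | ∀ a, q a ∈ A} = ⋂ a, {q | q a ∈ A} by ext; simp]
    exact MeasurableSet.iInter fun a => hA.preimage (measurable_pi_apply a)
  have hB : MeasurableSet {r : (Fin 4 → Pt) × ({m : Fin n // ¬ (m ∈ range e)} → Pt) |
      r.1 ∈ flipSet ∩ {q : Fin 4 → Pt | ∀ a, q a ∈ A} ∧ ∀ m, r.2 m ∈ (disksOf r.1)ᶜ} := by
    refine (hQ.preimage measurable_fst).inter (s₂ := {r : (Fin 4 → Pt) × ({m : Fin n // ¬ (m ∈ range e)} → Pt) |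
      ∀ m, r.2 m ∈ (disksOf r.1)ᶜ}) ?_
    rw [show {r : (Fin 4 → Pt) × ({m : Fin n // ¬ (m ∈ range e)} → Pt) |
      ∀ m, r.2 m ∈ (disksOf r.1)ᶜ} = ⋂ m, {r | r.2 m ∈ (disksOf r.1)ᶜ} by ext; simp]
    refine MeasurableSet.iInter fun m => ?_
    exact (measurableSet_disksOf_prod.preimage
      (measurable_fst.prodMk ((measurable_pi_apply m).comp measurable_snd))).compl
  set B := {r : (Fin 4 → Pt) × ({m : Fin n // ¬ (m ∈ range e)} → Pt) |
      r.1 ∈ flipSet ∩ {q : Fin 4 → Pt | ∀ a, q a ∈ A} ∧ ∀ m, r.2 m ∈ (disksOf r.1)ᶜ} with hBdef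
  have hS : MeasurableSet {x : Fin n → Pt | ((fun a => x (e a)), fun m : {m : Fin n // ¬ (m ∈ range e)}
    => x m) ∈ B} := hB.preimage (by fun_prop)
  have hE : {x | FlipIdx x e ∧ ∀ a, x (e a) ∈ A} = {x : Fin n → Pt | ((fun a => x (e a)),
      fun m : {m : Fin n // ¬ (m ∈ range e)} => x m) ∈ B} := by
    ext x
    simp only [FlipIdx, hBdef, flipSet, disksOf, mem_ofPred_eq, mem_inter_iff, mem_compl_iff,
      Subtype.forall, mem_range, not_exists]
    constructor
    · rintro ⟨⟨a, b⟩, c⟩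
      exact ⟨⟨a, c⟩, fun m hm => b m fun a h => hm a h.symm⟩
    · rintro ⟨⟨a, c⟩, b⟩
      exact ⟨⟨a, fun m hm => b m fun a h => hm a h.symm⟩, c⟩
  rw [hE, ← lintegral_indicator_one hS]
  have h1 := lintegral_pi_embedding e (fun q z => B.indicator 1 (q, z))
    (measurable_one.indicator hB)
  rw [show (∫⁻ x, {x : Fin n → Pt | ((fun a => x (e a)), fun m : {m : Fin n // ¬ (m ∈ range e)}
    => x m) ∈ B}.indicator 1 x ∂conf n) = _ from h1, ← lintegral_indicator hQ]
  refine lintegral_congr fun q => ?_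
  have hsec : MeasurableSet {z | (q, z) ∈ B} := hB.preimage measurable_prodMk_left
  rw [show (∫⁻ z, B.indicator 1 (q, z) ∂Measure.pi (fun _ => unifSq)) =
    ∫⁻ z, {z | (q, z) ∈ B}.indicator 1 z ∂Measure.pi (fun _ => unifSq) from rfl,
    lintegral_indicator_one hsec]
  by_cases hq : q ∈ flipSet ∩ {q : Fin 4 → Pt | ∀ a, q a ∈ A}
  · rw [indicator_of_mem hq]
    have : {z | (q, z) ∈ B} = Set.pi univ fun _ => (disksOf q)ᶜ := by
      ext z
      simp only [hBdef, mem_ofPred_eq, hq, true_and, mem_pi, mem_univ, true_imp_iff]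
    rw [this, Measure.pi_pi, Finset.prod_const, Finset.card_univ, Fintype.card_subtype_compl]
    congr 1
    rw [Fintype.card_fin, Fintype.card_of_subtype (Finset.univ.map e) (by simp), Finset.card_map,
      Finset.card_univ, Fintype.card_fin]
  · rw [indicator_of_notMem hq]
    have : {z | (q, z) ∈ B} = ∅ := by
      ext z
      simp only [hBdef, mem_ofPred_eq, hq, false_and, mem_empty_iff_false]
    rw [this, measure_empty]

end

section
open MeasureTheory
open scoped ENNReal

/-- The probability that four given points of `A` form a flippable quadrilateral avoided by the
remaining `n - 4` points. -/
def flipInt (n : ℕ) (A : Set Pt) : ℝ≥0∞ :=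
  ∫⁻ q in flipSet ∩ {q | ∀ a, q a ∈ A}, (unifSq (disksOf q)ᶜ) ^ (n - 4)
    ∂Measure.pi (fun _ : Fin 4 => unifSq)

lemma measurableSet_flipIdx {n : ℕ} (e : Fin 4 ↪ Fin n) : MeasurableSet {x | FlipIdx x e} := by
  refine (measurableSet_flipSet.preimage (f := fun x : Fin n → Pt => fun a => x (e a))
    (by fun_prop)).inter (s₂ := {x | ∀ m, (∀ a, m ≠ e a) → x m ∉ twoDisks _ _ _ _}) ?_
  rw [show {x : Fin n → Pt | ∀ m, (∀ a, m ≠ e a) →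
      x m ∉ twoDisks (x (e 0)) (x (e 1)) (x (e 2)) (x (e 3))} =
    ⋂ m, ⋂ _ : ∀ a, m ≠ e a, {x | x m ∈ twoDisks (x (e 0)) (x (e 1)) (x (e 2)) (x (e 3))}ᶜ by
      ext; simp]
  exact MeasurableSet.iInter fun m => MeasurableSet.iInter fun _ =>
    (measurableSet_twoDisks (by fun_prop) (by fun_prop) (by fun_prop) (by fun_prop)
      (by fun_prop)).compl

lemma lintegral_card {n : ℕ} {ι : Type*} [Fintype ι] (p : (Fin n → Pt) → ι → Prop)
    [∀ x, DecidablePred (p x)]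
    (hp : ∀ i, MeasurableSet {x | p x i}) :
    ∫⁻ x, ((Finset.univ.filter fun i => p x i).card : ℝ≥0∞) ∂conf n =
      ∑ i, conf n {x | p x i} := by
  have : ∀ x : Fin n → Pt, ((Finset.univ.filter fun i => p x i).card : ℝ≥0∞) =
      ∑ i, {x | p x i}.indicator 1 x := by
    intro x
    rw [Finset.card_eq_sum_ones, Finset.sum_filter]
    push_cast
    refine Finset.sum_congr rfl fun i _ => ?_
    by_cases h : p x i <;> simp [h]
  simp_rw [this]
  rw [lintegral_finsetSum _ fun i _ => measurable_one.indicator (hp i)]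
  simp_rw [lintegral_indicator_one (hp _)]

lemma measurable_card {n : ℕ} {ι : Type*} [Fintype ι] (p : (Fin n → Pt) → ι → Prop)
    [∀ x, DecidablePred (p x)]
    (hp : ∀ i, MeasurableSet {x | p x i}) :
    Measurable fun x => ((Finset.univ.filter fun i => p x i).card : ℝ≥0∞) := by
  have : ∀ x : Fin n → Pt, ((Finset.univ.filter fun i => p x i).card : ℝ≥0∞) =
      ∑ i, {x | p x i}.indicator 1 x := by
    intro x
    rw [Finset.card_eq_sum_ones, Finset.sum_filter]
    push_cast
    refine Finset.sum_congr rfl fun i _ => ?_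
    by_cases h : p x i <;> simp [h]
  simp_rw [this]
  exact Finset.measurable_sum _ fun i _ => measurable_one.indicator (hp i)

lemma measurableSet_forall_mem {n : ℕ} (e : Fin 4 ↪ Fin n) {A : Set Pt} (hA : MeasurableSet A) :
    MeasurableSet {x : Fin n → Pt | ∀ a, x (e a) ∈ A} := by
  rw [show {x : Fin n → Pt | ∀ a, x (e a) ∈ A} = ⋂ a, {x | x (e a) ∈ A} by ext; simp]
  exact MeasurableSet.iInter fun a => hA.preimage (measurable_pi_apply (e a))

lemma measurableSet_flipIdx_mem {n : ℕ} (e : Fin 4 ↪ Fin n) {A : Set Pt} (hA : MeasurableSet A) :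
    MeasurableSet {x : Fin n → Pt | FlipIdx x e ∧ ∀ a, x (e a) ∈ A} :=
  (measurableSet_flipIdx e).inter (measurableSet_forall_mem e hA)

lemma lintegral_card_flipIdx (n : ℕ) {A : Set Pt} (hA : MeasurableSet A)
    [∀ x, DecidablePred fun e : Fin 4 ↪ Fin n => FlipIdx x e ∧ ∀ a, x (e a) ∈ A] :
    ∫⁻ x, ((Finset.univ.filter fun e : Fin 4 ↪ Fin n => FlipIdx x e ∧ ∀ a, x (e a) ∈ A).card : ℝ≥0∞)
      ∂conf n = n.descFactorial 4 * flipInt n A := by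
  rw [lintegral_card _ fun e => measurableSet_flipIdx_mem e hA]
  simp_rw [conf_flipIdx _ hA]
  rw [Finset.sum_const, Finset.card_univ, Fintype.card_embedding_eq, Fintype.card_fin,
    Fintype.card_fin, nsmul_eq_mul, flipInt]

lemma descFactorial_mul_flipInt_le (n : ℕ) {A : Set Pt} (hA : MeasurableSet A) :
    n.descFactorial 4 * flipInt n A ≤ 16 * n * unifSq A := by
  classical
  rw [← lintegral_card_flipIdx n hA]
  calc _ ≤ ∫⁻ x, 16 * ((Finset.univ.filter fun i => x i ∈ A).card : ℝ≥0∞) ∂conf n := by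
        refine lintegral_mono_ae ?_
        filter_upwards [ae_generic n] with x hx
        exact_mod_cast card_flipIdx_le hx.1 hx.2.1 hx.2.2 A
    _ = 16 * ∑ i, conf n {x | x i ∈ A} := by
        rw [lintegral_const_mul _ (measurable_card _ fun i => hA.preimage (measurable_pi_apply i)),
          lintegral_card _ fun i => hA.preimage (measurable_pi_apply i)]
    _ = 16 * n * unifSq A := by
        have : ∀ i : Fin n, conf n {x | x i ∈ A} = unifSq A := fun i =>
          (measurePreserving_eval (fun _ : Fin n => unifSq) i).measure_preimage hA.nullMeasurableSet
        simp_rw [this]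
        simp [mul_assoc]

lemma integral_ncard_usefulNotDel (n : ℕ) :
    ∫ x, ((usefulNotDel (range x)).ncard : ℝ) ∂conf n =
      (n.descFactorial 4 * flipInt n univ).toReal / 2 := by
  classical
  have hm := measurable_card (n := n) (fun x (e : Fin 4 ↪ Fin n) => FlipIdx x e ∧
    ∀ a, x (e a) ∈ univ) fun e => measurableSet_flipIdx_mem e .univ
  have hm' := integral_toReal (μ := conf n) hm.aemeasurable (by simp)
  rw [lintegral_card_flipIdx n MeasurableSet.univ] at hm'
  rw [← hm', ← integral_div]
  refine integral_congr_ae ?_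
  filter_upwards [ae_generic n] with x hx
  have := two_mul_ncard_usefulNotDel hx.1 hx.2.1
  simp only [mem_univ, implies_true, and_true, ENNReal.toReal_natCast]
  rw [← this]
  push_cast; ring

end

section
open MeasureTheory
open scoped ENNReal

lemma exists_disk (u v : Pt) (t : ℝ) : ∃ z : Pt, ∃ r : ℝ, 0 ≤ r ∧
    ∀ p, dotAt u v p - t * orient u v p = dist p z ^ 2 - r ^ 2 := by
  obtain ⟨w, hw⟩ := exists_pwr u v t
  obtain ⟨z, r, hr, h⟩ := pwr_eq_dist_sq w u (by rw [hw]; simp [dotAt])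
  exact ⟨z, r, hr, fun p => by rw [← h, hw]⟩

lemma exists_ball_subset_disksOf {q : Fin 4 → Pt} (hq : q ∈ flipSet) (i : Fin 4) :
    ∃ z : Pt, ∃ r : ℝ, 0 ≤ r ∧ Metric.ball z r ⊆ disksOf q ∧ dist (q i) z = r ∧
      ∀ j, dist (q j) z ≤ r := by
  obtain ⟨ho, ho', hc⟩ := hq
  obtain ⟨z, r, hr, h⟩ := exists_disk (q 0) (q 1) (cotAt (q 0) (q 1) (q 2))
  obtain ⟨z', r', hr', h'⟩ := exists_disk (q 0) (q 1) (cotAt (q 0) (q 1) (q 3))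
  have hb : Metric.ball z r ⊆ disksOf q := fun p hp => Or.inl (by
    have := h p
    have : dist p z ^ 2 < r ^ 2 := pow_lt_pow_left₀ (Metric.mem_ball.1 hp) dist_nonneg two_ne_zero
    linarith)
  have hb' : Metric.ball z' r' ⊆ disksOf q := fun p hp => Or.inr (by
    have := h' p
    have : dist p z' ^ 2 < r' ^ 2 := pow_lt_pow_left₀ (Metric.mem_ball.1 hp) dist_nonneg two_ne_zero
    linarith)
  have e2 := dotAt_eq_cotAt ho.ne'
  have e3 := dotAt_eq_cotAt ho'.ne
  have le : ∀ j, dist (q j) z ^ 2 ≤ r ^ 2 := by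
    intro j
    fin_cases j
    · have := h (q 0); simp [dotAt] at this; simp; linarith
    · have := h (q 1); simp [dotAt] at this; simp; linarith
    · have := h (q 2); simp at this ⊢; linarith
    · have := h (q 3); simp at this ⊢; nlinarith
  have le' : ∀ j, dist (q j) z' ^ 2 ≤ r' ^ 2 := by
    intro j
    fin_cases j
    · have := h' (q 0); simp [dotAt] at this; simp; linarith
    · have := h' (q 1); simp [dotAt] at this; simp; linarith
    · have := h' (q 2); simp at this ⊢; nlinarith
    · have := h' (q 3); simp at this ⊢; linarith
  have Le : ∀ j, dist (q j) z ≤ r := fun j => (sq_le_sq₀ dist_nonneg hr).1 (le j)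
  have Le' : ∀ j, dist (q j) z' ≤ r' := fun j => (sq_le_sq₀ dist_nonneg hr').1 (le' j)
  by_cases hi : i = 3
  · subst hi
    refine ⟨z', r', hr', hb', ?_, Le'⟩
    have := h' (q 3)
    rw [← sq_eq_sq₀ dist_nonneg hr']; linarith
  · refine ⟨z, r, hr, hb, ?_, Le⟩
    rw [← sq_eq_sq₀ dist_nonneg hr]
    fin_cases i
    · have := h (q 0); simp [dotAt] at this; simp; linarith
    · have := h (q 1); simp [dotAt] at this; simp; linarith
    · have := h (q 2); simp at this ⊢; linarith
    · exact absurd rfl hi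

/-- The points of the unit square at distance at least `δ` from its boundary. -/
def innerSq (δ : ℝ) : Set Pt := {p : Pt | p 0 ∈ Icc δ (1 - δ) ∧ p 1 ∈ Icc δ (1 - δ)}

lemma measurableSet_innerSq (δ : ℝ) : MeasurableSet (innerSq δ) :=
  (measurableSet_Icc.preimage (measurable_apply 0)).inter
    (measurableSet_Icc.preimage (measurable_apply 1))

lemma dist_sq_eq (p q : Pt) : dist p q ^ 2 = (p 0 - q 0) ^ 2 + (p 1 - q 1) ^ 2 := by
  rw [EuclideanSpace.dist_eq, Real.sq_sqrt (by positivity)]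
  simp only [Fin.sum_univ_two, Real.dist_eq, sq_abs]

lemma abs_sub_apply_le_dist (p q : Pt) (i : Fin 2) : |p i - q i| ≤ dist p q := by
  rw [dist_eq_norm, ← Real.norm_eq_abs]
  exact PiLp.norm_apply_le (p - q) i

lemma innerSq_ball_subset {δ : ℝ} {p : Pt} (hp : p ∈ innerSq δ) {q : Pt} (h : dist q p ≤ δ) :
    q ∈ unitSq := by
  have h0 := abs_le.1 ((abs_sub_apply_le_dist q p 0).trans h)
  have h1 := abs_le.1 ((abs_sub_apply_le_dist q p 1).trans h)
  obtain ⟨⟨a, b⟩, c, d⟩ := hp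
  exact ⟨⟨by linarith, by linarith⟩, by linarith, by linarith⟩

lemma unitSq_dist_sq_le {p q : Pt} (hp : p ∈ unitSq) (hq : q ∈ unitSq) : dist p q ^ 2 ≤ 2 := by
  rw [dist_sq_eq]
  obtain ⟨⟨a, b⟩, c, d⟩ := hp
  obtain ⟨⟨a', b'⟩, c', d'⟩ := hq
  nlinarith

lemma unifSq_real_disksOf_ge {q : Fin 4 → Pt} (hq : q ∈ flipSet) (hS : ∀ a, q a ∈ unitSq) {δ : ℝ}
    (hδ : 0 < δ) (hδ1 : δ ≤ 1) {i : Fin 4} (hi : q i ∈ innerSq δ) (j : Fin 4) :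
    (δ ^ 2 / 16) * dist (q j) (q i) ^ 2 ≤ unifSq.real (disksOf q) := by
  obtain ⟨z, r, hr, hb, hz, hle⟩ := exists_ball_subset_disksOf hq i
  set d := dist (q j) (q i) with hd
  have hdr : d ≤ 2 * r := by
    calc d ≤ dist (q j) z + dist z (q i) := dist_triangle _ _ _
      _ ≤ 2 * r := by rw [dist_comm z, hz]; linarith [hle j]
  have hd0 : 0 ≤ d := dist_nonneg
  have hd2 : d ≤ 2 := by nlinarith [unitSq_dist_sq_le (hS j) (hS i)]
  rcases hd0.eq_or_lt with h0 | h0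
  · rw [← h0]; simp
  have hrp : 0 < r := by linarith
  set ρ := δ * d / 4 with hρ
  have hρr : ρ ≤ r := by nlinarith
  have hρδ : ρ ≤ δ / 2 := by nlinarith
  have hρ0 : 0 ≤ ρ := by positivity
  set c : Pt := q i + (ρ / r) • (z - q i) with hc
  have hci : dist c (q i) = ρ := by
    rw [hc, dist_eq_norm, add_sub_cancel_left, norm_smul, ← dist_eq_norm, dist_comm, hz,
      Real.norm_of_nonneg (by positivity)]
    field_simp
  have hcz : dist c z = r - ρ := by
    have : c - z = (1 - ρ / r) • (q i - z) := by rw [hc]; module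
    rw [dist_eq_norm, this, norm_smul, ← dist_eq_norm (q i), hz, Real.norm_of_nonneg]
    · field_simp
    · rw [sub_nonneg, div_le_one hrp]; exact hρr
  have hsub : Metric.ball c ρ ⊆ disksOf q ∩ unitSq := by
    intro p hp
    rw [Metric.mem_ball] at hp
    refine ⟨hb ?_, innerSq_ball_subset hi ?_⟩
    · rw [Metric.mem_ball]
      linarith [dist_triangle p c z]
    · linarith [dist_triangle p c (q i)]
  have hm : volume.real (Metric.ball c ρ) ≤ unifSq.real (disksOf q) := by
    rw [unifSq, measureReal_restrict_apply (measurableSet_disksOf q)]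
    refine measureReal_mono hsub ?_
    exact ((measure_mono inter_subset_right).trans_lt (volume_unitSq ▸ ENNReal.one_lt_top)).ne
  refine le_trans ?_ hm
  rw [measureReal_def, InnerProductSpace.volume_ball_of_dim_even (k := 1) (by simp)]
  simp
  rw [ENNReal.toReal_ofReal hρ0, ENNReal.toReal_ofReal Real.pi_pos.le, hρ]
  nlinarith [Real.pi_gt_three, mul_pos (pow_pos hδ 2) (pow_pos h0 2)]

lemma sum_dist_sq_le {q : Fin 4 → Pt} (hq : q ∈ flipSet) (hS : ∀ a, q a ∈ unitSq) {δ : ℝ}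
    (hδ : 0 < δ) (hδ1 : δ ≤ 1) {i : Fin 4} (hi : q i ∈ innerSq δ) :
    (δ ^ 2 / 192) * ∑ j : Fin 3, dist (q j.succ) (q 0) ^ 2 ≤ unifSq.real (disksOf q) := by
  have key : ∀ j, δ ^ 2 * dist (q j) (q 0) ^ 2 ≤ 64 * unifSq.real (disksOf q) := by
    intro j
    have h1 := unifSq_real_disksOf_ge hq hS hδ hδ1 hi j
    have h2 := unifSq_real_disksOf_ge hq hS hδ hδ1 hi 0
    have h3 : dist (q j) (q 0) ^ 2 ≤ 2 * dist (q j) (q i) ^ 2 + 2 * dist (q 0) (q i) ^ 2 := by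
      have := dist_triangle_right (q j) (q 0) (q i)
      nlinarith [sq_nonneg (dist (q j) (q i) - dist (q 0) (q i)), @dist_nonneg _ _ (q j) (q 0)]
    nlinarith [mul_le_mul_of_nonneg_left h3 (sq_nonneg δ)]
  rw [Fin.sum_univ_three]
  linarith [key (Fin.succ 0), key (Fin.succ 1), key (Fin.succ 2)]

end

section
open MeasureTheory
open scoped ENNReal

/-- A quadruple with first vertex at the origin. -/
def quad (w : Fin 3 → Pt) : Fin 4 → Pt := Fin.cons 0 w

/-- The quadruple with first vertex `u` and shape `w` at scale `s`. -/
def place (s : ℝ) (r : Pt × (Fin 3 → Pt)) : Fin 4 → Pt := fun a => r.1 + s • quad r.2 a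

lemma measurable_quad : Measurable quad := by
  refine measurable_pi_lambda _ fun a => ?_
  refine Fin.cases ?_ (fun j => ?_) a
  · exact measurable_const
  · exact measurable_pi_apply j

lemma measurable_place (s : ℝ) : Measurable (place s) := by
  refine measurable_pi_lambda _ fun a => ?_
  exact measurable_fst.add
    (((measurable_pi_apply a).comp (measurable_quad.comp measurable_snd)).const_smul s)

lemma lintegral_place {s : ℝ} (hs : 0 < s) {G : (Fin 4 → Pt) → ℝ≥0∞} (hG : Measurable G) :
    ∫⁻ r, G (place s r) = ENNReal.ofReal (s ^ 6)⁻¹ * ∫⁻ q, G q := by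
  have hp := volume_preserving_piFinSuccAbove (fun _ : Fin 4 => Pt) 0
  set e := MeasurableEquiv.piFinSuccAbove (fun _ : Fin 4 => Pt) 0 with he
  have hsm : Measurable fun r : Pt × (Fin 3 → Pt) => G (e.symm r) := hG.comp e.symm.measurable
  have hpm : Measurable fun r : Pt × (Fin 3 → Pt) => G (place s r) := hG.comp (measurable_place s)
  have h1 : ∫⁻ q, G q = ∫⁻ r, G (e.symm r) := by
    rw [← hp.lintegral_comp hsm]
    exact lintegral_congr fun q => by rw [e.symm_apply_apply]
  have hpl : ∀ (u : Pt) (w : Fin 3 → Pt), place s (u, w) = e.symm (u, (fun _ => u) + s • w) := by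
    intro u w
    ext1 a
    refine Fin.cases ?_ (fun j => ?_) a
    · simp [place, quad, he, MeasurableEquiv.piFinSuccAbove]
    · simp [place, quad, he, MeasurableEquiv.piFinSuccAbove]
  rw [h1, Measure.volume_eq_prod, lintegral_prod _ hsm.aemeasurable,
    lintegral_prod _ hpm.aemeasurable,
    ← lintegral_const_mul _ hsm.lintegral_prod_right']
  refine lintegral_congr fun u => ?_
  simp_rw [hpl]
  have hu : Measurable fun w : Fin 3 → Pt => G (e.symm (u, w)) := hsm.comp measurable_prodMk_left
  have hu' : Measurable fun w : Fin 3 → Pt => G (e.symm (u, (fun _ => u) + w)) :=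
    hu.comp (measurable_const_add _)
  have h2 : ∫⁻ w : Fin 3 → Pt, G (e.symm (u, (fun _ => u) + s • w)) =
      ∫⁻ w, G (e.symm (u, (fun _ => u) + w)) ∂(Measure.map (s • ·) volume) :=
    (lintegral_map hu' (measurable_const_smul s)).symm
  have hf : Module.finrank ℝ (Fin 3 → Pt) = 6 := by
    rw [Module.finrank_pi_fintype]; simp
  rw [h2, Measure.map_addHaar_smul _ hs.ne', lintegral_smul_measure, hf,
    lintegral_add_left_eq_self (fun w => G (e.symm (u, w))) (fun _ => u),
    abs_of_pos (by positivity), smul_eq_mul]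

lemma orient_place (p a b c : Pt) (s : ℝ) :
    orient (p + s • a) (p + s • b) (p + s • c) = s ^ 2 * orient a b c := by
  simp [orient]; ring

lemma dotAt_place (p a b c : Pt) (s : ℝ) :
    dotAt (p + s • a) (p + s • b) (p + s • c) = s ^ 2 * dotAt a b c := by
  simp [dotAt]; ring

lemma cotAt_place (p a b c : Pt) {s : ℝ} (hs : s ≠ 0) :
    cotAt (p + s • a) (p + s • b) (p + s • c) = cotAt a b c := by
  unfold cotAt; rw [orient_place, dotAt_place, mul_div_mul_left _ _ (pow_ne_zero 2 hs)]

lemma place_mem_flipSet {s : ℝ} (hs : 0 < s) (r : Pt × (Fin 3 → Pt)) :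
    place s r ∈ flipSet ↔ quad r.2 ∈ flipSet := by
  have : 0 < s ^ 2 := by positivity
  simp only [flipSet, mem_ofPred_eq, Flippable, place, orient_place, cotAt_place _ _ _ _ hs.ne',
    mul_pos_iff_of_pos_left this, ← neg_pos, ← mul_neg]

lemma mem_disksOf_place {s : ℝ} (hs : 0 < s) (r : Pt × (Fin 3 → Pt)) (p : Pt) :
    r.1 + s • p ∈ disksOf (place s r) ↔ p ∈ disksOf (quad r.2) := by
  have h2 : 0 < s ^ 2 := by positivity
  simp only [disksOf, twoDisks, place, mem_ofPred_eq, orient_place, dotAt_place,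
    cotAt_place _ _ _ _ hs.ne']
  rw [show ∀ x, cotAt (quad r.2 0) (quad r.2 1) (quad r.2 2) * (s ^ 2 * x) =
    s ^ 2 * (cotAt (quad r.2 0) (quad r.2 1) (quad r.2 2) * x) from fun x => by ring,
    show ∀ x, cotAt (quad r.2 0) (quad r.2 1) (quad r.2 3) * (s ^ 2 * x) =
    s ^ 2 * (cotAt (quad r.2 0) (quad r.2 1) (quad r.2 3) * x) from fun x => by ring,
    mul_lt_mul_iff_right₀ h2, mul_lt_mul_iff_right₀ h2]

lemma disksOf_place {s : ℝ} (hs : 0 < s) (r : Pt × (Fin 3 → Pt)) :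
    disksOf (place s r) = (fun p => r.1 + s • p) '' disksOf (quad r.2) := by
  ext p
  have hp : r.1 + s • (s⁻¹ • (p - r.1)) = p := by
    rw [smul_inv_smul₀ hs.ne']; abel
  constructor
  · intro h
    exact ⟨s⁻¹ • (p - r.1), by rwa [← mem_disksOf_place hs, hp], hp⟩
  · rintro ⟨p', h, rfl⟩
    exact (mem_disksOf_place hs r p').2 h

open Pointwise in
lemma volume_disksOf_place {s : ℝ} (hs : 0 < s) (r : Pt × (Fin 3 → Pt)) :
    volume (disksOf (place s r)) = ENNReal.ofReal (s ^ 2) * volume (disksOf (quad r.2)) := by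
  rw [disksOf_place hs, show (fun p => r.1 + s • p) '' disksOf (quad r.2) =
    (fun p => r.1 + p) '' (s • disksOf (quad r.2)) by rw [← image_smul, image_image],
    image_add_left, measure_preimage_add, Measure.addHaar_smul]
  simp

lemma isBounded_disksOf (q : Fin 4 → Pt) : Bornology.IsBounded (disksOf q) := by
  obtain ⟨z, r, hr, h⟩ := exists_disk (q 0) (q 1) (cotAt (q 0) (q 1) (q 2))
  obtain ⟨z', r', hr', h'⟩ := exists_disk (q 0) (q 1) (cotAt (q 0) (q 1) (q 3))
  refine (Metric.isBounded_ball (x := z) (r := r)).union (Metric.isBounded_ball (x := z') (r := r'))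
    |>.subset ?_
  rintro p (hp | hp)
  · left
    have := h p
    rw [Metric.mem_ball, ← sq_lt_sq₀ dist_nonneg hr]
    linarith
  · right
    have := h' p
    rw [Metric.mem_ball, ← sq_lt_sq₀ dist_nonneg hr']
    linarith

end

section
open MeasureTheory Filter
open scoped ENNReal Topology

/-- The quadruples of points of the unit square. -/
def cube : Set (Fin 4 → Pt) := {q | ∀ a, q a ∈ unitSq}

/-- The probability that `n - 4` independent points avoid the disks of `q`. -/
def avoidProb (n : ℕ) (q : Fin 4 → Pt) : ℝ≥0∞ := (unifSq (disksOf q)ᶜ) ^ (n - 4)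

lemma measurableSet_forall_apply_mem {A : Set Pt} (hA : MeasurableSet A) :
    MeasurableSet {q : Fin 4 → Pt | ∀ a, q a ∈ A} := by
  rw [show {q : Fin 4 → Pt | ∀ a, q a ∈ A} = ⋂ a, (fun q => q a) ⁻¹' A by ext; simp]
  exact .iInter fun a => measurable_pi_apply a hA

lemma measurableSet_cube : MeasurableSet cube := measurableSet_forall_apply_mem measurableSet_unitSq

lemma measurable_avoidProb (n : ℕ) : Measurable (avoidProb n) := by
  have := measurable_measure_prodMk_left (ν := unifSq) measurableSet_disksOf_prod.compl
  exact this.pow_const _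

lemma lintegral_pi_unifSq {B : Set (Fin 4 → Pt)} (hB : MeasurableSet B)
    {h : (Fin 4 → Pt) → ℝ≥0∞} (hh : Measurable h) {s : ℝ} (hs : 0 < s) :
    ENNReal.ofReal (s ^ 6)⁻¹ * ∫⁻ q in B, h q ∂(Measure.pi fun _ : Fin 4 => unifSq) =
      ∫⁻ r, (B ∩ cube).indicator h (place s r) := by
  have hc : (univ.pi fun _ : Fin 4 => unitSq) = cube := by ext; simp [cube]
  rw [lintegral_place hs (hh.indicator (hB.inter measurableSet_cube)),
    lintegral_indicator (hB.inter measurableSet_cube)]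
  unfold unifSq
  rw [← Measure.restrict_pi_pi, hc, Measure.restrict_restrict hB, ← volume_pi]

/-- The typical distance between neighbours among `n` points. -/
def meshSize (n : ℕ) : ℝ := (√n)⁻¹

lemma meshSize_sq (n : ℕ) : meshSize n ^ 2 = (n : ℝ)⁻¹ := by
  rw [meshSize, inv_pow, Real.sq_sqrt (Nat.cast_nonneg n)]

lemma meshSize_pos {n : ℕ} (hn : 0 < n) : 0 < meshSize n := by
  unfold meshSize; positivity

lemma tendsto_meshSize : Tendsto meshSize atTop (𝓝 0) :=
  tendsto_inv_atTop_zero.comp (Real.tendsto_sqrt_atTop.comp tendsto_natCast_atTop_atTop)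

lemma cube_mul_lintegral {n : ℕ} (hn : 0 < n) {B : Set (Fin 4 → Pt)} (hB : MeasurableSet B) :
    (n : ℝ≥0∞) ^ 3 * ∫⁻ q in B, avoidProb n q ∂(Measure.pi fun _ : Fin 4 => unifSq) =
      ∫⁻ r, (B ∩ cube).indicator (avoidProb n) (place (meshSize n) r) := by
  rw [← lintegral_pi_unifSq hB (measurable_avoidProb n) (meshSize_pos hn)]
  congr 1
  rw [show meshSize n ^ 6 = (meshSize n ^ 2) ^ 3 by ring, meshSize_sq, ← inv_pow, inv_inv,
    ENNReal.ofReal_pow (by positivity), ENNReal.ofReal_natCast]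

/-- The limit of the rescaled probability that `w` completes the origin to a flippable
quadrilateral whose disks are empty. -/
def limWeight (w : Fin 3 → Pt) : ℝ≥0∞ :=
  (quad ⁻¹' flipSet).indicator
    (fun w => ENNReal.ofReal (Real.exp (-(volume (disksOf (quad w))).toReal))) w

lemma measurable_limWeight : Measurable limWeight := by
  refine Measurable.indicator ?_ (measurable_quad measurableSet_flipSet)
  refine ENNReal.measurable_ofReal.comp (Real.measurable_exp.comp (Measurable.neg ?_))
  refine ENNReal.measurable_toReal.comp ?_
  exact (measurable_measure_prodMk_left (ν := (volume : Measure Pt))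
    measurableSet_disksOf_prod).comp measurable_quad

lemma unifSq_disksOf_compl (q : Fin 4 → Pt) :
    unifSq (disksOf q)ᶜ = ENNReal.ofReal (1 - unifSq.real (disksOf q)) := by
  rw [← probReal_compl_eq_one_sub (measurableSet_disksOf q), ofReal_measureReal]

lemma eventually_place_mem_square {u : Pt} (hu : ∀ i, u i ∈ Ioo (0 : ℝ) 1) {A : Set Pt}
    (hA : Bornology.IsBounded A) : ∀ᶠ n in atTop, ∀ p ∈ A, u + meshSize n • p ∈ unitSq := by
  obtain ⟨C, hC⟩ := hA.exists_norm_le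
  have hsC : Tendsto (fun n => meshSize n * C) atTop (𝓝 0) := by
    simpa using tendsto_meshSize.mul_const C
  have ev : ∀ i, ∀ᶠ n in atTop, meshSize n * C < u i ∧ meshSize n * C < 1 - u i := fun i =>
    (hsC.eventually_lt_const (hu i).1).and (hsC.eventually_lt_const (by linarith [(hu i).2]))
  filter_upwards [ev 0, ev 1, eventually_gt_atTop 0] with n h0 h1 hn p hp
  have hs := meshSize_pos hn
  have key : ∀ i, |meshSize n * p i| ≤ meshSize n * C := fun i => by
    rw [abs_mul, abs_of_pos hs]
    refine mul_le_mul_of_nonneg_left ?_ hs.le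
    simpa using (PiLp.norm_apply_le p i).trans (hC p hp)
  have k0 := abs_le.1 (key 0)
  have k1 := abs_le.1 (key 1)
  simp only [unitSq, mem_ofPred_eq, PiLp.add_apply, PiLp.smul_apply, smul_eq_mul, mem_Icc]
  exact ⟨⟨by linarith, by linarith⟩, ⟨by linarith, by linarith⟩⟩

lemma tendsto_avoidProb {r : Pt × (Fin 3 → Pt)} (hr : ∀ i, r.1 i ∈ Ioo (0 : ℝ) 1) :
    Tendsto (fun n => avoidProb n (place (meshSize n) r)) atTop
      (𝓝 (ENNReal.ofReal (Real.exp (-(volume (disksOf (quad r.2))).toReal)))) := by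
  set V := (volume (disksOf (quad r.2))).toReal with hV
  have hev : ∀ᶠ n : ℕ in atTop, avoidProb n (place (meshSize n) r) =
      ENNReal.ofReal ((1 + (-V) / n) ^ n / (1 + (-V) / n) ^ 4) := by
    have hVn : ∀ᶠ n : ℕ in atTop, V < n := tendsto_natCast_atTop_atTop.eventually_gt_atTop V
    filter_upwards [eventually_place_mem_square hr (isBounded_disksOf (quad r.2)),
      eventually_ge_atTop 5, hVn] with n hn hn5 hVn
    have hs := meshSize_pos (n := n) (by omega)
    have hU : unifSq.real (disksOf (place (meshSize n) r)) = V / n := by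
      have hsub : disksOf (place (meshSize n) r) ⊆ unitSq := by
        rw [disksOf_place hs]
        rintro _ ⟨p, hp, rfl⟩
        exact hn p hp
      rw [measureReal_def, unifSq, Measure.restrict_apply (measurableSet_disksOf _),
        inter_eq_left.2 hsub, volume_disksOf_place hs, ENNReal.toReal_mul,
        ENNReal.toReal_ofReal (by positivity), meshSize_sq, ← hV]
      ring
    have hpos : 0 < 1 + -V / n := by
      have : (0 : ℝ) < n := by positivity
      have : V / n < 1 := by rwa [div_lt_one this]
      rw [neg_div]; linarith
    rw [avoidProb, unifSq_disksOf_compl, hU, show 1 - V / n = 1 + -V / n by ring,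
      ← ENNReal.ofReal_pow hpos.le]
    congr 1
    rw [eq_div_iff (by positivity), ← pow_add]
    congr 1; omega
  refine (tendsto_congr' hev).2 (ENNReal.tendsto_ofReal ?_)
  have h1 : Tendsto (fun n : ℕ => 1 + (-V) / n) atTop (𝓝 1) := by
    simpa using (tendsto_const_div_atTop_nhds_zero_nat (-V)).const_add 1
  have := (Real.tendsto_one_add_div_pow_exp (-V)).div (h1.pow 4) (by norm_num)
  simpa using! this

lemma tendsto_indicator_avoidProb {r : Pt × (Fin 3 → Pt)} (h : (∀ i, r.1 i ∈ Ioo (0 : ℝ) 1) ∨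
    r.1 ∉ unitSq) :
    Tendsto (fun n => (flipSet ∩ cube).indicator (avoidProb n) (place (meshSize n) r)) atTop
      (𝓝 (unitSq.indicator 1 r.1 * limWeight r.2)) := by
  by_cases hf : quad r.2 ∈ flipSet
  · rcases h with h | h
    · have h1 : r.1 ∈ unitSq := ⟨Ioo_subset_Icc_self (h 0), Ioo_subset_Icc_self (h 1)⟩
      rw [indicator_of_mem h1, limWeight, indicator_of_mem (by exact hf)]
      simp only [Pi.one_apply, one_mul]
      refine (tendsto_avoidProb h).congr' ?_
      filter_upwards [eventually_place_mem_square h (Set.finite_range (quad r.2)).isBounded,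
        eventually_gt_atTop 0] with n hn hn0
      rw [indicator_of_mem]
      exact ⟨(place_mem_flipSet (meshSize_pos hn0) r).2 hf, fun a => hn _ (mem_range_self a)⟩
    · rw [indicator_of_notMem h, zero_mul]
      refine tendsto_const_nhds.congr fun n => (indicator_of_notMem ?_ _).symm
      rintro ⟨-, h2⟩
      have := h2 0
      simp [place, quad] at this
      exact h this
  · rw [limWeight, indicator_of_notMem (s := quad ⁻¹' flipSet) (by exact hf), mul_zero]
    refine tendsto_const_nhds.congr' ?_
    filter_upwards [eventually_gt_atTop 0] with n hn
    refine (indicator_of_notMem ?_ _).symm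
    rintro ⟨h1, -⟩
    exact hf ((place_mem_flipSet (meshSize_pos hn) r).1 h1)

lemma ae_interior_or_notMem : ∀ᵐ r : Pt × (Fin 3 → Pt),
    (∀ i, r.1 i ∈ Ioo (0 : ℝ) 1) ∨ r.1 ∉ unitSq := by
  have h : ∀ᵐ u : Pt, (∀ i, u i ∈ Ioo (0 : ℝ) 1) ∨ u ∉ unitSq := by
    have hne : ∀ (i : Fin 2) (c : ℝ), ∀ᵐ u : Pt, u i ≠ c := by
      intro i c
      have h1 : ∀ᵐ x : ℝ, x ≠ c := by simp [ae_iff]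
      have h2 := (Measure.quasiMeasurePreserving_eval (μ := fun _ : Fin 2 => (volume : Measure ℝ)) i).ae h1
      exact (PiLp.volume_preserving_ofLp (Fin 2)).quasiMeasurePreserving.ae h2
    filter_upwards [hne 0 0, hne 0 1, hne 1 0, hne 1 1] with u h1 h2 h3 h4
    by_cases hu : u ∈ unitSq
    · left
      obtain ⟨⟨a, b⟩, ⟨c, d⟩⟩ := hu
      simp only [Fin.forall_fin_two]
      exact ⟨⟨a.lt_of_ne h1.symm, b.lt_of_ne h2⟩, ⟨c.lt_of_ne h3.symm, d.lt_of_ne h4⟩⟩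
    · exact Or.inr hu
  exact Measure.quasiMeasurePreserving_fst.ae h

end

section
open MeasureTheory Filter
open scoped ENNReal Topology

lemma lintegral_prod_unitSq {g : (Fin 3 → Pt) → ℝ≥0∞} (hg : Measurable g) :
    ∫⁻ r : Pt × (Fin 3 → Pt), unitSq.indicator 1 r.1 * g r.2 = ∫⁻ w, g w := by
  rw [Measure.volume_eq_prod, lintegral_prod_mul
    (measurable_one.indicator measurableSet_unitSq).aemeasurable hg.aemeasurable,
    lintegral_indicator_one measurableSet_unitSq, volume_unitSq, one_mul]

lemma measurable_indicator_avoidProb (n : ℕ) {B : Set (Fin 4 → Pt)} (hB : MeasurableSet B) (s : ℝ) :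
    Measurable fun r => (B ∩ cube).indicator (avoidProb n) (place s r) :=
  ((measurable_avoidProb n).indicator (hB.inter measurableSet_cube)).comp (measurable_place s)

lemma cube_mul_flipInt {n : ℕ} (hn : 0 < n) : (n : ℝ≥0∞) ^ 3 * flipInt n univ =
    ∫⁻ r, (flipSet ∩ cube).indicator (avoidProb n) (place (meshSize n) r) := by
  rw [← cube_mul_lintegral hn measurableSet_flipSet, flipInt]
  simp only [mem_univ, implies_true, ofPred_true, inter_univ]
  rfl

lemma limWeight_le_liminf :
    ∫⁻ w, limWeight w ≤ liminf (fun n : ℕ => (n : ℝ≥0∞) ^ 3 * flipInt n univ) atTop := by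
  calc ∫⁻ w, limWeight w
      = ∫⁻ r : Pt × (Fin 3 → Pt), unitSq.indicator 1 r.1 * limWeight r.2 :=
        (lintegral_prod_unitSq measurable_limWeight).symm
    _ = ∫⁻ r, liminf (fun n => (flipSet ∩ cube).indicator (avoidProb n) (place (meshSize n) r))
          atTop := by
        refine lintegral_congr_ae ?_
        filter_upwards [ae_interior_or_notMem] with r hr
        exact (tendsto_indicator_avoidProb hr).liminf_eq.symm
    _ ≤ liminf (fun n => ∫⁻ r, (flipSet ∩ cube).indicator (avoidProb n) (place (meshSize n) r))
          atTop :=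
        lintegral_liminf_le fun n => measurable_indicator_avoidProb n measurableSet_flipSet _
    _ = _ := by
        refine liminf_congr ?_
        filter_upwards [eventually_gt_atTop 0] with n hn
        exact (cube_mul_flipInt hn).symm

lemma lintegral_gaussian_ne_top {c : ℝ} (hc : 0 < c) :
    ∫⁻ w : Fin 3 → Pt, ENNReal.ofReal (Real.exp (-(c * ∑ j, ‖w j‖ ^ 2))) ≠ ∞ := by
  have h1 : Integrable fun v : Pt => Real.exp (-(c * ‖v‖ ^ 2)) := by
    have := GaussianFourier.integrable_cexp_neg_mul_sq_norm_add (V := Pt) (b := c) (by simpa) 0 0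
    refine this.norm.congr (Eventually.of_forall fun v => ?_)
    simp [Complex.norm_exp, ← Complex.ofReal_pow]
  have h2 : Integrable fun w : Fin 3 → Pt => Real.exp (-(c * ∑ j, ‖w j‖ ^ 2)) := by
    have := Integrable.fintype_prod (ι := Fin 3) (fun _ => h1)
    refine this.congr (Eventually.of_forall fun w => ?_)
    simp [← Real.exp_sum, Finset.mul_sum]
  exact h2.lintegral_lt_top.ne

/-- The quadruples with a point at distance at least `δ` from the boundary of the square. -/
def meetsInner (δ : ℝ) : Set (Fin 4 → Pt) := {q | ∀ a, q a ∈ (innerSq δ)ᶜ}ᶜ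

lemma measurableSet_meetsInner (δ : ℝ) : MeasurableSet (meetsInner δ) :=
  (measurableSet_forall_apply_mem (measurableSet_innerSq δ).compl).compl

lemma indicator_avoidProb_le {δ : ℝ} (hδ : 0 < δ) (hδ1 : δ ≤ 1) {n : ℕ} (hn : 5 ≤ n)
    (r : Pt × (Fin 3 → Pt)) :
    (flipSet ∩ meetsInner δ ∩ cube).indicator (avoidProb n) (place (meshSize n) r) ≤
      unitSq.indicator 1 r.1 *
        ENNReal.ofReal (Real.exp (-(δ ^ 2 / 960 * ∑ j, ‖r.2 j‖ ^ 2))) := by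
  by_cases hq : place (meshSize n) r ∈ flipSet ∩ meetsInner δ ∩ cube
  swap
  · rw [indicator_of_notMem hq]; exact zero_le
  rw [indicator_of_mem hq]
  obtain ⟨⟨hf, hm⟩, hc⟩ := hq
  have hs := meshSize_pos (n := n) (by omega)
  have h0 : place (meshSize n) r 0 = r.1 := by simp [place, quad]
  have h1 : r.1 ∈ unitSq := h0 ▸ hc 0
  obtain ⟨i, hi⟩ : ∃ i, place (meshSize n) r i ∈ innerSq δ := by
    simpa [meetsInner] using hm
  have hU := sum_dist_sq_le hf hc hδ hδ1 hi
  have hd : ∀ j : Fin 3, dist (place (meshSize n) r j.succ) (place (meshSize n) r 0) ^ 2 =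
      (n : ℝ)⁻¹ * ‖r.2 j‖ ^ 2 := fun j => by
    rw [h0, ← meshSize_sq, ← mul_pow, dist_eq_norm]
    simp [place, quad, norm_smul, abs_of_pos hs]
  simp only [hd, ← Finset.mul_sum] at hU
  set U := unifSq.real (disksOf (place (meshSize n) r))
  rw [indicator_of_mem h1, Pi.one_apply, one_mul, avoidProb, unifSq_disksOf_compl]
  have hexp : ENNReal.ofReal (1 - U) ≤ ENNReal.ofReal (Real.exp (-U)) :=
    ENNReal.ofReal_le_ofReal (Real.one_sub_le_exp_neg U)
  refine (pow_le_pow_left' hexp _).trans ?_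
  rw [← ENNReal.ofReal_pow (Real.exp_pos _).le, ← Real.exp_nat_mul]
  refine ENNReal.ofReal_le_ofReal (Real.exp_le_exp.2 ?_)
  have hn' : (5 : ℝ) ≤ n := by exact_mod_cast hn
  have hn4 : (n : ℝ) / 5 ≤ ((n - 4 : ℕ) : ℝ) := by
    rw [Nat.cast_sub (by omega)]; push_cast; linarith
  have hU0 : 0 ≤ U := measureReal_nonneg
  have hle : n / 5 * U ≤ ((n - 4 : ℕ) : ℝ) * U := mul_le_mul_of_nonneg_right hn4 hU0
  have hle2 := mul_le_mul_of_nonneg_left hU (show (0 : ℝ) ≤ n / 5 by positivity)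
  have : (n : ℝ) / 5 * (δ ^ 2 / 192 * ((n : ℝ)⁻¹ * ∑ j, ‖r.2 j‖ ^ 2)) =
      δ ^ 2 / 960 * ∑ j, ‖r.2 j‖ ^ 2 := by
    field_simp; ring
  linarith

lemma limsup_lintegral_indicator_le {δ : ℝ} (hδ : 0 < δ) (hδ1 : δ ≤ 1) :
    limsup (fun n => ∫⁻ r, (flipSet ∩ meetsInner δ ∩ cube).indicator (avoidProb n)
      (place (meshSize n) r)) atTop ≤ ∫⁻ w, limWeight w := by
  rw [← limsup_nat_add _ 5]
  have hc : 0 < δ ^ 2 / 960 := by positivity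
  have hg : Measurable fun w : Fin 3 → Pt =>
      ENNReal.ofReal (Real.exp (-(δ ^ 2 / 960 * ∑ j, ‖w j‖ ^ 2))) := by
    fun_prop
  refine (limsup_lintegral_le (fun r => unitSq.indicator 1 r.1 *
    ENNReal.ofReal (Real.exp (-(δ ^ 2 / 960 * ∑ j, ‖r.2 j‖ ^ 2))))
    (fun n => measurable_indicator_avoidProb _
      (measurableSet_flipSet.inter (measurableSet_meetsInner δ)) _)
    (fun n => Eventually.of_forall fun r => indicator_avoidProb_le hδ hδ1 (by omega) r) ?_).trans ?_
  · rw [lintegral_prod_unitSq hg]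
    exact lintegral_gaussian_ne_top hc
  · rw [← lintegral_prod_unitSq measurable_limWeight]
    refine lintegral_mono_ae ?_
    filter_upwards [ae_interior_or_notMem] with r hr
    refine le_of_le_of_eq ?_ ((limsup_nat_add (fun n => (flipSet ∩ cube).indicator (avoidProb n)
      (place (meshSize n) r)) 5).trans (tendsto_indicator_avoidProb hr).limsup_eq)
    refine limsup_le_limsup (Eventually.of_forall fun n => ?_)
    exact indicator_le_indicator_of_subset (f := avoidProb (n + 5))
      (inter_subset_inter_left _ inter_subset_left) (fun _ => zero_le) _

lemma unifSq_innerSq_compl {δ : ℝ} (hδ : 0 < δ) (hδ1 : δ ≤ 1 / 2) :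
    unifSq (innerSq δ)ᶜ ≤ ENNReal.ofReal (4 * δ) := by
  have h : unifSq.real (innerSq δ) = (1 - 2 * δ) ^ 2 := by
    rw [measureReal_def, unifSq, Measure.restrict_apply (measurableSet_innerSq δ),
      inter_eq_left.2, innerSq, volume_rect, ← ENNReal.ofReal_mul (by linarith),
      ENNReal.toReal_ofReal (by nlinarith)]
    · ring
    · exact fun p hp => ⟨⟨by linarith [hp.1.1], by linarith [hp.1.2]⟩,
        ⟨by linarith [hp.2.1], by linarith [hp.2.2]⟩⟩
  rw [← ofReal_measureReal, probReal_compl_eq_one_sub (measurableSet_innerSq δ), h]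
  exact ENNReal.ofReal_le_ofReal (by nlinarith)

lemma cube_mul_flipInt_le {n : ℕ} (hn : 6 ≤ n) {A : Set Pt} (hA : MeasurableSet A) :
    (n : ℝ≥0∞) ^ 3 * flipInt n A ≤ 256 * unifSq A := by
  have h1 : n ^ 4 ≤ 16 * n.descFactorial 4 := by
    have h2 : n ≤ 2 * (n + 1 - 4) := by omega
    calc n ^ 4 ≤ (2 * (n + 1 - 4)) ^ 4 := Nat.pow_le_pow_left h2 4
      _ = 16 * (n + 1 - 4) ^ 4 := by ring
      _ ≤ _ := Nat.mul_le_mul_left _ (Nat.pow_sub_le_descFactorial n 4)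
  have h1' : (n : ℝ≥0∞) ^ 4 ≤ 16 * n.descFactorial 4 := by exact_mod_cast h1
  have hn0 : (n : ℝ≥0∞) ≠ 0 := by simp; omega
  rw [← ENNReal.mul_le_mul_iff_right hn0 (ENNReal.natCast_ne_top n)]
  calc (n : ℝ≥0∞) * (n ^ 3 * flipInt n A) = n ^ 4 * flipInt n A := by ring
    _ ≤ 16 * n.descFactorial 4 * flipInt n A := by gcongr
    _ = 16 * (n.descFactorial 4 * flipInt n A) := by ring
    _ ≤ 16 * (16 * n * unifSq A) := by exact mul_le_mul_right (descFactorial_mul_flipInt_le n hA) _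
    _ = _ := by ring

lemma cube_mul_flipInt_univ_le {n : ℕ} (hn : 6 ≤ n) {δ : ℝ} (hδ : 0 < δ) (hδ1 : δ ≤ 1 / 2) :
    (n : ℝ≥0∞) ^ 3 * flipInt n univ ≤
      (∫⁻ r, (flipSet ∩ meetsInner δ ∩ cube).indicator (avoidProb n) (place (meshSize n) r)) +
        ENNReal.ofReal (1024 * δ) := by
  have h1 : flipInt n univ ≤
      (∫⁻ q in flipSet ∩ meetsInner δ, avoidProb n q ∂(Measure.pi fun _ : Fin 4 => unifSq)) +
        flipInt n (innerSq δ)ᶜ := by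
    refine (lintegral_mono_set ?_).trans (lintegral_union_le _ _ _)
    rintro q ⟨hq, -⟩
    by_cases h : ∀ a, q a ∈ (innerSq δ)ᶜ
    · exact Or.inr ⟨hq, h⟩
    · exact Or.inl ⟨hq, h⟩
  refine (mul_le_mul_right h1 _).trans ?_
  rw [mul_add, cube_mul_lintegral (by omega)
    (measurableSet_flipSet.inter (measurableSet_meetsInner δ))]
  gcongr
  refine (cube_mul_flipInt_le hn (measurableSet_innerSq δ).compl).trans ?_
  refine (mul_le_mul_right (unifSq_innerSq_compl hδ hδ1) _).trans ?_
  rw [show (1024 * δ) = 256 * (4 * δ) by ring, ENNReal.ofReal_mul (p := 256) (by norm_num)]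
  simp

lemma lintegral_limWeight_ne_top : ∫⁻ w, limWeight w ≠ ∞ := by
  refine ne_top_of_le_ne_top (b := 256) (by simp) (limWeight_le_liminf.trans ?_)
  refine liminf_le_of_frequently_le' (Eventually.frequently ?_)
  filter_upwards [eventually_ge_atTop 6] with n hn
  simpa using cube_mul_flipInt_le hn MeasurableSet.univ

lemma tendsto_cube_mul_flipInt :
    Tendsto (fun n : ℕ => (n : ℝ≥0∞) ^ 3 * flipInt n univ) atTop (𝓝 (∫⁻ w, limWeight w)) := by
  refine tendsto_of_le_liminf_of_limsup_le limWeight_le_liminf ?_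
  refine ENNReal.le_of_forall_pos_le_add fun ε hε _ => ?_
  set δ : ℝ := min (1 / 2) (ε / 1024) with hδ
  have hε' : (0 : ℝ) < ε := hε
  have hδ0 : 0 < δ := by positivity
  have hδ1 : δ ≤ 1 / 2 := min_le_left _ _
  have hδε : 1024 * δ ≤ ε := by have := min_le_right (1 / 2 : ℝ) (ε / 1024); linarith
  calc limsup (fun n : ℕ => (n : ℝ≥0∞) ^ 3 * flipInt n univ) atTop
      ≤ limsup (fun n => (∫⁻ r, (flipSet ∩ meetsInner δ ∩ cube).indicator (avoidProb n)
          (place (meshSize n) r)) + (ε : ℝ≥0∞)) atTop := by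
        refine limsup_le_limsup ?_
        filter_upwards [eventually_ge_atTop 6] with n hn
        refine (cube_mul_flipInt_univ_le hn hδ0 hδ1).trans ?_
        gcongr
        exact ENNReal.ofReal_le_of_le_toReal (by simpa using hδε)
    _ = limsup (fun n => (∫⁻ r, (flipSet ∩ meetsInner δ ∩ cube).indicator (avoidProb n)
          (place (meshSize n) r))) atTop + ε := by
        exact limsup_add_const _ _ _ (by isBoundedDefault) (by isBoundedDefault)
    _ ≤ _ := by gcongr; exact limsup_lintegral_indicator_le hδ0 (by linarith)

lemma tendsto_integral_div :
    Tendsto (fun n : ℕ => (∫ x : Fin n → Pt, ((usefulNotDel (range x)).ncard : ℝ) ∂(conf n)) / n)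
      atTop (𝓝 ((∫⁻ w, limWeight w).toReal / 2)) := by
  have h1 := (ENNReal.tendsto_toReal lintegral_limWeight_ne_top).comp tendsto_cube_mul_flipInt
  have h2 : Tendsto (fun n : ℕ => (n.descFactorial 4 : ℝ) / (n : ℝ) ^ 4) atTop (𝓝 1) := by
    refine (Asymptotics.isEquivalent_iff_tendsto_one ?_).1 (isEquivalent_descFactorial 4)
    filter_upwards [eventually_gt_atTop 0] with n hn
    positivity
  have h3 := (h2.mul h1).div_const 2
  rw [one_mul] at h3
  refine h3.congr' ?_
  filter_upwards [eventually_gt_atTop 0] with n hn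
  have : (0 : ℝ) < n := by positivity
  simp only [integral_ncard_usefulNotDel, Function.comp, ENNReal.toReal_mul, ENNReal.toReal_pow,
    ENNReal.toReal_natCast]
  field_simp

end

section
open MeasureTheory Filter
open scoped ENNReal Topology

/-- The area of the part above the horizontal axis of the disk of centre `(1, t)` through the
origin. -/
def capArea (t : ℝ) : ℝ := (1 + t ^ 2) * (Real.pi / 2 + Real.arctan t) + t

lemma hasDerivAt_capArea (t : ℝ) :
    HasDerivAt capArea (2 * t * (Real.pi / 2 + Real.arctan t) + 2) t := by
  have h := ((((hasDerivAt_pow 2 t).const_add 1).mul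
    ((Real.hasDerivAt_arctan t).const_add (Real.pi / 2))).add (hasDerivAt_id t))
  refine h.congr_deriv ?_
  have : (1 + t ^ 2) ≠ 0 := by positivity
  field_simp
  ring

lemma hasDerivAt_circle_primitive {b u : ℝ} (h1 : -b < u) (h2 : u < b) :
    HasDerivAt (fun u => u * √(b ^ 2 - u ^ 2) + b ^ 2 * Real.arcsin (u / b))
      (2 * √(b ^ 2 - u ^ 2)) u := by
  have hb : 0 < b := by linarith
  have hpos : 0 < b ^ 2 - u ^ 2 := by nlinarith
  have hs : HasDerivAt (fun u => √(b ^ 2 - u ^ 2)) _ u :=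
    ((hasDerivAt_pow 2 u).const_sub (b ^ 2)).sqrt hpos.ne'
  have ha :=
    (Real.hasDerivAt_arcsin (x := u / b) (by rw [ne_eq, div_eq_iff hb.ne']; linarith)
      (by rw [ne_eq, div_eq_iff hb.ne']; linarith)).comp u ((hasDerivAt_id' u).div_const b)
  refine (((hasDerivAt_id' u).mul hs).add (ha.const_mul (b ^ 2))).congr_deriv ?_
  have hsq : √(1 - (u / b) ^ 2) = √(b ^ 2 - u ^ 2) / b := by
    rw [show 1 - (u / b) ^ 2 = (b ^ 2 - u ^ 2) / b ^ 2 by field_simp, Real.sqrt_div hpos.le,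
      Real.sqrt_sq hb.le]
  have hr : 0 < √(b ^ 2 - u ^ 2) := Real.sqrt_pos.2 hpos
  have hrr : √(b ^ 2 - u ^ 2) ^ 2 = b ^ 2 - u ^ 2 := Real.sq_sqrt hpos.le
  simp only [hsq]
  generalize √(b ^ 2 - u ^ 2) = r at *
  field_simp
  push_cast
  nlinarith

lemma integral_cap (t : ℝ) :
    ∫ y in (0)..(t + √(1 + t ^ 2)), 2 * √((√(1 + t ^ 2)) ^ 2 - (y - t) ^ 2) = capArea t := by
  set b := √(1 + t ^ 2) with hb
  have hb0 : 0 < b := by positivity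
  have hb2 : b ^ 2 = 1 + t ^ 2 := Real.sq_sqrt (by positivity)
  have htb : |t| < b := abs_lt_of_sq_lt_sq (by linarith) hb0.le
  have h1 := (abs_lt.1 htb)
  rw [intervalIntegral.integral_comp_sub_right (fun u => 2 * √(b ^ 2 - u ^ 2)) t,
    intervalIntegral.integral_eq_sub_of_hasDerivAt_of_le (by linarith) ?_
      (fun u hu => hasDerivAt_circle_primitive (b := b) (by linarith [hu.1]) (by linarith [hu.2]))
      ((by fun_prop : Continuous fun u => 2 * √(b ^ 2 - u ^ 2)).intervalIntegrable _ _)]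
  · rw [zero_sub, add_sub_cancel_left, div_self hb0.ne', Real.arcsin_one, sub_self, neg_sq,
      show b ^ 2 - t ^ 2 = 1 by linarith, capArea, Real.arctan_eq_arcsin, ← hb, neg_div,
      Real.arcsin_neg, hb2]
    simp
    ring
  · have : Continuous Real.arcsin := Real.continuous_arcsin
    fun_prop

/-- The half disk of `capArea`. -/
def halfDisk (t : ℝ) : Set Pt := {p | 0 < p 1 ∧ p 0 ^ 2 + p 1 ^ 2 - 2 * p 0 ≤ 2 * t * p 1}

lemma volume_halfDisk (t : ℝ) : volume (halfDisk t) = ENNReal.ofReal (capArea t) := by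
  set b := √(1 + t ^ 2) with hb
  have hb0 : 0 < b := by positivity
  have hb2 : b ^ 2 = 1 + t ^ 2 := Real.sq_sqrt (by positivity)
  have htb : |t| < b := abs_lt_of_sq_lt_sq (by linarith) hb0.le
  have h1 := (abs_lt.1 htb)
  set S : Set (ℝ × ℝ) := {z | 0 < z.2 ∧ z.1 ^ 2 + z.2 ^ 2 - 2 * z.1 ≤ 2 * t * z.2} with hS
  have hSm : MeasurableSet S :=
    (measurableSet_lt (f := fun _ : ℝ × ℝ => (0 : ℝ)) (g := fun z => z.2) (by fun_prop)
      (by fun_prop)).inter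
    (measurableSet_le (f := fun z : ℝ × ℝ => z.1 ^ 2 + z.2 ^ 2 - 2 * z.1)
      (g := fun z => 2 * t * z.2) (by fun_prop) (by fun_prop))
  have hmp := (volume_preserving_finTwoArrow ℝ).comp (PiLp.volume_preserving_ofLp (Fin 2))
  have e : halfDisk t = (MeasurableEquiv.finTwoArrow ∘ WithLp.ofLp) ⁻¹' S := by
    ext p; simp [halfDisk, hS, MeasurableEquiv.finTwoArrow]
  rw [e, hmp.measure_preimage hSm.nullMeasurableSet, Measure.volume_eq_prod,
    Measure.prod_apply_symm hSm]
  have hslice : ∀ y : ℝ, volume ((fun x => (x, y)) ⁻¹' S) =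
      (Ioc 0 (t + b)).indicator (fun y => ENNReal.ofReal (2 * √(b ^ 2 - (y - t) ^ 2))) y := by
    intro y
    by_cases hy : y ∈ Ioc 0 (t + b)
    · have hnn : 0 ≤ b ^ 2 - (y - t) ^ 2 := by nlinarith [hy.1, hy.2]
      rw [indicator_of_mem hy, show (fun x => (x, y)) ⁻¹' S =
        Icc (1 - √(b ^ 2 - (y - t) ^ 2)) (1 + √(b ^ 2 - (y - t) ^ 2)) from ?_, Real.volume_Icc]
      · congr 1; ring
      · ext x
        have : |x - 1| ≤ √(b ^ 2 - (y - t) ^ 2) ↔ (x - 1) ^ 2 ≤ b ^ 2 - (y - t) ^ 2 := by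
          rw [Real.le_sqrt (abs_nonneg _) hnn, sq_abs]
        rw [abs_le] at this
        simp only [hS, mem_preimage, mem_ofPred_eq, mem_Icc, hy.1, true_and]
        rw [show (1 - √(b ^ 2 - (y - t) ^ 2) ≤ x ∧ x ≤ 1 + √(b ^ 2 - (y - t) ^ 2)) ↔
          (-√(b ^ 2 - (y - t) ^ 2) ≤ x - 1 ∧ x - 1 ≤ √(b ^ 2 - (y - t) ^ 2)) by
            constructor <;> rintro ⟨_, _⟩ <;> constructor <;> linarith, this, hb2]
        constructor <;> intro h <;> nlinarith
    · rw [indicator_of_notMem hy]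
      convert measure_empty (μ := (volume : Measure ℝ))
      refine eq_empty_of_forall_notMem fun x hx => hy ?_
      have h2 : (x - 1) ^ 2 + (y - t) ^ 2 ≤ b ^ 2 := by have := hx.2; simp only at this; nlinarith
      exact ⟨hx.1, by nlinarith [abs_le_of_sq_le_sq (a := y - t) (b := b) (by nlinarith) hb0.le]⟩
  simp_rw [hslice]
  rw [lintegral_indicator measurableSet_Ioc, ← integral_cap t, ← hb,
    intervalIntegral.integral_of_le (by linarith), ofReal_integral_eq_lintegral_ofReal]
  · exact ((by fun_prop : Continuous fun y => 2 * √(b ^ 2 - (y - t) ^ 2)).integrableOn_Icc).mono_set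
      Ioc_subset_Icc_self
  · exact Eventually.of_forall fun y => by positivity

end

section
open MeasureTheory Filter
open scoped ENNReal Topology

/-- The derivative of `capArea`. -/
def capRate (t : ℝ) : ℝ := 2 * t * (Real.pi / 2 + Real.arctan t) + 2

lemma continuous_capRate : Continuous capRate := by unfold capRate; fun_prop

lemma capArea_nonneg (t : ℝ) : 0 ≤ capArea t := by
  rw [← integral_cap]
  have h1 : |t| ≤ √(1 + t ^ 2) := Real.abs_le_sqrt (by linarith)
  exact intervalIntegral.integral_nonneg (by linarith [(abs_le.1 h1).1]) fun y _ => by positivity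

lemma capArea_mono : Monotone capArea := by
  intro s t hst
  rw [← ENNReal.ofReal_le_ofReal_iff (capArea_nonneg t), ← volume_halfDisk, ← volume_halfDisk]
  refine measure_mono fun p hp => ⟨hp.1, hp.2.trans ?_⟩
  have := hp.1
  nlinarith

lemma capRate_nonneg (t : ℝ) : 0 ≤ capRate t := by
  have := capArea_mono.deriv_nonneg (x := t)
  rwa [(hasDerivAt_capArea t).deriv] at this

lemma continuous_capArea : Continuous capArea := by unfold capArea; fun_prop

/-- The points to the left of `0 v`. -/
def leftOf (v : Pt) : Set Pt := {p | 0 < orient 0 v p}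

lemma measurableSet_leftOf (v : Pt) : MeasurableSet (leftOf v) :=
  measurableSet_lt measurable_const (measurable_orient measurable_const measurable_const
    measurable_id)

lemma measurable_cotAt_right (v : Pt) : Measurable (cotAt 0 v) :=
  measurable_cotAt measurable_const measurable_const measurable_id

lemma norm_sq_eq (v : Pt) : ‖v‖ ^ 2 = v 0 ^ 2 + v 1 ^ 2 := by
  rw [EuclideanSpace.norm_sq_eq]; simp

lemma volume_leftOf_cotAt_le {v : Pt} (hv : v ≠ 0) (t : ℝ) :
    volume (leftOf v ∩ cotAt 0 v ⁻¹' Iic t) = ENNReal.ofReal ((‖v‖ / 2) ^ 2 * capArea t) := by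
  have hn : 0 < ‖v‖ ^ 2 := by positivity
  have hn' := norm_sq_eq v
  set f : Pt →ₗ[ℝ] Pt := Matrix.toLpLin 2 2 !![v 0 / 2, -v 1 / 2; v 1 / 2, v 0 / 2] with hf
  have hdet : LinearMap.det f = (‖v‖ / 2) ^ 2 := by
    rw [hf, Matrix.toLpLin_eq_toLin, LinearMap.det_toLin, Matrix.det_fin_two_of, div_pow, hn']
    ring
  have hf0 : ∀ p, f p 0 = (v 0 * p 0 - v 1 * p 1) / 2 := fun p => by
    simp [hf, Matrix.toLpLin_apply, dotProduct, Fin.sum_univ_two]; ring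
  have hf1 : ∀ p, f p 1 = (v 1 * p 0 + v 0 * p 1) / 2 := fun p => by
    simp [hf, Matrix.toLpLin_apply, dotProduct, Fin.sum_univ_two]; ring
  have ho : ∀ p, orient 0 v (f p) = ‖v‖ ^ 2 / 2 * p 1 := fun p => by
    simp only [orient, hf0, hf1, hn', PiLp.zero_apply]; ring
  have hd : ∀ p, dotAt 0 v (f p) = ‖v‖ ^ 2 / 4 * (p 0 ^ 2 + p 1 ^ 2 - 2 * p 0) := fun p => by
    simp only [dotAt, hf0, hf1, hn', PiLp.zero_apply]; ring
  have hpre : f ⁻¹' (leftOf v ∩ cotAt 0 v ⁻¹' Iic t) = halfDisk t := by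
    ext p
    simp only [leftOf, halfDisk, mem_preimage, mem_inter_iff, mem_ofPred_eq, mem_Iic, cotAt, ho, hd,
      mul_pos_iff_of_pos_left (half_pos hn)]
    refine and_congr_right fun hp => ?_
    rw [div_le_iff₀ (by positivity), show t * (‖v‖ ^ 2 / 2 * p 1) = ‖v‖ ^ 2 / 4 * (2 * t * p 1) by ring,
      mul_le_mul_iff_right₀ (by positivity)]
  have hpos : 0 < (‖v‖ / 2) ^ 2 := by rw [div_pow]; positivity
  have h := Measure.addHaar_preimage_linearMap volume (f := f) (by rw [hdet]; exact hpos.ne')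
    (leftOf v ∩ cotAt 0 v ⁻¹' Iic t)
  rw [hpre, volume_halfDisk, hdet, abs_of_pos (inv_pos.2 hpos)] at h
  rw [ENNReal.ofReal_mul hpos.le, h, ← mul_assoc, ← ENNReal.ofReal_mul hpos.le,
    mul_inv_cancel₀ hpos.ne', ENNReal.ofReal_one, one_mul]

/-- The distribution of the oriented angle under which `0 v` is seen from the left. -/
def viewMeasure (v : Pt) : Measure ℝ := (volume.restrict (leftOf v)).map (cotAt 0 v)

lemma viewMeasure_Iic {v : Pt} (hv : v ≠ 0) (t : ℝ) :
    viewMeasure v (Iic t) = ENNReal.ofReal ((‖v‖ / 2) ^ 2 * capArea t) := by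
  rw [viewMeasure, Measure.map_apply (measurable_cotAt_right v) measurableSet_Iic,
    Measure.restrict_apply (measurable_cotAt_right v measurableSet_Iic), inter_comm,
    volume_leftOf_cotAt_le hv]

lemma viewMeasure_eq {v : Pt} (hv : v ≠ 0) : viewMeasure v =
    volume.withDensity fun t => ENNReal.ofReal ((‖v‖ / 2) ^ 2 * capRate t) := by
  have hIoc : ∀ ⦃a b : ℝ⦄, a < b → viewMeasure v (Ioc a b) =
      ENNReal.ofReal ((‖v‖ / 2) ^ 2 * (capArea b - capArea a)) := by
    intro a b hab
    rw [← Iic_sdiff_Iic, measure_sdiff (Iic_subset_Iic.2 hab.le) measurableSet_Iic.nullMeasurableSet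
      (by rw [viewMeasure_Iic hv]; exact ENNReal.ofReal_ne_top), viewMeasure_Iic hv,
      viewMeasure_Iic hv, ← ENNReal.ofReal_sub _ (by have := capArea_nonneg a; positivity), mul_sub]
  refine Measure.ext_of_Ioc' _ _ (fun a b hab => by rw [hIoc hab]; exact ENNReal.ofReal_ne_top)
    fun a b hab => ?_
  have hc : Continuous fun t => (‖v‖ / 2) ^ 2 * capRate t := continuous_capRate.const_mul _
  rw [hIoc hab, withDensity_apply _ measurableSet_Ioc, ← ofReal_integral_eq_lintegral_ofReal
    (hc.integrableOn_Icc.mono_set Ioc_subset_Icc_self)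
    (Eventually.of_forall fun t => by have := capRate_nonneg t; positivity),
    ← intervalIntegral.integral_of_le hab.le, intervalIntegral.integral_const_mul,
    intervalIntegral.integral_eq_sub_of_hasDerivAt (f' := capRate) (fun t _ => hasDerivAt_capArea t)
      (continuous_capRate.intervalIntegrable _ _)]

lemma viewMeasure_Iio {v : Pt} (hv : v ≠ 0) (t : ℝ) :
    viewMeasure v (Iio t) = ENNReal.ofReal ((‖v‖ / 2) ^ 2 * capArea t) := by
  rw [← viewMeasure_Iic hv t, viewMeasure_eq hv]
  exact measure_congr ((withDensity_absolutelyContinuous _ _).ae_eq Iio_ae_eq_Iic)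

lemma lintegral_leftOf {v : Pt} (hv : v ≠ 0) {g : ℝ → ℝ≥0∞} (hg : Measurable g) :
    ∫⁻ p in leftOf v, g (cotAt 0 v p) =
      ∫⁻ t, ENNReal.ofReal ((‖v‖ / 2) ^ 2 * capRate t) * g t := by
  rw [← lintegral_map hg (measurable_cotAt_right v), ← viewMeasure, viewMeasure_eq hv,
    lintegral_withDensity_eq_lintegral_mul _ _ hg]
  · rfl
  · exact ((continuous_capRate.const_mul _).measurable).ennreal_ofReal

/-- The points to the right of `0 v`. -/
def rightOf (v : Pt) : Set Pt := {p | orient 0 v p < 0}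

lemma measurableSet_rightOf (v : Pt) : MeasurableSet (rightOf v) :=
  measurableSet_lt (measurable_orient measurable_const measurable_const measurable_id)
    measurable_const

lemma orient_zero_sub (v p : Pt) : orient 0 v (v - p) = -orient 0 v p := by
  simp [orient]; ring

lemma cotAt_zero_sub (v p : Pt) : cotAt 0 v (v - p) = -cotAt 0 v p := by
  rw [cotAt, orient_zero_sub, cotAt, div_neg]
  congr 2; simp [dotAt]; ring

lemma lintegral_rightOf (v : Pt) {g : ℝ → ℝ≥0∞} (hg : Measurable g) :
    ∫⁻ p in rightOf v, g (cotAt 0 v p) = ∫⁻ p in leftOf v, g (-cotAt 0 v p) := by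
  have h := Measure.measurePreserving_sub_left (volume : Measure Pt) v
  rw [← h.setLIntegral_comp_preimage (f := fun p => g (cotAt 0 v p)) (measurableSet_rightOf v)
    (hg.comp (measurable_cotAt_right v))]
  simp only [cotAt_zero_sub]
  congr 2
  ext p; simp [rightOf, leftOf, orient_zero_sub]

lemma volume_disksOf_quad {w : Fin 3 → Pt} (hv : w 0 ≠ 0) (hw : quad w ∈ flipSet) :
    volume (disksOf (quad w)) = ENNReal.ofReal ((‖w 0‖ / 2) ^ 2 *
      (capArea (cotAt 0 (w 0) (w 2)) + capArea (-cotAt 0 (w 0) (w 1)))) := by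
  obtain ⟨hx, hy, hxy⟩ := hw
  change 0 < orient 0 (w 0) (w 1) at hx
  change orient 0 (w 0) (w 2) < 0 at hy
  change cotAt 0 (w 0) (w 1) < cotAt 0 (w 0) (w 2) at hxy
  have hD : disksOf (quad w) = {p | dotAt 0 (w 0) p < cotAt 0 (w 0) (w 1) * orient 0 (w 0) p ∨
    dotAt 0 (w 0) p < cotAt 0 (w 0) (w 2) * orient 0 (w 0) p} := rfl
  set v := w 0
  set s := cotAt 0 v (w 1)
  set t := cotAt 0 v (w 2)
  have hline : volume {p | orient 0 v p = 0} = 0 := volume_orient_eq_zero hv.symm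
  have hae : disksOf (quad w) =ᵐ[volume]
      ((leftOf v ∩ cotAt 0 v ⁻¹' Iio t) ∪ (rightOf v ∩ cotAt 0 v ⁻¹' Ioi s) : Set Pt) := by
    rw [Filter.eventuallyEq_set]
    have : ∀ᵐ p, ¬ orient 0 v p = 0 := by rw [ae_iff]; simpa using hline
    filter_upwards [this] with p hp
    rw [hD]
    simp only [leftOf, rightOf, mem_union, mem_inter_iff, mem_ofPred_eq, mem_preimage, mem_Iio,
      mem_Ioi]
    rcases lt_or_gt_of_ne hp with h | h
    · have e1 : dotAt 0 v p < s * orient 0 v p ↔ s < cotAt 0 v p := (lt_div_iff_of_neg h).symm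
      have e2 : dotAt 0 v p < t * orient 0 v p ↔ t < cotAt 0 v p := (lt_div_iff_of_neg h).symm
      rw [e1, e2]
      constructor
      · rintro (h' | h')
        · exact Or.inr ⟨h, h'⟩
        · exact Or.inr ⟨h, hxy.trans h'⟩
      · rintro (⟨h', -⟩ | ⟨-, h'⟩)
        · exact absurd h' h.not_gt
        · exact Or.inl h'
    · have e1 : dotAt 0 v p < s * orient 0 v p ↔ cotAt 0 v p < s := (div_lt_iff₀ h).symm
      have e2 : dotAt 0 v p < t * orient 0 v p ↔ cotAt 0 v p < t := (div_lt_iff₀ h).symm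
      rw [e1, e2]
      constructor
      · rintro (h' | h')
        · exact Or.inl ⟨h, h'.trans hxy⟩
        · exact Or.inl ⟨h, h'⟩
      · rintro (⟨-, h'⟩ | ⟨h', -⟩)
        · exact Or.inr h'
        · exact absurd h' h.not_gt
  have hmL : MeasurableSet (leftOf v ∩ cotAt 0 v ⁻¹' Iio t) :=
    (measurableSet_leftOf v).inter (measurable_cotAt_right v measurableSet_Iio)
  have hL : volume (leftOf v ∩ cotAt 0 v ⁻¹' Iio t) =
      ENNReal.ofReal ((‖v‖ / 2) ^ 2 * capArea t) := by
    rw [← viewMeasure_Iio hv, viewMeasure, Measure.map_apply (measurable_cotAt_right v)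
      measurableSet_Iio, Measure.restrict_apply (measurable_cotAt_right v measurableSet_Iio),
      inter_comm]
  have hR : volume (rightOf v ∩ cotAt 0 v ⁻¹' Ioi s) =
      ENNReal.ofReal ((‖v‖ / 2) ^ 2 * capArea (-s)) := by
    rw [← viewMeasure_Iio hv, viewMeasure, Measure.map_apply (measurable_cotAt_right v)
      measurableSet_Iio, Measure.restrict_apply (measurable_cotAt_right v measurableSet_Iio),
      inter_comm, ← (Measure.measurePreserving_sub_left (volume : Measure Pt) v).measure_preimage
      ((measurable_cotAt_right v measurableSet_Ioi).inter
        (measurableSet_rightOf v)).nullMeasurableSet]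
    congr 1
    ext p
    simp [rightOf, leftOf, orient_zero_sub, cotAt_zero_sub, lt_neg]
  rw [measure_congr hae, measure_union _ ((measurableSet_rightOf v).inter
    (measurable_cotAt_right v measurableSet_Ioi)), hL, hR, ← ENNReal.ofReal_add, mul_add]
  · have := capArea_nonneg t; positivity
  · have := capArea_nonneg (-s); positivity
  · refine Disjoint.mono inter_subset_left inter_subset_left ?_
    exact disjoint_left.2 fun p h1 h2 => lt_asymm (show 0 < orient 0 v p from h1) h2

end

section
open MeasureTheory Filter
open scoped ENNReal Topology

lemma lintegral_fin_three {F : (Fin 3 → Pt) → ℝ≥0∞} (hF : Measurable F) :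
    ∫⁻ w, F w = ∫⁻ v, ∫⁻ x, ∫⁻ y, F ![v, x, y] := by
  have h1 := (volume_preserving_piFinSuccAbove (fun _ : Fin 3 => Pt) 0).symm
  have h2 := (volume_preserving_finTwoArrow Pt).symm
  have hm1 : Measurable fun z : Pt × (Fin 2 → Pt) =>
      F ((MeasurableEquiv.piFinSuccAbove (fun _ : Fin 3 => Pt) 0).symm z) :=
    hF.comp (MeasurableEquiv.measurable _)
  rw [← h1.lintegral_comp hF, Measure.volume_eq_prod, lintegral_prod _ hm1.aemeasurable]
  refine lintegral_congr fun v => ?_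
  have hm2 : Measurable fun z : Fin 2 → Pt =>
      F ((MeasurableEquiv.piFinSuccAbove (fun _ : Fin 3 => Pt) 0).symm (v, z)) :=
    hm1.comp measurable_prodMk_left
  have hm3 : Measurable fun z : Pt × Pt => F ((MeasurableEquiv.piFinSuccAbove
      (fun _ : Fin 3 => Pt) 0).symm (v, MeasurableEquiv.finTwoArrow.symm z)) :=
    hm2.comp (MeasurableEquiv.measurable _)
  rw [← h2.lintegral_comp hm2, Measure.volume_eq_prod, lintegral_prod _ hm3.aemeasurable]
  refine lintegral_congr fun x => lintegral_congr fun y => ?_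
  congr 1
  ext i : 1
  fin_cases i <;> rfl

/-- The density, for the cotangent `-p`, of the third vertices of triangles with a given side of
length `2 a`, damped by the probability that the cap on the other side is empty. -/
def capWeight (a p : ℝ) : ℝ := a ^ 2 * capRate (-p) * Real.exp (-(a ^ 2 * capArea p))

lemma capWeight_nonneg (a p : ℝ) : 0 ≤ capWeight a p := by
  have := capRate_nonneg (-p)
  unfold capWeight; positivity

lemma measurable_capWeight : Measurable fun z : ℝ × ℝ => capWeight z.1 z.2 := by
  have := continuous_capRate
  have := continuous_capArea
  unfold capWeight
  exact Continuous.measurable (by fun_prop)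

/-- The contribution of edges of length `2 a`. -/
def edgeWeight (a : ℝ) : ℝ≥0∞ :=
  ∫⁻ p, ENNReal.ofReal (capWeight a p) * ∫⁻ q in Ioi (-p), ENNReal.ofReal (capWeight a q)

lemma limWeight_vec {v : Pt} (hv : v ≠ 0) (x y : Pt) : limWeight ![v, x, y] =
    (leftOf v).indicator (fun x => (rightOf v).indicator (fun y =>
      {z : ℝ × ℝ | z.1 < z.2}.indicator (fun z => ENNReal.ofReal (Real.exp
        (-((‖v‖ / 2) ^ 2 * (capArea z.2 + capArea (-z.1)))))) (cotAt 0 v x, cotAt 0 v y)) y) x := by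
  by_cases h : quad ![v, x, y] ∈ flipSet
  · have h' := h
    obtain ⟨hx, hy, hxy⟩ := h'
    rw [limWeight, indicator_of_mem (s := quad ⁻¹' flipSet) (by exact h),
      volume_disksOf_quad (by exact hv) h, indicator_of_mem (by exact hx),
      indicator_of_mem (by exact hy), indicator_of_mem (by exact hxy)]
    rw [ENNReal.toReal_ofReal]
    · rfl
    · exact mul_nonneg (sq_nonneg _) (add_nonneg (capArea_nonneg _) (capArea_nonneg _))
  · rw [limWeight, indicator_of_notMem (s := quad ⁻¹' flipSet) (by exact h)]
    simp only [indicator]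
    split_ifs with h1 h2 h3
    · exact absurd ⟨h1, h2, h3⟩ h
    all_goals rfl

lemma lintegral_limWeight_vec {v : Pt} (hv : v ≠ 0) :
    ∫⁻ x, ∫⁻ y, limWeight ![v, x, y] = edgeWeight (‖v‖ / 2) := by
  set a := ‖v‖ / 2 with ha
  set G : ℝ × ℝ → ℝ≥0∞ := {z : ℝ × ℝ | z.1 < z.2}.indicator (fun z => ENNReal.ofReal (Real.exp
        (-(a ^ 2 * (capArea z.2 + capArea (-z.1)))))) with hG
  have hGm : Measurable G := by
    refine Measurable.indicator ?_ (measurableSet_lt measurable_fst measurable_snd)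
    have := continuous_capArea
    exact (Continuous.measurable (by fun_prop)).ennreal_ofReal
  have hrm : Measurable fun t => ENNReal.ofReal (a ^ 2 * capRate t) :=
    ((continuous_capRate.const_mul _).measurable).ennreal_ofReal
  have h1 : ∀ x, ∫⁻ y, limWeight ![v, x, y] = (leftOf v).indicator (fun x =>
      ∫⁻ t, ENNReal.ofReal (a ^ 2 * capRate t) * G (cotAt 0 v x, -t)) x := by
    intro x
    simp_rw [limWeight_vec hv x]
    by_cases hx : x ∈ leftOf v
    · simp only [indicator_of_mem hx]
      have hGx : Measurable fun t => G (cotAt 0 v x, t) := hGm.comp measurable_prodMk_left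
      rw [lintegral_indicator (measurableSet_rightOf v),
        lintegral_rightOf v (g := fun t => G (cotAt 0 v x, t)) hGx,
        lintegral_leftOf hv (g := fun t => G (cotAt 0 v x, -t)) (hGx.comp measurable_neg)]
    · simp [indicator_of_notMem hx]
  have h2 : Measurable fun s => ∫⁻ t, ENNReal.ofReal (a ^ 2 * capRate t) * G (s, -t) := by
    refine Measurable.lintegral_prod_right' (f := fun z : ℝ × ℝ =>
      ENNReal.ofReal (a ^ 2 * capRate z.2) * G (z.1, -z.2)) ?_
    exact (hrm.comp measurable_snd).mul (hGm.comp (by fun_prop))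
  simp_rw [h1]
  rw [lintegral_indicator (measurableSet_leftOf v), lintegral_leftOf hv h2, ← ha,
    ← lintegral_neg_eq_self, edgeWeight]
  refine lintegral_congr fun p => ?_
  rw [← lintegral_neg_eq_self, ← lintegral_indicator measurableSet_Ioi,
    ← lintegral_const_mul, ← lintegral_const_mul]
  · refine lintegral_congr fun q => ?_
    by_cases hq : -p < q
    · rw [hG, indicator_of_mem (by simpa using hq), indicator_of_mem (by exact hq),
        ← ENNReal.ofReal_mul, ← ENNReal.ofReal_mul, ← ENNReal.ofReal_mul]
      · congr 1
        simp only [capWeight, neg_neg]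
        rw [mul_add, neg_add, Real.exp_add]
        ring
      · exact capWeight_nonneg _ _
      · exact mul_nonneg (sq_nonneg _) (capRate_nonneg _)
      · exact mul_nonneg (sq_nonneg _) (capRate_nonneg _)
    · rw [hG, indicator_of_notMem (by simpa using hq), indicator_of_notMem (by exact hq)]
      simp
  · exact (measurable_capWeight.comp measurable_prodMk_left).ennreal_ofReal.indicator
      measurableSet_Ioi
  · exact (hrm.comp measurable_neg).mul (hGm.comp (by fun_prop))

lemma measurable_edgeWeight : Measurable edgeWeight := by
  have h : Measurable fun z : (ℝ × ℝ) × ℝ => ({z : (ℝ × ℝ) × ℝ | -z.1.2 < z.2}.indicator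
      (fun z => ENNReal.ofReal (capWeight z.1.1 z.2)) z) := by
    refine Measurable.indicator ?_ (measurableSet_lt (by fun_prop) (by fun_prop))
    exact (measurable_capWeight.comp (by fun_prop :
      Measurable fun z : (ℝ × ℝ) × ℝ => (z.1.1, z.2))).ennreal_ofReal
  have h2 := h.lintegral_prod_right' (ν := volume)
  have h3 := (measurable_capWeight.ennreal_ofReal.mul h2).lintegral_prod_right' (ν := volume)
  convert h3 using 2 with x
  rw [edgeWeight]
  refine lintegral_congr fun y => ?_
  rw [← lintegral_indicator measurableSet_Ioi]
  rfl

lemma measure_eq_of_Iic {μ ν : Measure ℝ} (hμ : ∀ t, μ (Iic t) ≠ ∞)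
    (h : ∀ t, μ (Iic t) = ν (Iic t)) : μ = ν := by
  have key : ∀ ρ : Measure ℝ, (∀ t, ρ (Iic t) ≠ ∞) → ∀ a b, a < b →
      ρ (Ioc a b) = ρ (Iic b) - ρ (Iic a) := by
    intro ρ hρ a b hab
    rw [← Iic_sdiff_Iic, measure_sdiff (Iic_subset_Iic.2 hab.le) measurableSet_Iic.nullMeasurableSet
      (hρ a)]
  refine Measure.ext_of_Ioc' _ _ (fun a b _ => ne_top_of_le_ne_top (hμ b)
    (measure_mono Ioc_subset_Iic_self)) fun a b hab => ?_
  rw [key μ hμ a b hab, key ν (fun t => h t ▸ hμ t) a b hab, h, h]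

lemma lintegral_half_norm {f : ℝ → ℝ≥0∞} (hf : Measurable f) :
    ∫⁻ v : Pt, f (‖v‖ / 2) = ∫⁻ a in Ioi 0, ENNReal.ofReal (8 * Real.pi * a) * f a := by
  have hd : Measurable fun a : ℝ => ENNReal.ofReal (8 * Real.pi * a) := by fun_prop
  have hn : Measurable fun v : Pt => ‖v‖ / 2 := by fun_prop
  have hμ : ∀ t, (volume.map fun v : Pt => ‖v‖ / 2) (Iic t) =
      ENNReal.ofReal (2 * t) ^ 2 * ENNReal.ofReal Real.pi := by
    intro t
    rw [Measure.map_apply hn measurableSet_Iic, show (fun v : Pt => ‖v‖ / 2) ⁻¹' Iic t =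
      Metric.closedBall 0 (2 * t) by ext; simp [div_le_iff₀, mul_comm],
      EuclideanSpace.volume_closedBall_fin_two]
  have key : (volume.map fun v : Pt => ‖v‖ / 2) =
      (volume.restrict (Ioi 0)).withDensity fun a => ENNReal.ofReal (8 * Real.pi * a) := by
    refine measure_eq_of_Iic (fun t => by rw [hμ]; finiteness) fun t => ?_
    rw [hμ, withDensity_apply _ measurableSet_Iic, Measure.restrict_restrict measurableSet_Iic,
      Iic_inter_Ioi]
    rcases le_total t 0 with ht | ht
    · rw [Ioc_eq_empty (by linarith), ENNReal.ofReal_of_nonpos (by linarith)]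
      simp
    · rw [← ofReal_integral_eq_lintegral_ofReal, ← intervalIntegral.integral_of_le ht,
        intervalIntegral.integral_const_mul, integral_id, ← ENNReal.ofReal_pow (by linarith),
        ← ENNReal.ofReal_mul (by positivity)]
      · congr 1; ring
      · exact (by fun_prop : Continuous fun a : ℝ => 8 * Real.pi * a).integrableOn_Icc.mono_set
          Ioc_subset_Icc_self
      · refine (ae_restrict_iff' measurableSet_Ioc).2 (Eventually.of_forall fun a ha => ?_)
        have := ha.1
        simp only [Pi.zero_apply]; positivity
  rw [← lintegral_map hf hn, key, lintegral_withDensity_eq_lintegral_mul _ hd hf]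
  rfl

lemma lintegral_limWeight : ∫⁻ w, limWeight w =
    ∫⁻ a in Ioi 0, ENNReal.ofReal (8 * Real.pi * a) * edgeWeight a := by
  rw [lintegral_fin_three measurable_limWeight, ← lintegral_half_norm measurable_edgeWeight]
  refine lintegral_congr_ae ?_
  have : ∀ᵐ v : Pt, v ≠ 0 := by simp [ae_iff]
  filter_upwards [this] with v hv
  exact lintegral_limWeight_vec hv

end

section
open MeasureTheory Filter
open scoped ENNReal Topology

lemma setLIntegral_neg {m : ℝ → ℝ≥0∞} (s : Set ℝ) (hs : MeasurableSet s) :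
    ∫⁻ t in s, m (-t) = ∫⁻ t in -s, m t := by
  rw [← lintegral_indicator hs, ← lintegral_indicator hs.neg, ← lintegral_neg_eq_self]
  refine lintegral_congr fun t => ?_
  by_cases ht : -t ∈ s
  · rw [indicator_of_mem ht, indicator_of_mem (by simpa using ht), neg_neg]
  · rw [indicator_of_notMem ht, indicator_of_notMem (by simpa using ht)]

lemma lintegral_Ioi_swap {f g : ℝ → ℝ≥0∞} (hf : Measurable f) (hg : Measurable g) :
    ∫⁻ p in Ioi (0 : ℝ), f p * ∫⁻ t in Ioo 0 p, g t =
      ∫⁻ t in Ioi (0 : ℝ), g t * ∫⁻ p in Ioi t, f p := by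
  have h1 : ∀ p, f p * ∫⁻ t in Ioo 0 p, g t =
      ∫⁻ t in Ioi (0 : ℝ), {z : ℝ × ℝ | z.2 < z.1}.indicator (fun z => f z.1 * g z.2) (p, t) := by
    intro p
    rw [← lintegral_const_mul _ hg, show Ioo 0 p = Iio p ∩ Ioi 0 by
      rw [inter_comm, Ioi_inter_Iio],
      ← Measure.restrict_restrict measurableSet_Iio, ← lintegral_indicator measurableSet_Iio]
    rfl
  have h2 : ∀ t ∈ Ioi (0 : ℝ), g t * ∫⁻ p in Ioi t, f p =
      ∫⁻ p in Ioi (0 : ℝ), {z : ℝ × ℝ | z.2 < z.1}.indicator (fun z => f z.1 * g z.2) (p, t) := by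
    intro t ht
    rw [← lintegral_const_mul _ hf, show Ioi t = Ioi t ∩ Ioi 0 by
      exact (inter_eq_left.2 (Ioi_subset_Ioi (le_of_lt ht))).symm,
      ← Measure.restrict_restrict measurableSet_Ioi, ← lintegral_indicator measurableSet_Ioi]
    refine lintegral_congr fun p => ?_
    simp only [indicator, mem_Ioi, mem_ofPred_eq, mul_comm]
  simp_rw [h1]
  rw [setLIntegral_congr_fun measurableSet_Ioi h2]
  refine lintegral_lintegral_swap (Measurable.aemeasurable ?_)
  exact ((hf.comp measurable_fst).mul (hg.comp measurable_snd)).indicator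
    (measurableSet_lt measurable_snd measurable_fst)

lemma lintegral_mul_lintegral_Ioi_neg {m : ℝ → ℝ≥0∞} (hm : Measurable m) :
    ∫⁻ p, m p * ∫⁻ q in Ioi (-p), m q =
      (∫⁻ p in Ioi (0 : ℝ), m p) * (∫⁻ p in Ioi (0 : ℝ), m p) +
        2 * ∫⁻ t in Ioi (0 : ℝ), m (-t) * ∫⁻ p in Ioi t, m p := by
  have hpos : ∫⁻ p in Ioi (0 : ℝ), m p * ∫⁻ q in Ioi (-p), m q =
      (∫⁻ p in Ioi (0 : ℝ), m p) * (∫⁻ p in Ioi (0 : ℝ), m p) +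
        ∫⁻ t in Ioi (0 : ℝ), m (-t) * ∫⁻ p in Ioi t, m p := by
    rw [← lintegral_Ioi_swap (g := fun t => m (-t)) hm (hm.comp measurable_neg), ← lintegral_mul_const _ hm,
      ← lintegral_add_left (hm.mul_const _)]
    refine setLIntegral_congr_fun measurableSet_Ioi fun p hp => ?_
    have hp : 0 < p := hp
    rw [setLIntegral_neg _ measurableSet_Ioo, ← mul_add,
      ← Ioc_union_Ioi_eq_Ioi (by linarith : -p ≤ 0),
      lintegral_union measurableSet_Ioi (Ioc_disjoint_Ioi le_rfl), add_comm,
      show -Ioo 0 p = Ioo (-p) 0 by simp, restrict_Ioo_eq_restrict_Ioc]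
  have hneg : ∫⁻ p in Iic (0 : ℝ), m p * ∫⁻ q in Ioi (-p), m q =
      ∫⁻ t in Ioi (0 : ℝ), m (-t) * ∫⁻ p in Ioi t, m p := by
    have := setLIntegral_neg (m := fun p => m p * ∫⁻ q in Ioi (-p), m q) (Ioi 0) measurableSet_Ioi
    simp only [neg_neg] at this
    rw [this, ← restrict_Iio_eq_restrict_Iic]
    simp
  rw [← setLIntegral_univ, ← Iic_union_Ioi (a := (0 : ℝ)),
    lintegral_union measurableSet_Ioi (Iic_disjoint_Ioi le_rfl), hpos, hneg]
  ring

/-- `capWeight a` on positive cotangents, in terms of the circumradius `b`. -/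
def capWeightPos (a b : ℝ) : ℝ :=
  (2 * a * b / Real.sqrt (b ^ 2 - a ^ 2) - 2 * b * Real.arcsin (a / b)) *
    Real.exp (-Real.pi * b ^ 2 + b ^ 2 * Real.arcsin (a / b) - a * Real.sqrt (b ^ 2 - a ^ 2))

/-- `capWeight a` on negative cotangents, in terms of the circumradius `c`. -/
def capWeightNeg (a c : ℝ) : ℝ :=
  (2 * Real.pi * c - 2 * c * Real.arcsin (a / c) + 2 * a * c / Real.sqrt (c ^ 2 - a ^ 2)) *
    Real.exp (-(c ^ 2 * Real.arcsin (a / c)) + a * Real.sqrt (c ^ 2 - a ^ 2))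

/-- The cotangent of half the angle subtended by a chord of half-length `a` in a circle of
radius `b`. -/
def radiusCot (a b : ℝ) : ℝ := Real.sqrt (b ^ 2 - a ^ 2) / a

section
variable {a b c : ℝ}

lemma sq_sub_sq_pos_of_lt (ha : 0 < a) (hb : a < b) : 0 < b ^ 2 - a ^ 2 := by nlinarith

lemma arctan_radiusCot (ha : 0 < a) (hb : a < b) :
    Real.arctan (radiusCot a b) = Real.pi / 2 - Real.arcsin (a / b) := by
  have hb0 : 0 < b := ha.trans hb
  have hs := Real.sqrt_pos.2 (sq_sub_sq_pos_of_lt ha hb)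
  have h1 : Real.arcsin (a / b) = Real.arctan (radiusCot a b)⁻¹ := by
    rw [Real.arctan_eq_arcsin, radiusCot]
    congr 1
    have : 1 + ((Real.sqrt (b ^ 2 - a ^ 2) / a)⁻¹) ^ 2 = (b / Real.sqrt (b ^ 2 - a ^ 2)) ^ 2 := by
      field_simp
      rw [Real.sq_sqrt (sq_sub_sq_pos_of_lt ha hb).le]
      ring
    rw [this, Real.sqrt_sq (by positivity)]
    field_simp
  rw [h1, Real.arctan_inv_of_pos (by unfold radiusCot; positivity)]
  ring

lemma hasDerivAt_radiusCot (ha : 0 < a) (hb : a < b) :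
    HasDerivAt (radiusCot a) (b / (a * Real.sqrt (b ^ 2 - a ^ 2))) b := by
  have h := (((hasDerivAt_pow 2 b).sub_const (a ^ 2)).sqrt
    (sq_sub_sq_pos_of_lt ha hb).ne').div_const a
  refine h.congr_deriv ?_
  simp only [Nat.cast_ofNat]
  have hs := Real.sqrt_pos.2 (sq_sub_sq_pos_of_lt ha hb)
  field_simp
  ring

lemma radiusCot_lt (ha : 0 < a) (hb : a ≤ b) (hc : b < c) : radiusCot a b < radiusCot a c := by
  have h1 : a ^ 2 ≤ b ^ 2 := by gcongr
  have h2 : b ^ 2 < c ^ 2 := by gcongr; linarith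
  exact div_lt_div_of_pos_right (Real.sqrt_lt_sqrt (by linarith) (by linarith)) ha

lemma radiusCot_self : radiusCot a a = 0 := by simp [radiusCot]

lemma image_radiusCot_Ioi (ha : 0 < a) (hb : a ≤ b) :
    radiusCot a '' Ioi b = Ioi (radiusCot a b) := by
  ext y
  constructor
  · rintro ⟨c, hc, rfl⟩
    exact radiusCot_lt ha hb hc
  · intro hy
    have hy : radiusCot a b < y := hy
    have hy0 : 0 ≤ radiusCot a b := by unfold radiusCot; positivity
    have hab : a ^ 2 ≤ b ^ 2 := by nlinarith
    refine ⟨Real.sqrt (a ^ 2 * y ^ 2 + a ^ 2), ?_, ?_⟩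
    · refine Real.lt_sqrt_of_sq_lt ?_
      have h1 : (a * radiusCot a b) ^ 2 = b ^ 2 - a ^ 2 := by
        rw [radiusCot, mul_div_cancel₀ _ ha.ne', Real.sq_sqrt (by linarith)]
      have h2 : (a * radiusCot a b) ^ 2 < (a * y) ^ 2 := by gcongr
      nlinarith
    · have : 0 < y := hy0.trans_lt hy
      rw [radiusCot, Real.sq_sqrt (by positivity), add_sub_cancel_right, ← mul_pow,
        Real.sqrt_sq (by positivity)]
      field_simp

lemma sq_mul_one_add_radiusCot_sq (ha : 0 < a) (hb : a < b) :
    a ^ 2 * (1 + radiusCot a b ^ 2) = b ^ 2 := by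
  rw [radiusCot, div_pow, Real.sq_sqrt (sq_sub_sq_pos_of_lt ha hb).le]
  field_simp
  ring

lemma sq_mul_radiusCot (ha : 0 < a) : a ^ 2 * radiusCot a b = a * Real.sqrt (b ^ 2 - a ^ 2) := by
  rw [radiusCot]; field_simp

lemma deriv_mul_capWeight (ha : 0 < a) (hb : a < b) :
    b / (a * Real.sqrt (b ^ 2 - a ^ 2)) * capWeight a (radiusCot a b) = capWeightPos a b := by
  have hs := Real.sqrt_pos.2 (sq_sub_sq_pos_of_lt ha hb)
  have hA : -(a ^ 2 * capArea (radiusCot a b)) = -Real.pi * b ^ 2 + b ^ 2 * Real.arcsin (a / b) -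
      a * Real.sqrt (b ^ 2 - a ^ 2) := by
    rw [capArea, arctan_radiusCot ha hb, mul_add, ← mul_assoc, sq_mul_one_add_radiusCot_sq ha hb,
      sq_mul_radiusCot ha]
    ring
  rw [capWeight, hA, capWeightPos, ← mul_assoc]
  congr 1
  rw [capRate, Real.arctan_neg, arctan_radiusCot ha hb, radiusCot]
  field_simp
  ring

lemma deriv_mul_capWeight_neg (ha : 0 < a) (hb : a < b) :
    b / (a * Real.sqrt (b ^ 2 - a ^ 2)) * capWeight a (-radiusCot a b) = capWeightNeg a b := by
  have hs := Real.sqrt_pos.2 (sq_sub_sq_pos_of_lt ha hb)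
  have hA : -(a ^ 2 * capArea (-radiusCot a b)) = -(b ^ 2 * Real.arcsin (a / b)) +
      a * Real.sqrt (b ^ 2 - a ^ 2) := by
    rw [capArea, Real.arctan_neg, arctan_radiusCot ha hb, neg_sq, mul_add, ← mul_assoc,
      sq_mul_one_add_radiusCot_sq ha hb, mul_neg, sq_mul_radiusCot ha]
    ring
  rw [capWeight, hA, capWeightNeg, ← mul_assoc]
  congr 1
  rw [neg_neg, capRate, arctan_radiusCot ha hb, radiusCot]
  field_simp
  ring

lemma lintegral_Ioi_radiusCot (ha : 0 < a) (hb : a ≤ b) (f : ℝ → ℝ≥0∞) :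
    ∫⁻ p in Ioi (radiusCot a b), f p =
      ∫⁻ c in Ioi b, ENNReal.ofReal (c / (a * Real.sqrt (c ^ 2 - a ^ 2))) * f (radiusCot a c) := by
  have hinj : InjOn (radiusCot a) (Ioi b) := by
    refine StrictMonoOn.injOn fun x hx y _ hxy => radiusCot_lt ha (hb.trans (le_of_lt hx)) hxy
  rw [← image_radiusCot_Ioi ha hb, lintegral_image_eq_lintegral_abs_deriv_mul measurableSet_Ioi
    (fun c hc => (hasDerivAt_radiusCot ha (hb.trans_lt hc)).hasDerivWithinAt) hinj]
  refine setLIntegral_congr_fun measurableSet_Ioi fun c hc => ?_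
  have hc : b < c := hc
  have : 0 < c := by linarith
  rw [abs_of_nonneg (by positivity)]

lemma radiusCot_deriv_nonneg (ha : 0 < a) (hb : a < b) :
    0 ≤ b / (a * Real.sqrt (b ^ 2 - a ^ 2)) := by
  have := ha.trans hb
  positivity

lemma lintegral_capWeight_Ioi (ha : 0 < a) (hb : a ≤ b) :
    ∫⁻ p in Ioi (radiusCot a b), ENNReal.ofReal (capWeight a p) =
      ∫⁻ c in Ioi b, ENNReal.ofReal (capWeightPos a c) := by
  rw [lintegral_Ioi_radiusCot ha hb]
  refine setLIntegral_congr_fun measurableSet_Ioi fun c hc => ?_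
  rw [← ENNReal.ofReal_mul (radiusCot_deriv_nonneg ha (hb.trans_lt hc)),
    deriv_mul_capWeight ha (hb.trans_lt hc)]

lemma edgeWeight_eq (ha : 0 < a) : edgeWeight a =
    (∫⁻ c in Ioi a, ENNReal.ofReal (capWeightPos a c)) *
      (∫⁻ b in Ioi a, ENNReal.ofReal (capWeightPos a b)) +
    2 * ∫⁻ c in Ioi a, ENNReal.ofReal (capWeightNeg a c) *
      ∫⁻ b in Ioi c, ENNReal.ofReal (capWeightPos a b) := by
  have hm : Measurable fun p => ENNReal.ofReal (capWeight a p) :=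
    (measurable_capWeight.comp measurable_prodMk_left).ennreal_ofReal
  rw [edgeWeight, lintegral_mul_lintegral_Ioi_neg hm, ← radiusCot_self (a := a),
    lintegral_capWeight_Ioi ha le_rfl, lintegral_Ioi_radiusCot ha le_rfl]
  congr 2
  refine setLIntegral_congr_fun measurableSet_Ioi fun c hc => ?_
  have hc : a < c := hc
  rw [lintegral_capWeight_Ioi ha hc.le, ← mul_assoc,
    ← ENNReal.ofReal_mul (radiusCot_deriv_nonneg ha hc), deriv_mul_capWeight_neg ha hc]

lemma capWeightPos_nonneg (ha : 0 < a) (hb : a < b) : 0 ≤ capWeightPos a b := by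
  rw [← deriv_mul_capWeight ha hb]
  exact mul_nonneg (radiusCot_deriv_nonneg ha hb) (capWeight_nonneg _ _)

lemma capWeightNeg_nonneg (ha : 0 < a) (hb : a < b) : 0 ≤ capWeightNeg a b := by
  rw [← deriv_mul_capWeight_neg ha hb]
  exact mul_nonneg (radiusCot_deriv_nonneg ha hb) (capWeight_nonneg _ _)

end

lemma measurable_capWeightPos : Measurable fun z : ℝ × ℝ => capWeightPos z.1 z.2 := by
  unfold capWeightPos
  fun_prop

lemma measurable_capWeightNeg : Measurable fun z : ℝ × ℝ => capWeightNeg z.1 z.2 := by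
  unfold capWeightNeg
  fun_prop

end

section
open MeasureTheory Filter
open scoped ENNReal Topology

/-- The mass of `capWeightPos a` on radii larger than `c`. -/
def posTail (a c : ℝ) : ℝ≥0∞ := ∫⁻ b in Ioi c, ENNReal.ofReal (capWeightPos a b)

/-- The contribution to `edgeWeight a` of pairs of cotangents of opposite signs. -/
def mixedWeight (a : ℝ) : ℝ≥0∞ :=
  ∫⁻ c in Ioi a, ENNReal.ofReal (capWeightNeg a c) * posTail a c

lemma measurable_setLIntegral_Ioi {α : Type*} [MeasurableSpace α] {f : α × ℝ → ℝ≥0∞}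
    {g : α → ℝ} (hf : Measurable f) (hg : Measurable g) :
    Measurable fun x => ∫⁻ t in Ioi (g x), f (x, t) := by
  have h : Measurable ({z : α × ℝ | g z.1 < z.2}.indicator f) :=
    hf.indicator (measurableSet_lt (hg.comp measurable_fst) measurable_snd)
  convert h.lintegral_prod_right' (ν := volume) using 2 with x
  rw [← lintegral_indicator measurableSet_Ioi]
  rfl

lemma measurable_posTail : Measurable fun z : ℝ × ℝ => posTail z.1 z.2 :=
  measurable_setLIntegral_Ioi (f := fun z : (ℝ × ℝ) × ℝ => ENNReal.ofReal (capWeightPos z.1.1 z.2))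
    (measurable_capWeightPos.comp (by fun_prop :
      Measurable fun z : (ℝ × ℝ) × ℝ => (z.1.1, z.2))).ennreal_ofReal measurable_snd

lemma measurable_posTail_self : Measurable fun a => posTail a a :=
  measurable_posTail.comp (by fun_prop : Measurable fun a : ℝ => (a, a))

lemma measurable_mixedWeight : Measurable mixedWeight :=
  measurable_setLIntegral_Ioi (measurable_capWeightNeg.ennreal_ofReal.mul measurable_posTail)
    measurable_id

lemma lintegral_limWeight_eq_add : ∫⁻ w, limWeight w =
    (∫⁻ a in Ioi 0, ENNReal.ofReal (8 * Real.pi * a) * (posTail a a * posTail a a)) +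
      2 * ∫⁻ a in Ioi 0, ENNReal.ofReal (8 * Real.pi * a) * mixedWeight a := by
  have := measurable_posTail_self
  have := measurable_mixedWeight
  rw [lintegral_limWeight, ← lintegral_const_mul _ (by fun_prop),
    ← lintegral_add_left (by fun_prop)]
  refine setLIntegral_congr_fun measurableSet_Ioi fun a ha => ?_
  simp only [edgeWeight_eq ha, posTail, mixedWeight]
  ring

lemma integral_capWeightPos {a c : ℝ} (ha : 0 < a) (hc : a ≤ c) :
    ∫ b in Ioi c, capWeightPos a b = (posTail a c).toReal :=
  integral_eq_lintegral_of_nonneg_ae ((ae_restrict_iff' measurableSet_Ioi).2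
    (Eventually.of_forall fun _ hb => capWeightPos_nonneg ha (hc.trans_lt hb)))
    (measurable_capWeightPos.comp measurable_prodMk_left).aestronglyMeasurable

lemma integral_capWeightNeg_mul {a : ℝ} (ha : 0 < a) (h : posTail a a ≠ ∞) :
    ∫ c in Ioi a, capWeightNeg a c * (posTail a c).toReal = (mixedWeight a).toReal := by
  rw [mixedWeight, ← integral_toReal]
  · refine setIntegral_congr_fun measurableSet_Ioi fun c hc => ?_
    simp only [ENNReal.toReal_mul, ENNReal.toReal_ofReal (capWeightNeg_nonneg ha hc)]
  · exact ((measurable_capWeightNeg.ennreal_ofReal.mul measurable_posTail).comp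
      measurable_prodMk_left).aemeasurable
  · refine (ae_restrict_iff' measurableSet_Ioi).2 (Eventually.of_forall fun c hc => ?_)
    refine ENNReal.mul_lt_top ENNReal.ofReal_lt_top (lt_of_le_of_lt ?_ h.lt_top)
    exact lintegral_mono_set (Ioi_subset_Ioi (le_of_lt hc))

lemma integral_mul_toReal {F : ℝ → ℝ≥0∞} (hF : Measurable F)
    (h : ∫⁻ a in Ioi 0, ENNReal.ofReal (8 * Real.pi * a) * F a ≠ ∞) :
    ∫ a in Ioi (0 : ℝ), 8 * Real.pi * a * (F a).toReal =
      (∫⁻ a in Ioi 0, ENNReal.ofReal (8 * Real.pi * a) * F a).toReal := by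
  have hm : Measurable fun a => ENNReal.ofReal (8 * Real.pi * a) * F a :=
    (by fun_prop : Measurable fun a : ℝ => ENNReal.ofReal (8 * Real.pi * a)).mul hF
  rw [← integral_toReal hm.aemeasurable (ae_lt_top hm h)]
  refine setIntegral_congr_fun measurableSet_Ioi fun a ha => ?_
  have ha : 0 < a := ha
  simp only [ENNReal.toReal_mul, ENNReal.toReal_ofReal (by positivity : 0 ≤ 8 * Real.pi * a)]

lemma c1_eq_integral : c1 = ∫ a in Ioi (0 : ℝ), 8 * Real.pi * a *
    (posTail a a * posTail a a).toReal := by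
  refine setIntegral_congr_fun measurableSet_Ioi fun a ha => ?_
  simp only [ENNReal.toReal_mul, ← integral_capWeightPos ha le_rfl]
  rw [← integral_mul_const, ← integral_const_mul]
  refine integral_congr_ae (Eventually.of_forall fun c => ?_)
  simp only
  rw [← integral_const_mul, ← integral_const_mul]
  refine integral_congr_ae (Eventually.of_forall fun b => ?_)
  simp only [capWeightPos]
  rw [show -Real.pi * b ^ 2 + b ^ 2 * Real.arcsin (a / b) - a * Real.sqrt (b ^ 2 - a ^ 2) -
    Real.pi * c ^ 2 + c ^ 2 * Real.arcsin (a / c) - a * Real.sqrt (c ^ 2 - a ^ 2) =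
    (-Real.pi * b ^ 2 + b ^ 2 * Real.arcsin (a / b) - a * Real.sqrt (b ^ 2 - a ^ 2)) +
    (-Real.pi * c ^ 2 + c ^ 2 * Real.arcsin (a / c) - a * Real.sqrt (c ^ 2 - a ^ 2)) by ring,
    Real.exp_add]
  ring

lemma c2_eq_integral (h : ∀ᵐ a ∂(volume.restrict (Ioi (0 : ℝ))), posTail a a ≠ ∞) :
    c2 = ∫ a in Ioi (0 : ℝ), 8 * Real.pi * a * (mixedWeight a).toReal := by
  refine integral_congr_ae ?_
  filter_upwards [h, ae_restrict_mem measurableSet_Ioi] with a hfin ha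
  rw [← integral_capWeightNeg_mul ha hfin, ← integral_const_mul]
  refine setIntegral_congr_fun measurableSet_Ioi fun c hc => ?_
  simp only [← integral_capWeightPos ha (le_of_lt hc)]
  rw [← integral_const_mul, ← integral_const_mul]
  refine integral_congr_ae (Eventually.of_forall fun b => ?_)
  simp only [capWeightPos, capWeightNeg]
  rw [show -Real.pi * b ^ 2 + b ^ 2 * Real.arcsin (a / b) - a * Real.sqrt (b ^ 2 - a ^ 2) -
    c ^ 2 * Real.arcsin (a / c) + a * Real.sqrt (c ^ 2 - a ^ 2) =
    (-Real.pi * b ^ 2 + b ^ 2 * Real.arcsin (a / b) - a * Real.sqrt (b ^ 2 - a ^ 2)) +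
    (-(c ^ 2 * Real.arcsin (a / c)) + a * Real.sqrt (c ^ 2 - a ^ 2)) by ring,
    Real.exp_add]
  ring

lemma toReal_lintegral_limWeight : (∫⁻ w, limWeight w).toReal = c1 + 2 * c2 := by
  have hfin := lintegral_limWeight_ne_top
  rw [lintegral_limWeight_eq_add] at hfin ⊢
  obtain ⟨h1, h2⟩ := ENNReal.add_ne_top.1 hfin
  have h2 : ∫⁻ a in Ioi 0, ENNReal.ofReal (8 * Real.pi * a) * mixedWeight a ≠ ∞ := fun h => by
    rw [h] at h2
    exact h2 (ENNReal.mul_top two_ne_zero)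
  have hmm : Measurable fun a => posTail a a * posTail a a :=
    measurable_posTail_self.mul measurable_posTail_self
  have hae : ∀ᵐ a ∂(volume.restrict (Ioi (0 : ℝ))), posTail a a ≠ ∞ := by
    filter_upwards [ae_lt_top (by fun_prop) h1, ae_restrict_mem measurableSet_Ioi]
      with a ha ha0 htop
    have ha0 : 0 < a := ha0
    rw [htop, ENNReal.top_mul_top, ENNReal.mul_top] at ha
    · exact lt_irrefl _ ha
    · exact (ENNReal.ofReal_pos.2 (by positivity)).ne'
  rw [ENNReal.toReal_add h1 (ENNReal.mul_ne_top (by simp) h2), ENNReal.toReal_mul,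
    ← integral_mul_toReal hmm h1, ← integral_mul_toReal measurable_mixedWeight h2,
    c1_eq_integral, c2_eq_integral hae]
  simp

end

open MeasureTheory Filter in
/-- Corollary 4.2: for `n` independent uniform points in the unit square, the expected
number `E[U₁]` of useful order-1 non-Delaunay edges satisfies
`E[U₁] / n → (c₁ + 2c₂)/2 ≈ 0.525785`. -/
theorem expected_useful_one_edges :
    Tendsto
      (fun n : ℕ =>
        (∫ x : Fin n → Pt, ((usefulNotDel (Set.range x)).ncard : ℝ) ∂(conf n)) / n)
      atTop (nhds ((c1 + 2 * c2) / 2)) := by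
  rw [← toReal_lintegral_limWeight]
  exact tendsto_integral_div

end
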